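/- Let Ω ⊂ ℝ² be a bounded, simply connected open set with smooth boundary containing 0, let α > -1, and let K ∈ C¹(Ω̄) with K > 0 on Ω̄. Then there exists ρ₀ > 0, depending only on Ω, α and K, such that for every λ > 0 and every solution u of the problem -Δu = λ|x|^{2α} K(x) e^{u} in Ω, u = 0 on ∂Ω, one has λ ∫_Ω |x|^{2α} K(x) e^{u(x)} dx ≤ ρ₀. -/

import Mathlib

open MeasureTheory Real Set Metric

noncomputable section

abbrev Plane := EuclideanSpace ℝ (Fin 2)

/-- The Laplace operator on ℝ² (acting on real-valued functions). -/
def lap (u : Plane → ℝ) (x : Plane) : ℝ :=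
  ∑ i, fderiv ℝ (fun y => fderiv ℝ u y (EuclideanSpace.single i 1)) x
    (EuclideanSpace.single i 1)

/-- `Ω` has smooth boundary: near each boundary point, `Ω` is a sublevel set of a smooth
function with nonvanishing differential, whose zero set is the boundary. -/
def SmoothBoundary (Ω : Set Plane) : Prop :=
  ∀ x ∈ frontier Ω, ∃ (U : Set Plane) (f : Plane → ℝ),
    IsOpen U ∧ x ∈ U ∧ ContDiffOn ℝ (⊤ : ℕ∞) f U ∧
    (∀ y ∈ U, fderiv ℝ f y ≠ 0) ∧
    Ω ∩ U = {y ∈ U | f y < 0} ∧ frontier Ω ∩ U = {y ∈ U | f y = 0}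

open Complex in
/-- The Laplacian of a real-valued function on `ℂ`, through iterated Fréchet derivatives. -/
def lapC (u : ℂ → ℝ) (z : ℂ) : ℝ :=
  fderiv ℝ (fun y => fderiv ℝ u y 1) z 1 + fderiv ℝ (fun y => fderiv ℝ u y I) z I

section Calculus

open Filter Topology

variable {u w : ℂ → ℝ} {z : ℂ}

theorem ContDiffAt.fderiv_apply_right (h : ContDiffAt ℝ 2 u z) (v : ℂ) :
    ContDiffAt ℝ 1 (fun y => fderiv ℝ u y v) z :=
  (h.fderiv_right (m := 1) (by norm_num)).clm_apply contDiffAt_const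

theorem ContDiffAt.differentiableAt_fderiv_apply (h : ContDiffAt ℝ 2 u z) (v : ℂ) :
    DifferentiableAt ℝ (fun y => fderiv ℝ u y v) z :=
  (h.fderiv_apply_right v).differentiableAt (by norm_num)

theorem ContDiffAt.eventually_differentiableAt (h : ContDiffAt ℝ 2 u z) :
    ∀ᶠ y in 𝓝 z, DifferentiableAt ℝ u y := by
  filter_upwards [h.eventually (by simp)] with y hy
  exact hy.differentiableAt (by norm_num)

theorem lapC_congr (h : u =ᶠ[𝓝 z] w) : lapC u z = lapC w z := by
  have key : ∀ v : ℂ, (fun y => fderiv ℝ u y v) =ᶠ[𝓝 z] (fun y => fderiv ℝ w y v) := fun v => by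
    filter_upwards [h.fderiv (𝕜 := ℝ)] with y hy using by rw [hy]
  rw [lapC, lapC, (key _).fderiv_eq, (key _).fderiv_eq]

theorem lapC_add (hu : ContDiffAt ℝ 2 u z) (hw : ContDiffAt ℝ 2 w z) :
    lapC (fun y => u y + w y) z = lapC u z + lapC w z := by
  have key : ∀ v : ℂ, fderiv ℝ (fun y => fderiv ℝ (fun y => u y + w y) y v) z v =
      fderiv ℝ (fun y => fderiv ℝ u y v) z v + fderiv ℝ (fun y => fderiv ℝ w y v) z v := by
    intro v
    have h : (fun y => fderiv ℝ (fun y => u y + w y) y v) =ᶠ[𝓝 z]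
        fun y => fderiv ℝ u y v + fderiv ℝ w y v := by
      filter_upwards [hu.eventually_differentiableAt, hw.eventually_differentiableAt] with y h1 h2
      rw [fderiv_fun_add h1 h2]; rfl
    rw [h.fderiv_eq, fderiv_fun_add (hu.differentiableAt_fderiv_apply v)
      (hw.differentiableAt_fderiv_apply v)]; rfl
  simp only [lapC, key]; ring

theorem lapC_const_mul (c : ℝ) (hu : ContDiffAt ℝ 2 u z) :
    lapC (fun y => c * u y) z = c * lapC u z := by
  have key : ∀ v : ℂ, fderiv ℝ (fun y => fderiv ℝ (fun y => c * u y) y v) z v =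
      c * fderiv ℝ (fun y => fderiv ℝ u y v) z v := by
    intro v
    have h : (fun y => fderiv ℝ (fun y => c * u y) y v) =ᶠ[𝓝 z]
        fun y => c * fderiv ℝ u y v := by
      filter_upwards [hu.eventually_differentiableAt] with y h1
      rw [fderiv_const_mul h1]; rfl
    rw [h.fderiv_eq, fderiv_const_mul (hu.differentiableAt_fderiv_apply v)]; rfl
  simp only [lapC, key]; ring

theorem lapC_sub (hu : ContDiffAt ℝ 2 u z) (hw : ContDiffAt ℝ 2 w z) :
    lapC (fun y => u y - w y) z = lapC u z - lapC w z := by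
  have h := lapC_add hu (w := fun y => (-1) * w y) (contDiffAt_const.mul hw)
  rw [lapC_const_mul _ hw] at h
  rw [show (fun y => u y - w y) = fun y => u y + (-1) * w y by ext; ring, h]; ring

theorem lapC_const (c : ℝ) : lapC (fun _ => c) z = 0 := by
  simp [lapC]

open Complex in
theorem lapC_mul (hu : ContDiffAt ℝ 2 u z) (hw : ContDiffAt ℝ 2 w z) :
    lapC (fun y => u y * w y) z = u z * lapC w z + w z * lapC u z +
      2 * (fderiv ℝ u z 1 * fderiv ℝ w z 1 + fderiv ℝ u z I * fderiv ℝ w z I) := by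
  have key : ∀ v : ℂ, fderiv ℝ (fun y => fderiv ℝ (fun y => u y * w y) y v) z v =
      u z * fderiv ℝ (fun y => fderiv ℝ w y v) z v + w z * fderiv ℝ (fun y => fderiv ℝ u y v) z v
      + 2 * (fderiv ℝ u z v * fderiv ℝ w z v) := by
    intro v
    have h : (fun y => fderiv ℝ (fun y => u y * w y) y v) =ᶠ[𝓝 z]
        fun y => u y * fderiv ℝ w y v + w y * fderiv ℝ u y v := by
      filter_upwards [hu.eventually_differentiableAt, hw.eventually_differentiableAt] with y h1 h2
      rw [fderiv_fun_mul h1 h2]; rfl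
    have hu1 := hu.differentiableAt (by norm_num)
    have hw1 := hw.differentiableAt (by norm_num)
    have hu2 := hu.differentiableAt_fderiv_apply v
    have hw2 := hw.differentiableAt_fderiv_apply v
    rw [h.fderiv_eq, fderiv_fun_add (hu1.fun_mul hw2) (hw1.fun_mul hu2), fderiv_fun_mul hu1 hw2,
      fderiv_fun_mul hw1 hu2]
    simp only [add_apply, smul_apply, smul_eq_mul]
    ring
  simp only [lapC, key]; ring

open Complex in
theorem fderiv_re_apply (z v : ℂ) : fderiv ℝ Complex.re z v = v.re := by
  change fderiv ℝ (⇑reCLM) z v = _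
  rw [ContinuousLinearMap.fderiv]; rfl

open Complex in
theorem fderiv_im_apply (z v : ℂ) : fderiv ℝ Complex.im z v = v.im := by
  change fderiv ℝ (⇑imCLM) z v = _
  rw [ContinuousLinearMap.fderiv]; rfl

theorem contDiff_re_two : ContDiff ℝ 2 Complex.re := Complex.reCLM.contDiff
theorem contDiff_im_two : ContDiff ℝ 2 Complex.im := Complex.imCLM.contDiff

theorem lapC_re : lapC Complex.re z = 0 := by simp [lapC, fderiv_re_apply]
theorem lapC_im : lapC Complex.im z = 0 := by simp [lapC, fderiv_im_apply]

/-- The squared distance to `q`. -/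
def distSq (q z : ℂ) : ℝ := (z.re - q.re) * (z.re - q.re) + (z.im - q.im) * (z.im - q.im)

theorem distSq_eq (q z : ℂ) : distSq q z = dist z q ^ 2 := by
  rw [Complex.dist_eq, ← Complex.normSq_eq_norm_sq, Complex.normSq_apply]; simp [distSq]

theorem contDiff_distSq (q : ℂ) : ContDiff ℝ 2 (distSq q) := by
  have h1 := contDiff_re_two
  have h2 := contDiff_im_two
  unfold distSq; fun_prop

theorem lapC_distSq (q : ℂ) : lapC (distSq q) z = 4 := by
  have h1 : ContDiffAt ℝ 2 (fun y : ℂ => y.re - q.re) z :=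
    (contDiff_re_two.sub contDiff_const).contDiffAt
  have h2 : ContDiffAt ℝ 2 (fun y : ℂ => y.im - q.im) z :=
    (contDiff_im_two.sub contDiff_const).contDiffAt
  unfold distSq
  rw [lapC_add (h1.mul h1) (h2.mul h2), lapC_mul h1 h1, lapC_mul h2 h2,
    lapC_sub contDiff_re_two.contDiffAt contDiffAt_const,
    lapC_sub contDiff_im_two.contDiffAt contDiffAt_const, lapC_re, lapC_im, lapC_const, lapC_const]
  have e1 : ∀ v, fderiv ℝ (fun y : ℂ => y.re - q.re) z v = v.re := fun v => by
    rw [fderiv_sub_const]; exact fderiv_re_apply z v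
  have e2 : ∀ v, fderiv ℝ (fun y : ℂ => y.im - q.im) z v = v.im := fun v => by
    rw [fderiv_sub_const]; exact fderiv_im_apply z v
  simp [e1, e2]; norm_num

theorem fderiv_fderiv_line {v : ℂ} (hu : ContDiffAt ℝ 2 u z) :
    deriv (deriv (fun t : ℝ => u (z + t • v))) 0 = fderiv ℝ (fun y => fderiv ℝ u y v) z v := by
  have hl : ∀ t : ℝ, HasDerivAt (fun t : ℝ => z + t • v) v t := fun t => by
    simpa using ((hasDerivAt_id t).smul_const v).const_add z
  have hc : Tendsto (fun t : ℝ => z + t • v) (𝓝 0) (𝓝 z) := by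
    have := (hl 0).continuousAt.tendsto; simpa using this
  have h1 : deriv (fun t : ℝ => u (z + t • v)) =ᶠ[𝓝 0]
      fun t => fderiv ℝ u (z + t • v) v := by
    filter_upwards [hc.eventually hu.eventually_differentiableAt] with t ht
    exact (ht.hasFDerivAt.comp_hasDerivAt t (hl t)).deriv
  rw [h1.deriv_eq]
  have h2 : DifferentiableAt ℝ (fun y => fderiv ℝ u y v) (z + (0 : ℝ) • v) := by
    simpa using hu.differentiableAt_fderiv_apply v
  have := (h2.hasFDerivAt.comp_hasDerivAt (0 : ℝ) (hl 0)).deriv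
  simp only [Function.comp_def, zero_smul, add_zero] at this
  exact this

theorem IsLocalMax.fderiv_fderiv_nonpos (h : IsLocalMax u z) (hu : ContDiffAt ℝ 2 u z) (v : ℂ) :
    fderiv ℝ (fun y => fderiv ℝ u y v) z v ≤ 0 := by
  by_contra! hpos
  have hl : Continuous (fun t : ℝ => z + t • v) := by fun_prop
  have hc : Tendsto (fun t : ℝ => z + t • v) (𝓝 0) (𝓝 z) := by
    have := hl.tendsto 0; simpa using this
  have hmax : IsLocalMax (fun t : ℝ => u (z + t • v)) 0 := by
    have := hc.eventually h
    simpa [IsLocalMax, IsMaxFilter] using this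
  have hcont : ContinuousAt (fun t : ℝ => u (z + t • v)) 0 := by
    refine ContinuousAt.comp (x := (0 : ℝ)) (f := fun t : ℝ => z + t • v) ?_ hl.continuousAt
    simpa using hu.continuousAt
  have h2 := fderiv_fderiv_line (v := v) hu
  have hmin := isLocalMin_of_deriv_deriv_pos (by rw [h2]; exact hpos) hmax.deriv_eq_zero hcont
  have hconst : (fun t : ℝ => u (z + t • v)) =ᶠ[𝓝 0] fun _ => u (z + (0 : ℝ) • v) := by
    filter_upwards [hmax, hmin] with t h1 h2
    exact le_antisymm h1 h2
  have h3 : deriv (fun t : ℝ => u (z + t • v)) =ᶠ[𝓝 0] fun _ => 0 := by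
    have := hconst.deriv
    simpa using this
  rw [h3.deriv_eq] at h2
  simp at h2
  linarith

theorem IsLocalMax.lapC_nonpos (h : IsLocalMax u z) (hu : ContDiffAt ℝ 2 u z) : lapC u z ≤ 0 :=
  add_nonpos (h.fderiv_fderiv_nonpos hu _) (h.fderiv_fderiv_nonpos hu _)

/-- Maximum principle for strict subsolutions. -/
theorem le_of_lapC_pos {K G : Set ℂ} {c : ℝ} (hK : IsCompact K) (hG : IsOpen G) (hGK : G ⊆ K)
    (hcont : ContinuousOn u K) (hbd : ∀ x ∈ K, x ∉ G → u x ≤ c)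
    (hlap : ∀ x ∈ G, u x > c → ContDiffAt ℝ 2 u x ∧ 0 < lapC u x) : ∀ x ∈ K, u x ≤ c := by
  intro x hx
  obtain ⟨m, hm, hmax⟩ := hK.exists_isMaxOn ⟨x, hx⟩ hcont
  refine (hmax hx).trans ?_
  by_contra! hpos
  have hmG : m ∈ G := by
    by_contra h
    exact absurd (hbd m hm h) (not_le.mpr hpos)
  obtain ⟨h1, h2⟩ := hlap m hmG hpos
  have : IsLocalMax u m := by
    filter_upwards [hG.mem_nhds hmG] with y hy using hmax (hGK hy)
  exact absurd (this.lapC_nonpos h1) (not_le.mpr h2)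

theorem lapC_comp_clm (L : ℂ →L[ℝ] ℂ) (hu : ContDiffAt ℝ 2 u (L z)) (v : ℂ) :
    fderiv ℝ (fun y => fderiv ℝ (fun x => u (L x)) y v) z v =
      fderiv ℝ (fun y => fderiv ℝ u y (L v)) (L z) (L v) := by
  have h : (fun y => fderiv ℝ (fun x => u (L x)) y v) =ᶠ[𝓝 z]
      fun y => fderiv ℝ u (L y) (L v) := by
    have := L.continuous.continuousAt.eventually hu.eventually_differentiableAt
    filter_upwards [this] with y hy
    have := (hy.hasFDerivAt.comp y L.hasFDerivAt).fderiv
    simp only [Function.comp_def] at this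
    rw [this]; rfl
  rw [h.fderiv_eq]
  have := ((hu.differentiableAt_fderiv_apply (L v)).hasFDerivAt.comp z L.hasFDerivAt).fderiv
  simp only [Function.comp_def] at this
  rw [this]; rfl

theorem fderiv_fderiv_neg (v : ℂ) : fderiv ℝ (fun y => fderiv ℝ u y (-v)) z (-v) =
    fderiv ℝ (fun y => fderiv ℝ u y v) z v := by
  simp only [map_neg, fderiv_fun_neg]
  simp

theorem lapC_comp_add (s : ℂ) : lapC (fun x => u (x + s)) z = lapC u (z + s) := by
  have key : ∀ v : ℂ, fderiv ℝ (fun y => fderiv ℝ u (y + s) v) z =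
      fderiv ℝ (fun y => fderiv ℝ u y v) (z + s) :=
    fun v => fderiv_comp_add_right (f := fun y => fderiv ℝ u y v) s
  simp only [lapC, fderiv_comp_add_right s, key]

end Calculus

section GradientEstimate

open Filter Topology

variable {w : ℂ → ℝ} {r S K : ℝ}

/-- The reflection across the imaginary axis. -/
def reflRe : ℂ →L[ℝ] ℂ := -(Complex.conjCLE : ℂ →L[ℝ] ℂ)

theorem reflRe_apply (z : ℂ) : reflRe z = -(starRingEnd ℂ z) := rfl

/-- Rotation by a right angle. -/
def rotI : ℂ →L[ℝ] ℂ := ContinuousLinearMap.mul ℝ ℂ Complex.I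

theorem rotI_apply (z : ℂ) : rotI z = Complex.I * z := rfl

theorem lapC_comp_reflRe {z : ℂ} (hw : ContDiffAt ℝ 2 w (reflRe z)) :
    lapC (fun x => w (reflRe x)) z = lapC w (reflRe z) := by
  have h1 : reflRe 1 = -1 := by simp [reflRe_apply]
  have h2 : reflRe Complex.I = Complex.I := by simp [reflRe_apply]
  rw [lapC, lapC_comp_clm _ hw, lapC_comp_clm _ hw, h1, h2, fderiv_fderiv_neg]; rfl

theorem lapC_comp_rotI {z : ℂ} (hw : ContDiffAt ℝ 2 w (rotI z)) :
    lapC (fun x => w (rotI x)) z = lapC w (rotI z) := by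
  have h1 : rotI 1 = Complex.I := by simp [rotI_apply]
  have h2 : rotI Complex.I = -1 := by simp [rotI_apply]
  rw [lapC, lapC_comp_clm _ hw, lapC_comp_clm _ hw, h1, h2, fderiv_fderiv_neg, add_comm]; rfl

theorem fderiv_one_le_of_abs_lapC_lt (hr : 0 < r) (hw : ∀ x ∈ ball (0 : ℂ) r, ContDiffAt ℝ 2 w x)
    {c : ℝ} (hS : ∀ x ∈ ball (0 : ℂ) r, |w x - c| ≤ S) (hK : ∀ x ∈ ball (0 : ℂ) r, |lapC w x| < K) :
    fderiv ℝ w 0 1 ≤ 2 * S / r + K * r := by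
  have hS0 : 0 ≤ S := (abs_nonneg _).trans (hS 0 (mem_ball_self hr))
  have hK0 : 0 < K := (abs_nonneg _).trans_lt (hK 0 (mem_ball_self hr))
  have key : ∀ r' ∈ Ioo 0 r, fderiv ℝ w 0 1 ≤ (2 * (S / r' ^ 2) + K / 2 + K / 2) * r' := by
    intro r' ⟨hr'0, hr'⟩
    set B := 2 * S / r' ^ 2
    have hB : 0 ≤ B := by positivity
    set E := 2 * B + K
    have hsub : closedBall (0 : ℂ) r' ⊆ ball 0 r := closedBall_subset_ball hr'
    have hrefl : ∀ x : ℂ, ‖reflRe x‖ = ‖x‖ := fun x => by simp [reflRe_apply]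
    let φ : ℂ → ℝ := fun x =>
      (w x - w (reflRe x)) - (E * r' * x.re + (B * distSq 0 x - E * (x.re * x.re)))
    have hφ1 : ∀ x ∈ ball (0 : ℂ) r, ContDiffAt ℝ 2 φ x ∧
        lapC φ x = lapC w x - lapC w (reflRe x) - (4 * B - 2 * E) := by
      intro x hx
      have hx' : reflRe x ∈ ball (0 : ℂ) r := by
        rw [mem_ball_zero_iff] at hx ⊢; rwa [hrefl]
      have c1 := hw x hx
      have c2 : ContDiffAt ℝ 2 (fun x => w (reflRe x)) x :=
        (hw _ hx').comp x reflRe.contDiff.contDiffAt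
      have c3 : ContDiffAt ℝ 2 Complex.re x := contDiff_re_two.contDiffAt
      have c4 : ContDiffAt ℝ 2 (distSq 0) x := (contDiff_distSq 0).contDiffAt
      have c5 : ContDiffAt ℝ 2 (fun x : ℂ => E * r' * x.re) x := contDiffAt_const.mul c3
      have c6 : ContDiffAt ℝ 2 (fun x : ℂ => B * distSq 0 x) x := contDiffAt_const.mul c4
      have c7 : ContDiffAt ℝ 2 (fun x : ℂ => x.re * x.re) x := c3.mul c3
      have c8 : ContDiffAt ℝ 2 (fun x : ℂ => E * (x.re * x.re)) x := contDiffAt_const.mul c7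
      refine ⟨(c1.sub c2).sub (c5.add (c6.sub c8)), ?_⟩
      rw [lapC_sub (c1.sub c2) (c5.add (c6.sub c8)), lapC_sub c1 c2, lapC_comp_reflRe (hw _ hx'),
        lapC_add c5 (c6.sub c8), lapC_sub c6 c8, lapC_const_mul _ c3, lapC_const_mul _ c4,
        lapC_const_mul _ c7, lapC_mul c3 c3, lapC_re, lapC_distSq]
      simp [fderiv_re_apply]; ring
    have hle : ∀ x ∈ closedBall (0 : ℂ) r' ∩ {x | 0 ≤ x.re}, φ x ≤ 0 := by
      refine le_of_lapC_pos (G := ball (0 : ℂ) r' ∩ {x | 0 < x.re})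
        ((isCompact_closedBall _ _).inter_right (isClosed_le continuous_const Complex.continuous_re))
        (isOpen_ball.inter (isOpen_lt continuous_const Complex.continuous_re))
        (fun x hx => ⟨ball_subset_closedBall hx.1, le_of_lt (α := ℝ) hx.2⟩)
        (fun x hx => (hφ1 x (hsub hx.1)).1.continuousAt.continuousWithinAt) ?_ ?_
      · rintro x ⟨hx1, hx2⟩ hx3
        simp only [Set.mem_ofPred_eq] at hx2
        rw [mem_closedBall_zero_iff] at hx1
        by_cases h0 : x.re = 0
        · have : reflRe x = x := by
            apply Complex.ext <;> simp [reflRe_apply, h0]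
          simp only [φ, this, h0]
          have : 0 ≤ distSq 0 x := by rw [distSq_eq]; positivity
          nlinarith [mul_nonneg hB this]
        · have hpos : 0 < x.re := lt_of_le_of_ne hx2 (Ne.symm h0)
          have hn : ‖x‖ = r' := by
            by_contra hne
            exact hx3 ⟨mem_ball_zero_iff.2 (lt_of_le_of_ne hx1 hne), hpos⟩
          have hd : distSq 0 x = r' ^ 2 := by rw [distSq_eq, dist_zero_right, hn]
          have hx4 : x ∈ ball (0 : ℂ) r := mem_ball_zero_iff.2 (hn ▸ hr')
          have hx5 : reflRe x ∈ ball (0 : ℂ) r := by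
            rw [mem_ball_zero_iff] at hx4 ⊢; rwa [hrefl]
          have a1 := abs_le.1 (hS _ hx4)
          have a2 := abs_le.1 (hS _ hx5)
          have hre : x.re ≤ r' := (Complex.re_le_norm x).trans hx1
          have hBr : B * r' ^ 2 = 2 * S := by simp only [B]; field_simp
          have : 0 ≤ E * (x.re * (r' - x.re)) := by
            have : 0 ≤ r' - x.re := by linarith
            have : 0 ≤ E := by positivity
            positivity
          simp only [φ, hd, hBr]
          nlinarith
      · rintro x ⟨hx1, hx2⟩ -
        have hx4 : x ∈ ball (0 : ℂ) r := hsub (ball_subset_closedBall hx1)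
        have hx5 : reflRe x ∈ ball (0 : ℂ) r := by
          rw [mem_ball_zero_iff] at hx4 ⊢; rwa [hrefl]
        refine ⟨(hφ1 x hx4).1, ?_⟩
        rw [(hφ1 x hx4).2]
        have a1 := abs_lt.1 (hK _ hx4)
        have a2 := abs_lt.1 (hK _ hx5)
        simp only [E]; linarith
    have h0r : (0 : ℂ) ∈ ball (0 : ℂ) r := mem_ball_self hr
    have hderiv : HasDerivAt (fun t : ℝ => φ ((t : ℝ) • (1 : ℂ))) (fderiv ℝ φ 0 1) 0 := by
      have hl : HasDerivAt (fun t : ℝ => (t : ℝ) • (1 : ℂ)) 1 0 := by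
        simpa using (hasDerivAt_id (0 : ℝ)).smul_const (1 : ℂ)
      have hd : DifferentiableAt ℝ φ ((0 : ℝ) • (1 : ℂ)) := by
        simpa using (hφ1 0 h0r).1.differentiableAt (by norm_num)
      have := hd.hasFDerivAt.comp_hasDerivAt (0 : ℝ) hl
      simpa [Function.comp_def] using this
    have hφ0 : φ 0 = 0 := by simp [φ, distSq, reflRe_apply]
    have hneg : fderiv ℝ φ 0 1 ≤ 0 := by
      have h1 := hderiv.tendsto_slope_zero_right
      refine le_of_tendsto h1 ?_
      filter_upwards [Ioo_mem_nhdsGT hr'0] with t ht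
      have : φ ((t : ℝ) • (1 : ℂ)) ≤ 0 := by
        apply hle
        constructor
        · rw [mem_closedBall_zero_iff]; simp [abs_of_pos ht.1, ht.2.le]
        · simp [ht.1.le]
      simp only [zero_add, zero_smul, hφ0, sub_zero, smul_eq_mul]
      exact mul_nonpos_of_nonneg_of_nonpos (inv_nonneg.2 ht.1.le) this
    have hcomp : fderiv ℝ φ 0 1 = 2 * fderiv ℝ w 0 1 - E * r' := by
      have d1 : HasFDerivAt w (fderiv ℝ w 0) 0 :=
        ((hw 0 h0r).differentiableAt (by norm_num)).hasFDerivAt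
      have d2 : HasFDerivAt (fun x => w (reflRe x)) ((fderiv ℝ w 0).comp reflRe) 0 := by
        have d1' : HasFDerivAt w (fderiv ℝ w 0) (reflRe 0) := by simpa using d1
        exact d1'.comp 0 reflRe.hasFDerivAt
      have d3 : HasFDerivAt Complex.re Complex.reCLM (0 : ℂ) := Complex.reCLM.hasFDerivAt
      have d4 : HasFDerivAt Complex.im Complex.imCLM (0 : ℂ) := Complex.imCLM.hasFDerivAt
      have d5 : HasFDerivAt φ _ 0 := (d1.sub d2).sub ((d3.const_mul (E * r')).add
        (((((d3.sub_const (0 : ℂ).re).mul (d3.sub_const (0 : ℂ).re)).add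
          ((d4.sub_const (0 : ℂ).im).mul (d4.sub_const (0 : ℂ).im))).const_mul B).sub
          ((d3.mul d3).const_mul E)))
      rw [d5.fderiv]
      simp [reflRe_apply]; ring
    rw [hcomp] at hneg
    have : (2 * (S / r' ^ 2) + K / 2 + K / 2) * r' = (E * r') / 2 + (K / 2) * r' := by
      simp only [E, B]; ring
    rw [this]
    have : 0 ≤ K / 2 * r' := by positivity
    linarith
  have hlim : Tendsto (fun r' : ℝ => (2 * (S / r' ^ 2) + K / 2 + K / 2) * r') (𝓝[<] r)
      (𝓝 ((2 * (S / r ^ 2) + K / 2 + K / 2) * r)) := by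
    apply tendsto_nhdsWithin_of_tendsto_nhds
    apply ContinuousAt.tendsto (f := fun r' : ℝ => (2 * (S / r' ^ 2) + K / 2 + K / 2) * r')
    have : r ^ 2 ≠ 0 := by positivity
    fun_prop (disch := assumption)
  have := ge_of_tendsto hlim (by filter_upwards [Ioo_mem_nhdsLT hr] with r' h using key r' h)
  have e : (2 * (S / r ^ 2) + K / 2 + K / 2) * r = 2 * S / r + K * r := by
    have : r ≠ 0 := hr.ne'
    field_simp
    ring
  rwa [e] at this

/-- Interior gradient estimate for functions with bounded Laplacian. -/
theorem norm_fderiv_le_of_abs_lapC_lt {x₀ : ℂ} (hr : 0 < r)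
    (hw : ∀ x ∈ ball x₀ r, ContDiffAt ℝ 2 w x) {c : ℝ} (hS : ∀ x ∈ ball x₀ r, |w x - c| ≤ S)
    (hK : ∀ x ∈ ball x₀ r, |lapC w x| < K) :
    ‖fderiv ℝ w x₀‖ ≤ 2 * (2 * S / r + K * r) := by
  have main : ∀ w : ℂ → ℝ, (∀ x ∈ ball (0 : ℂ) r, ContDiffAt ℝ 2 w x) → ∀ c : ℝ,
      (∀ x ∈ ball (0 : ℂ) r, |w x - c| ≤ S) → (∀ x ∈ ball (0 : ℂ) r, |lapC w x| < K) →
      |fderiv ℝ w 0 1| ≤ 2 * S / r + K * r := by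
    intro w hw c hS hK
    rw [abs_le]
    refine ⟨?_, fderiv_one_le_of_abs_lapC_lt hr hw hS hK⟩
    have h2 : ∀ x ∈ ball (0 : ℂ) r, lapC (fun y => (-1) * w y) x = - lapC w x := fun x hx => by
      rw [lapC_const_mul _ (hw x hx)]; ring
    have := fderiv_one_le_of_abs_lapC_lt (w := fun y => (-1) * w y) (S := S) (K := K) (c := -c) hr
      (fun x hx => contDiffAt_const.mul (hw x hx))
      (fun x hx => by
        rw [show -1 * w x - -c = -(w x - c) by ring, abs_neg]; exact hS x hx)
      (fun x hx => by rw [h2 x hx, abs_neg]; exact hK x hx)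
    rw [fderiv_const_mul ((hw 0 (mem_ball_self hr)).differentiableAt (by norm_num))] at this
    simp at this
    linarith
  have hmem : ∀ x ∈ ball (0 : ℂ) r, x + x₀ ∈ ball x₀ r := fun x hx => by
    rw [mem_ball_zero_iff] at hx
    simpa [mem_ball, dist_eq_norm] using hx
  set w₁ : ℂ → ℝ := fun x => w (x + x₀)
  have h1 : ∀ x ∈ ball (0 : ℂ) r, ContDiffAt ℝ 2 w₁ x := fun x hx =>
    (hw _ (hmem x hx)).comp x (contDiffAt_id.add contDiffAt_const)
  have h2 : ∀ x ∈ ball (0 : ℂ) r, |lapC w₁ x| < K := fun x hx => by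
    rw [lapC_comp_add]; exact hK _ (hmem x hx)
  have e1 := main w₁ h1 c (fun x hx => hS _ (hmem x hx)) h2
  have hrot : ∀ x ∈ ball (0 : ℂ) r, rotI x ∈ ball (0 : ℂ) r := fun x hx => by
    rw [mem_ball_zero_iff] at hx ⊢; simpa [rotI_apply] using hx
  have e2 := main (fun x => w₁ (rotI x))
    (fun x hx => (h1 _ (hrot x hx)).comp x rotI.contDiff.contDiffAt) c
    (fun x hx => hS _ (hmem _ (hrot x hx)))
    (fun x hx => by rw [lapC_comp_rotI (h1 _ (hrot x hx))]; exact h2 _ (hrot x hx))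
  have e3 : fderiv ℝ (fun x => w₁ (rotI x)) 0 1 = fderiv ℝ w₁ 0 Complex.I := by
    have d : HasFDerivAt w₁ (fderiv ℝ w₁ 0) (rotI 0) := by
      simpa using ((h1 0 (mem_ball_self hr)).differentiableAt (by norm_num)).hasFDerivAt
    have := (d.comp 0 rotI.hasFDerivAt).fderiv
    simp only [Function.comp_def] at this
    rw [this]; simp [rotI_apply]
  have e4 : fderiv ℝ w₁ 0 = fderiv ℝ w x₀ := by
    simp only [w₁]; rw [fderiv_comp_add_right x₀, zero_add]
  rw [e3] at e2
  rw [e4] at e1 e2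
  have hb : 0 ≤ 2 * S / r + K * r := (abs_nonneg _).trans e1
  refine ContinuousLinearMap.opNorm_le_bound _ (by positivity) fun v => ?_
  have hv : fderiv ℝ w x₀ v = v.re * fderiv ℝ w x₀ 1 + v.im * fderiv ℝ w x₀ Complex.I := by
    have : v = v.re • (1 : ℂ) + v.im • Complex.I := by
      simp [Complex.re_add_im]
    conv_lhs => rw [this]
    rw [map_add, map_smul, map_smul]; rfl
  rw [hv, Real.norm_eq_abs]
  calc _ ≤ |v.re| * |fderiv ℝ w x₀ 1| + |v.im| * |fderiv ℝ w x₀ Complex.I| := by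
        rw [← abs_mul, ← abs_mul]; exact abs_add_le _ _
    _ ≤ ‖v‖ * (2 * S / r + K * r) + ‖v‖ * (2 * S / r + K * r) := by
        gcongr
        · exact Complex.abs_re_le_norm v
        · exact Complex.abs_im_le_norm v
    _ = _ := by ring

end GradientEstimate

section Boundary

open Filter Topology

/-- A defining function of `Ω` near the boundary point `p`, increasing in the direction `e`, with
quantitative control. -/
structure BdryChart (Ω : Set ℂ) (p e : ℂ) where
  ρ : ℂ → ℝ
  R : ℝ
  m : ℝ
  L : ℝ
  N : ℝ
  isOpen : IsOpen Ω
  mem : p ∈ frontier Ω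
  norm_e : ‖e‖ = 1
  R_pos : 0 < R
  m_pos : 0 < m
  L_pos : 0 < L
  N_nonneg : 0 ≤ N
  smooth : ∀ x ∈ ball p R, ContDiffAt ℝ 2 ρ x
  mem_iff : ∀ x ∈ ball p R, x ∈ Ω ↔ 0 < ρ x
  frontier_iff : ∀ x ∈ ball p R, x ∈ frontier Ω ↔ ρ x = 0
  le_deriv : ∀ x ∈ ball p R, m ≤ fderiv ℝ ρ x e
  norm_le : ∀ x ∈ ball p R, ‖fderiv ℝ ρ x‖ ≤ L
  small : ∀ x ∈ ball p R, N * |ρ x| ≤ 1 / 2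
  lap_sub : ∀ x ∈ ball p R, lapC (fun y => ρ y - N * (ρ y * ρ y)) x ≤ -1
  lap_add : ∀ x ∈ ball p R, 5 ≤ lapC (fun y => ρ y + N * (ρ y * ρ y)) x

namespace BdryChart

variable {Ω : Set ℂ} {p e : ℂ} (c : BdryChart Ω p e)

theorem lipschitz {x y : ℂ} (hx : x ∈ ball p c.R) (hy : y ∈ ball p c.R) :
    |c.ρ y - c.ρ x| ≤ c.L * dist y x := by
  rw [dist_eq_norm, ← Real.norm_eq_abs]
  exact (convex_ball p c.R).norm_image_sub_le_of_norm_fderiv_le (𝕜 := ℝ)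
    (fun z hz => (c.smooth z hz).differentiableAt (by norm_num)) (fun z hz => c.norm_le z hz) hx hy

theorem zero_at : c.ρ p = 0 := (c.frontier_iff p (mem_ball_self c.R_pos)).1 c.mem

theorem abs_le {x : ℂ} (hx : x ∈ ball p c.R) : |c.ρ x| ≤ c.L * dist x p := by
  simpa [c.zero_at] using c.lipschitz (mem_ball_self c.R_pos) hx

theorem segment_mem {x : ℂ} {s t : ℝ} {r : ℝ} (hx : x ∈ ball p r) (hxs : x + (s : ℂ) * e ∈ ball p r)
    (ht : t ∈ Icc 0 s) : x + (t : ℂ) * e ∈ ball p r := by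
  have hs : 0 ≤ s := ht.1.trans ht.2
  rcases hs.eq_or_lt with h | h
  · have : t = 0 := le_antisymm (h ▸ ht.2) ht.1
    simpa [this] using hx
  · have := (convex_ball p r).add_smul_sub_mem hx hxs (t := t / s)
      ⟨by have := ht.1; positivity, by rw [div_le_one h]; exact ht.2⟩
    have e1 : x + (t / s) • (x + (s : ℂ) * e - x) = x + (t : ℂ) * e := by
      have : (s : ℂ) ≠ 0 := by exact_mod_cast h.ne'
      rw [Complex.real_smul]; push_cast; field_simp; ring
    rwa [e1] at this

theorem hasDerivAt_line {w : ℂ → ℝ} {x e : ℂ} {t : ℝ} (h : DifferentiableAt ℝ w (x + (t : ℂ) * e)) :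
    HasDerivAt (fun t : ℝ => w (x + (t : ℂ) * e)) (fderiv ℝ w (x + (t : ℂ) * e) e) t := by
  have h1 : HasDerivAt (fun t : ℝ => x + (t : ℂ) * e) e t := by
    have := ((Complex.ofRealCLM.hasDerivAt (x := t)).mul_const e).const_add x
    simpa using this
  exact h.hasFDerivAt.comp_hasDerivAt t h1

theorem mono {x : ℂ} {s : ℝ} (hs : 0 ≤ s) (hx : x ∈ ball p c.R)
    (hxs : x + (s : ℂ) * e ∈ ball p c.R) : c.ρ x + c.m * s ≤ c.ρ (x + (s : ℂ) * e) := by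
  have hd : ∀ t ∈ Icc 0 s, HasDerivAt (fun t : ℝ => c.ρ (x + (t : ℂ) * e))
      (fderiv ℝ c.ρ (x + (t : ℂ) * e) e) t := fun t ht =>
    hasDerivAt_line ((c.smooth _ (segment_mem hx hxs ht)).differentiableAt (by norm_num))
  have := (convex_Icc 0 s).mul_sub_le_image_sub_of_le_deriv
    (f := fun t : ℝ => c.ρ (x + (t : ℂ) * e))
    (fun t ht => (hd t ht).continuousAt.continuousWithinAt)
    (fun t ht => (hd t (interior_subset ht)).differentiableAt.differentiableWithinAt)
    (C := c.m) (fun t ht => by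
      rw [(hd t (interior_subset ht)).deriv]
      exact c.le_deriv _ (segment_mem hx hxs (interior_subset ht)))
    0 (by simp [hs]) s (by simp [hs]) hs
  simp at this
  linarith

/-- Near `p`, every point of `Ω` is close to a boundary point in the direction `-e`. -/
theorem exists_foot {ε : ℝ} (hε : 0 < ε) (hεR : 2 * ε < c.R) : ∃ r > 0, r ≤ ε ∧
    ∀ x ∈ ball p r, x ∈ Ω → ∃ q : ℂ, ∃ s : ℝ, q ∈ frontier Ω ∧ dist x q = s ∧ 0 ≤ s ∧
      s ≤ c.ρ x / c.m ∧ s ≤ ε ∧ q ∈ ball p (2 * ε) := by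
  have hm := c.m_pos
  have hL := c.L_pos
  refine ⟨ε / (1 + c.L / c.m), by positivity, ?_, ?_⟩
  · apply div_le_self hε.le
    have : 0 < c.L / c.m := by positivity
    linarith
  intro x hx hxΩ
  have hD : 0 < 1 + c.L / c.m := by positivity
  have hx1 : dist x p * (1 + c.L / c.m) < ε := by
    rw [mem_ball] at hx
    rwa [lt_div_iff₀ hD] at hx
  have hxp : dist x p < ε := by
    have : 0 ≤ dist x p * (c.L / c.m) := by positivity
    linarith
  have hxR : x ∈ ball p c.R := by rw [mem_ball]; linarith
  have hρ := (c.mem_iff x hxR).1 hxΩ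
  have hρL := c.abs_le hxR
  rw [abs_of_pos hρ] at hρL
  set s₁ := c.ρ x / c.m
  have hs₁ : 0 < s₁ := by positivity
  have hs₁' : s₁ ≤ dist x p * (c.L / c.m) := by
    simp only [s₁]; rw [div_le_iff₀ hm]
    calc _ ≤ c.L * dist x p := hρL
      _ = _ := by field_simp
  have hs₁ε : s₁ < ε := by
    have := dist_nonneg (x := x) (y := p)
    linarith
  have hball : ∀ s ∈ Icc 0 s₁, x + ((-s : ℝ) : ℂ) * e ∈ ball p (2 * ε) := fun s hs => by
    rw [mem_ball]
    calc dist (x + ((-s : ℝ) : ℂ) * e) p ≤ dist (x + ((-s : ℝ) : ℂ) * e) x + dist x p :=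
          dist_triangle _ _ _
      _ = s + dist x p := by
          rw [dist_eq_norm]; simp [c.norm_e, abs_of_nonneg hs.1]
      _ < 2 * ε := by linarith [hs.2]
  have hballR : ∀ s ∈ Icc 0 s₁, x + ((-s : ℝ) : ℂ) * e ∈ ball p c.R := fun s hs =>
    ball_subset_ball hεR.le (hball s hs)
  have hcont : ContinuousOn (fun s : ℝ => c.ρ (x + ((-s : ℝ) : ℂ) * e)) (Icc 0 s₁) := by
    intro s hs
    apply ContinuousAt.continuousWithinAt
    exact ContinuousAt.comp (g := c.ρ) (f := fun s : ℝ => x + ((-s : ℝ) : ℂ) * e)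
      (c.smooth _ (hballR s hs)).continuousAt (by fun_prop)
  have hend : c.ρ (x + ((-s₁ : ℝ) : ℂ) * e) ≤ 0 := by
    have h1 := hballR s₁ ⟨hs₁.le, le_rfl⟩
    have h2 : x + ((-s₁ : ℝ) : ℂ) * e + (s₁ : ℂ) * e = x := by push_cast; ring
    have := c.mono hs₁.le h1 (by rwa [h2])
    rw [h2] at this
    have : c.m * s₁ = c.ρ x := by simp only [s₁]; field_simp
    linarith
  obtain ⟨s, hs, hs0⟩ := intermediate_value_Icc' hs₁.le hcont
    (show (0 : ℝ) ∈ Icc _ _ from ⟨hend, by simpa using hρ.le⟩)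
  refine ⟨x + ((-s : ℝ) : ℂ) * e, s, (c.frontier_iff _ (hballR s hs)).2 hs0, ?_, hs.1, hs.2,
    by linarith [hs.2], hball s hs⟩
  rw [dist_comm, dist_eq_norm]; simp [c.norm_e, abs_of_nonneg hs.1]

/-- Continuity up to the boundary, interior regularity and zero boundary values near `p`. -/
structure Data (c : BdryChart Ω p e) (w : ℂ → ℝ) (r₀ : ℝ) : Prop where
  pos : 0 < r₀
  le : r₀ ≤ c.R
  cont : ContinuousOn w (closure Ω ∩ ball p r₀)
  smooth : ∀ x ∈ Ω ∩ ball p r₀, ContDiffAt ℝ 2 w x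
  zero : ∀ x ∈ frontier Ω ∩ ball p r₀, w x = 0

theorem Data.shrink {c : BdryChart Ω p e} {w : ℂ → ℝ} {r₀ r : ℝ} (d : c.Data w r₀) (hr : 0 < r)
    (h : r ≤ r₀) : c.Data w r where
  pos := hr
  le := h.trans d.le
  cont := d.cont.mono (inter_subset_inter_right _ (ball_subset_ball h))
  smooth x hx := d.smooth x ⟨hx.1, ball_subset_ball h hx.2⟩
  zero x hx := d.zero x ⟨hx.1, ball_subset_ball h hx.2⟩

variable {w : ℂ → ℝ} {r₀ : ℝ}

theorem mem_frontier_of (c : BdryChart Ω p e) {x : ℂ} (h : x ∈ closure Ω) (h' : x ∉ Ω) :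
    x ∈ frontier Ω := by
  rw [c.isOpen.frontier_eq]; exact ⟨h, h'⟩

theorem nonneg_of_closure {x : ℂ} (hx : x ∈ ball p c.R) (h : x ∈ closure Ω) : 0 ≤ c.ρ x := by
  by_cases h' : x ∈ Ω
  · exact ((c.mem_iff x hx).1 h').le
  · exact ((c.frontier_iff x hx).1 (c.mem_frontier_of h h')).ge

theorem contDiffAt_sub {x : ℂ} (hx : x ∈ ball p c.R) :
    ContDiffAt ℝ 2 (fun y => c.ρ y - c.N * (c.ρ y * c.ρ y)) x :=
  have := c.smooth x hx
  this.sub (contDiffAt_const.mul (this.mul this))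

theorem contDiffAt_add {x : ℂ} (hx : x ∈ ball p c.R) :
    ContDiffAt ℝ 2 (fun y => c.ρ y + c.N * (c.ρ y * c.ρ y)) x :=
  have := c.smooth x hx
  this.add (contDiffAt_const.mul (this.mul this))

theorem bounds {x : ℂ} (hx : x ∈ ball p c.R) (h : 0 ≤ c.ρ x) :
    0 ≤ c.ρ x - c.N * (c.ρ x * c.ρ x) ∧ c.ρ x - c.N * (c.ρ x * c.ρ x) ≤ c.ρ x ∧
    c.ρ x ≤ c.ρ x + c.N * (c.ρ x * c.ρ x) ∧ c.ρ x + c.N * (c.ρ x * c.ρ x) ≤ 3 / 2 * c.ρ x := by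
  have h1 := c.small x hx
  rw [abs_of_nonneg h] at h1
  have h2 : c.N * (c.ρ x * c.ρ x) ≤ 1 / 2 * c.ρ x := by
    calc _ = (c.N * c.ρ x) * c.ρ x := by ring
      _ ≤ _ := by gcongr
  have h3 : 0 ≤ c.N * (c.ρ x * c.ρ x) := mul_nonneg c.N_nonneg (mul_nonneg h h)
  refine ⟨by linarith, by linarith, by linarith, by linarith⟩

theorem le_const_mul (d : c.Data w r₀) {S K : ℝ} (hS : 0 ≤ S) (hK : 0 ≤ K)
    (hwS : ∀ x ∈ Ω ∩ ball p r₀, w x ≤ S) (hlap : ∀ x ∈ Ω ∩ ball p r₀, -K < lapC w x) :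
    ∃ C ≥ 0, ∃ r > 0, r ≤ r₀ ∧ ∀ x ∈ Ω ∩ ball p r, w x ≤ C * c.ρ x := by
  have hr₀ := d.pos
  have hrR := d.le
  have hm := c.m_pos
  set ε := r₀ / 4
  have hε : 0 < ε := by positivity
  have hεr : 4 * ε = r₀ := by simp only [ε]; ring
  obtain ⟨r, hr, hrε, hfoot⟩ := c.exists_foot hε (by linarith)
  set B := S / ε ^ 2
  have hB : 0 ≤ B := by positivity
  have hBS : B * ε ^ 2 = S := by simp only [B]; field_simp
  set A := K + 4 * B
  have hA : 0 ≤ A := by positivity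
  refine ⟨A + B * (ε / c.m), by positivity, r, hr, by linarith, ?_⟩
  rintro x ⟨hxΩ, hxr⟩
  obtain ⟨q, s, hq, hqs, hs0, hs1, hs2, hqp⟩ := hfoot x hxr hxΩ
  have hsub : closedBall q ε ⊆ ball p r₀ := by
    intro y hy
    rw [mem_ball] at *; rw [mem_closedBall] at hy
    linarith [dist_triangle y q p]
  have hsubR : closedBall q ε ⊆ ball p c.R := hsub.trans (ball_subset_ball hrR)
  set b : ℂ → ℝ := fun y => A * (c.ρ y - c.N * (c.ρ y * c.ρ y)) + B * distSq q y
  have hbc : ∀ y ∈ ball p c.R, ContDiffAt ℝ 2 b y := fun y hy =>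
    (contDiffAt_const.mul (c.contDiffAt_sub hy)).add
      (contDiffAt_const.mul (contDiff_distSq q).contDiffAt)
  have hmain := le_of_lapC_pos (u := fun y => w y - b y) (c := 0)
    (K := closure Ω ∩ closedBall q ε) (G := Ω ∩ ball q ε)
    ((isCompact_closedBall q ε).inter_left isClosed_closure)
    (c.isOpen.inter isOpen_ball)
    (inter_subset_inter subset_closure ball_subset_closedBall)
    ((d.cont.mono (inter_subset_inter_right _ hsub)).sub
      (fun y hy => (hbc y (hsubR hy.2)).continuousAt.continuousWithinAt))
    (by
      rintro y ⟨hy1, hy2⟩ hyG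
      have hyρ := c.nonneg_of_closure (hsubR hy2) hy1
      have hb1 := (c.bounds (hsubR hy2) hyρ).1
      have hb2 : 0 ≤ distSq q y := by rw [distSq_eq]; positivity
      by_cases hyΩ : y ∈ Ω
      · have : dist y q = ε := by
          by_contra hne
          exact hyG ⟨hyΩ, mem_ball.2 (lt_of_le_of_ne (mem_closedBall.1 hy2) hne)⟩
        have h3 : distSq q y = ε ^ 2 := by rw [distSq_eq, this]
        have := hwS y ⟨hyΩ, hsub hy2⟩
        simp only [b, h3, hBS]
        nlinarith [mul_nonneg hA hb1]
      · rw [d.zero y ⟨c.mem_frontier_of hy1 hyΩ, hsub hy2⟩]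
        simp only [b]
        nlinarith [mul_nonneg hA hb1, mul_nonneg hB hb2])
    (by
      rintro y ⟨hyΩ, hyq⟩ -
      have hyR := hsubR (ball_subset_closedBall hyq)
      have hwy := d.smooth y ⟨hyΩ, hsub (ball_subset_closedBall hyq)⟩
      refine ⟨hwy.sub (hbc y hyR), ?_⟩
      have e1 : lapC b y = A * lapC (fun y => c.ρ y - c.N * (c.ρ y * c.ρ y)) y + B * 4 := by
        simp only [b]
        rw [lapC_add (contDiffAt_const.mul (c.contDiffAt_sub hyR))
          (contDiffAt_const.mul (contDiff_distSq q).contDiffAt),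
          lapC_const_mul _ (c.contDiffAt_sub hyR), lapC_const_mul _ (contDiff_distSq q).contDiffAt,
          lapC_distSq]
      rw [lapC_sub hwy (hbc y hyR), e1]
      have h1 := hlap y ⟨hyΩ, hsub (ball_subset_closedBall hyq)⟩
      have h2 := mul_le_mul_of_nonneg_left (c.lap_sub y hyR) hA
      have : A = K + 4 * B := rfl
      linarith)
    x ⟨subset_closure hxΩ, by rw [mem_closedBall, hqs]; exact hs2⟩
  have hxR : x ∈ ball p c.R := ball_subset_ball (by linarith) hxr
  have hρ := ((c.mem_iff x hxR).1 hxΩ).le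
  have h1 := (c.bounds hxR hρ).2.1
  have h2 : distSq q x = s ^ 2 := by rw [distSq_eq, hqs]
  have h3 : s ^ 2 ≤ ε * (c.ρ x / c.m) := by
    rw [sq]; exact mul_le_mul hs2 hs1 hs0 hε.le
  simp only [b, h2] at hmain
  calc w x ≤ A * (c.ρ x - c.N * (c.ρ x * c.ρ x)) + B * s ^ 2 := by linarith
    _ ≤ A * c.ρ x + B * (ε * (c.ρ x / c.m)) := by gcongr
    _ = _ := by ring

end BdryChart
end Boundary

section Boundary

open Filter Topology

namespace BdryChart

variable {Ω : Set ℂ} {p e : ℂ} (c : BdryChart Ω p e) {w : ℂ → ℝ} {r₀ : ℝ}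

/-- Hopf-type lower bound. -/
theorem const_mul_le (d : c.Data w r₀) (hw : ∀ x ∈ Ω ∩ ball p r₀, 0 < w x)
    (hlap : ∀ x ∈ Ω ∩ ball p r₀, lapC w x ≤ 0) :
    ∃ k > 0, ∃ r > 0, r ≤ r₀ ∧ ∀ x ∈ Ω ∩ ball p r, k * c.ρ x ≤ w x := by
  have hr₀ := d.pos
  have hrR := d.le
  have hm := c.m_pos
  have hL := c.L_pos
  set ε := r₀ / 4
  have hε : 0 < ε := by positivity
  have hεr : 4 * ε = r₀ := by simp only [ε]; ring
  set ε₁ := min ε (c.m / 2)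
  have hε₁ : 0 < ε₁ := by positivity
  have hε₁ε : ε₁ ≤ ε := min_le_left _ _
  obtain ⟨r, hr, hrε, hfoot⟩ := c.exists_foot hε₁ (by linarith)
  have hsub₀ : closedBall p (3 * ε) ⊆ ball p r₀ := closedBall_subset_ball (by linarith)
  have hbR : ball p r₀ ⊆ ball p c.R := ball_subset_ball hrR
  -- a positive lower bound away from the boundary
  obtain ⟨μ, hμ, hμw⟩ : ∃ μ > 0, ∀ x ∈ Ω ∩ closedBall p (3 * ε),
      (2 / 3) * ε ^ 2 ≤ c.ρ x → μ ≤ w x := by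
    have hcρ : ContinuousOn c.ρ (closure Ω ∩ closedBall p (3 * ε)) := fun x hx =>
      (c.smooth x (hbR (hsub₀ hx.2))).continuousAt.continuousWithinAt
    have hcl : IsCompact (closure Ω ∩ closedBall p (3 * ε)) :=
      (isCompact_closedBall p _).inter_left isClosed_closure
    have hK : IsCompact ((closure Ω ∩ closedBall p (3 * ε)) ∩ c.ρ ⁻¹' Ici ((2 / 3) * ε ^ 2)) :=
      hcl.of_isClosed_subset (hcρ.preimage_isClosed_of_isClosed hcl.isClosed isClosed_Ici)
        inter_subset_left
    rcases eq_empty_or_nonempty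
      ((closure Ω ∩ closedBall p (3 * ε)) ∩ c.ρ ⁻¹' Ici ((2 / 3) * ε ^ 2)) with h | h
    · refine ⟨1, one_pos, fun x hx hρ => ?_⟩
      have : x ∈ (∅ : Set ℂ) := h ▸ ⟨⟨subset_closure hx.1, hx.2⟩, hρ⟩
      exact absurd this (notMem_empty x)
    · obtain ⟨y, hy, hmin⟩ := hK.exists_isMinOn h
        (d.cont.mono (fun x hx => ⟨hx.1.1, hsub₀ hx.1.2⟩))
      have hyΩ : y ∈ Ω := (c.mem_iff y (hbR (hsub₀ hy.1.2))).2
        (lt_of_lt_of_le (by positivity) (show (2 / 3) * ε ^ 2 ≤ c.ρ y from hy.2))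
      exact ⟨w y, hw y ⟨hyΩ, hsub₀ hy.1.2⟩, fun x hx hρ =>
        hmin ⟨⟨subset_closure hx.1, hx.2⟩, hρ⟩⟩
  set k := μ / (3 / 2 * c.L * r₀)
  have hk : 0 < k := by positivity
  have hkμ : k * (3 / 2 * c.L * r₀) = μ := by simp only [k]; field_simp
  refine ⟨k / 2, by positivity, r, hr, by linarith, ?_⟩
  rintro x ⟨hxΩ, hxr⟩
  obtain ⟨q, s, hq, hqs, hs0, hs1, hs2, hqp⟩ := hfoot x hxr hxΩ
  have hsub1 : closedBall q ε ⊆ closedBall p (3 * ε) := by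
    intro y hy
    rw [mem_ball] at *; rw [mem_closedBall] at *
    linarith [dist_triangle y q p]
  have hsub : closedBall q ε ⊆ ball p r₀ := hsub1.trans hsub₀
  have hsubR : closedBall q ε ⊆ ball p c.R := hsub.trans hbR
  set b : ℂ → ℝ := fun y => k * ((c.ρ y + c.N * (c.ρ y * c.ρ y)) - distSq q y)
  have hb' : ∀ y ∈ ball p c.R, ContDiffAt ℝ 2
      (fun y => (c.ρ y + c.N * (c.ρ y * c.ρ y)) - distSq q y) y := fun y hy =>
    (c.contDiffAt_add hy).sub (contDiff_distSq q).contDiffAt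
  have hbc : ∀ y ∈ ball p c.R, ContDiffAt ℝ 2 b y := fun y hy =>
    contDiffAt_const.mul (hb' y hy)
  have hmain := le_of_lapC_pos (u := fun y => b y - w y) (c := 0)
    (K := closure Ω ∩ closedBall q ε) (G := Ω ∩ ball q ε)
    ((isCompact_closedBall q ε).inter_left isClosed_closure)
    (c.isOpen.inter isOpen_ball)
    (inter_subset_inter subset_closure ball_subset_closedBall)
    (ContinuousOn.sub (fun y hy => (hbc y (hsubR hy.2)).continuousAt.continuousWithinAt)
      (d.cont.mono (inter_subset_inter_right _ hsub)))
    (by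
      rintro y ⟨hy1, hy2⟩ hyG
      have hyρ := c.nonneg_of_closure (hsubR hy2) hy1
      have hb1 := (c.bounds (hsubR hy2) hyρ).2.2.2
      have hb2 : 0 ≤ distSq q y := by rw [distSq_eq]; positivity
      by_cases hyΩ : y ∈ Ω
      · have : dist y q = ε := by
          by_contra hne
          exact hyG ⟨hyΩ, mem_ball.2 (lt_of_le_of_ne (mem_closedBall.1 hy2) hne)⟩
        have h3 : distSq q y = ε ^ 2 := by rw [distSq_eq, this]
        have hwy := hw y ⟨hyΩ, hsub hy2⟩
        simp only [b, h3]
        by_cases hρ : (2 / 3) * ε ^ 2 ≤ c.ρ y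
        · have h4 := hμw y ⟨hyΩ, hsub1 hy2⟩ hρ
          have h5 := c.abs_le (hsubR hy2)
          rw [abs_of_nonneg hyρ] at h5
          have h6 : c.L * dist y p ≤ c.L * r₀ :=
            mul_le_mul_of_nonneg_left (mem_ball.1 (hsub hy2)).le hL.le
          have : k * ((c.ρ y + c.N * (c.ρ y * c.ρ y)) - ε ^ 2) ≤ k * (3 / 2 * c.L * r₀) := by
            gcongr
            nlinarith
          linarith
        · have : k * ((c.ρ y + c.N * (c.ρ y * c.ρ y)) - ε ^ 2) ≤ k * 0 := by
            gcongr
            linarith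
          linarith
      · rw [d.zero y ⟨c.mem_frontier_of hy1 hyΩ, hsub hy2⟩]
        have h0 := (c.frontier_iff y (hsubR hy2)).1 (c.mem_frontier_of hy1 hyΩ)
        simp only [b, h0]
        nlinarith)
    (by
      rintro y ⟨hyΩ, hyq⟩ -
      have hyR := hsubR (ball_subset_closedBall hyq)
      have hwy := d.smooth y ⟨hyΩ, hsub (ball_subset_closedBall hyq)⟩
      refine ⟨(hbc y hyR).sub hwy, ?_⟩
      have e1 : lapC b y = k * (lapC (fun y => c.ρ y + c.N * (c.ρ y * c.ρ y)) y - 4) := by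
        simp only [b]
        rw [lapC_const_mul _ (hb' y hyR), lapC_sub (c.contDiffAt_add hyR)
          (contDiff_distSq q).contDiffAt, lapC_distSq]
      rw [lapC_sub (hbc y hyR) hwy, e1]
      have h1 := hlap y ⟨hyΩ, hsub (ball_subset_closedBall hyq)⟩
      have h2 := c.lap_add y hyR
      nlinarith)
    x ⟨subset_closure hxΩ, by rw [mem_closedBall, hqs]; exact hs2.trans hε₁ε⟩
  have hxR : x ∈ ball p c.R := ball_subset_ball (by linarith) hxr
  have hρ := ((c.mem_iff x hxR).1 hxΩ).le
  have h1 := (c.bounds hxR hρ).2.2.1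
  have h2 : distSq q x = s ^ 2 := by rw [distSq_eq, hqs]
  have h3 : s ^ 2 ≤ c.m / 2 * (c.ρ x / c.m) := by
    rw [sq]; exact mul_le_mul (hs2.trans (min_le_right _ _)) hs1 hs0 (by positivity)
  have h4 : c.m / 2 * (c.ρ x / c.m) = c.ρ x / 2 := by field_simp
  simp only [b, h2] at hmain
  have h5 : k * (c.ρ x / 2) ≤ k * ((c.ρ x + c.N * (c.ρ x * c.ρ x)) - s ^ 2) := by
    gcongr
    linarith
  linarith

/-- Gradient bound near the boundary. -/
theorem norm_fderiv_le (d : c.Data w r₀) {C K : ℝ} (hC : 0 ≤ C) (hK : 0 ≤ K)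
    (hw : ∀ x ∈ Ω ∩ ball p r₀, |w x| ≤ C * c.ρ x)
    (hlap : ∀ x ∈ Ω ∩ ball p r₀, |lapC w x| ≤ K) :
    ∃ C' ≥ 0, ∃ r > 0, r ≤ r₀ ∧ ∀ x ∈ Ω ∩ ball p r, ‖fderiv ℝ w x‖ ≤ C' := by
  have hr₀ := d.pos
  have hL := c.L_pos
  have hbR : ball p r₀ ⊆ ball p c.R := ball_subset_ball d.le
  refine ⟨2 * (12 * C * c.L + (K + 1) * r₀), by positivity, r₀ / 2, by positivity,
    by linarith, ?_⟩
  rintro x ⟨hxΩ, hx⟩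
  have hx₀ : x ∈ ball p r₀ := ball_subset_ball (by linarith) hx
  have hρ := (c.mem_iff x (hbR hx₀)).1 hxΩ
  have hρL := c.abs_le (hbR hx₀)
  rw [abs_of_pos hρ] at hρL
  rw [mem_ball] at hx
  set δ := c.ρ x / (2 * c.L)
  have hδ : 0 < δ := by positivity
  have hδL : c.L * δ = c.ρ x / 2 := by simp only [δ]; field_simp
  have hδr : δ ≤ r₀ / 2 := by
    have : c.L * δ ≤ c.L * (r₀ / 2) := by rw [hδL]; nlinarith
    exact le_of_mul_le_mul_left this hL
  have hball : ∀ y ∈ ball x δ, y ∈ Ω ∩ ball p r₀ ∧ c.ρ y ≤ 3 / 2 * c.ρ x := by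
    intro y hy
    rw [mem_ball] at hy
    have hyp : y ∈ ball p r₀ := by
      rw [mem_ball]; linarith [dist_triangle y x p]
    have h1 := c.lipschitz (hbR hx₀) (hbR hyp)
    have h2 : c.L * dist y x < c.L * δ := by gcongr
    rw [hδL] at h2
    have h3 := abs_lt.1 (h1.trans_lt h2)
    exact ⟨⟨(c.mem_iff y (hbR hyp)).2 (by linarith), hyp⟩, by linarith⟩
  have := norm_fderiv_le_of_abs_lapC_lt (w := w) (x₀ := x) (c := 0) (S := C * (3 / 2 * c.ρ x))
    (K := K + 1) hδ (fun y hy => d.smooth y (hball y hy).1)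
    (fun y hy => by
      rw [sub_zero]
      refine (hw y (hball y hy).1).trans ?_
      gcongr
      exact (hball y hy).2)
    (fun y hy => (hlap y (hball y hy).1).trans_lt (by linarith))
  refine this.trans ?_
  have e1 : 2 * (C * (3 / 2 * c.ρ x)) / δ = 6 * C * c.L := by
    simp only [δ]; field_simp; ring
  rw [e1]
  have : (K + 1) * δ ≤ (K + 1) * r₀ := by gcongr; linarith
  have : 0 ≤ C * c.L := by positivity
  linarith

/-- Lower bound for the derivative in the direction `e`. -/
theorem le_fderiv (d : c.Data w r₀) {k C K : ℝ} (hk : 0 < k) (hC : 0 ≤ C) (hK : 0 ≤ K)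
    (hw : ∀ x ∈ Ω ∩ ball p r₀, k * c.ρ x ≤ w x)
    (hgrad : ∀ x ∈ Ω ∩ ball p r₀, ‖fderiv ℝ w x‖ ≤ C)
    (hlap : ∀ x ∈ Ω ∩ ball p r₀, ∀ s : ℝ, 0 < s → x + (s : ℂ) * e ∈ Ω ∩ ball p r₀ →
      |lapC w (x + (s : ℂ) * e) - lapC w x| ≤ K * s) :
    ∃ κ > 0, ∃ r > 0, r ≤ r₀ ∧ ∀ x ∈ Ω ∩ ball p r, κ ≤ fderiv ℝ w x e := by
  have hr₀ := d.pos
  have hm := c.m_pos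
  have hL := c.L_pos
  have hbR : ball p r₀ ⊆ ball p c.R := ball_subset_ball d.le
  set κ := k * c.m / 2
  have hκ : 0 < κ := by positivity
  set r := r₀ / 2
  have hr : 0 < r := by positivity
  have hrr : 2 * r = r₀ := by simp only [r]; ring
  set B := (2 * κ + C) / r ^ 2
  have hB : 0 ≤ B := by positivity
  have hBr : B * r ^ 2 = 2 * κ + C := by simp only [B]; field_simp
  set A := K + 4 * B + 1
  have hA : 0 ≤ A := by positivity
  have hsub₀ : closedBall p r ⊆ ball p r₀ := closedBall_subset_ball (by linarith)
  -- translates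
  have hmove : ∀ s : ℝ, 0 < s → s < r → ∀ x ∈ closure Ω ∩ closedBall p r,
      x + (s : ℂ) * e ∈ Ω ∩ ball p r₀ ∧ c.m * s ≤ c.ρ (x + (s : ℂ) * e) := by
    intro s hs hsr x hx
    have h1 : x + (s : ℂ) * e ∈ ball p r₀ := by
      rw [mem_ball]
      have : dist (x + (s : ℂ) * e) x = s := by
        rw [dist_eq_norm]; simp [c.norm_e, abs_of_pos hs]
      linarith [dist_triangle (x + (s : ℂ) * e) x p, mem_closedBall.1 hx.2]
    have h2 := c.mono hs.le (hbR (hsub₀ hx.2)) (hbR h1)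
    have h3 := c.nonneg_of_closure (hbR (hsub₀ hx.2)) hx.1
    have h4 : c.m * s ≤ c.ρ (x + (s : ℂ) * e) := by linarith
    exact ⟨⟨(c.mem_iff _ (hbR h1)).2 (lt_of_lt_of_le (by positivity) h4), h1⟩, h4⟩
  have hmain : ∀ s : ℝ, 0 < s → s < r → ∀ x ∈ closure Ω ∩ closedBall p r,
      (2 * κ * s - (w (x + (s : ℂ) * e) - w x)) -
        s * (A * (c.ρ x - c.N * (c.ρ x * c.ρ x)) + B * distSq p x) ≤ 0 := by
    intro s hs hsr
    set b : ℂ → ℝ := fun y => A * (c.ρ y - c.N * (c.ρ y * c.ρ y)) + B * distSq p y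
    have hbc : ∀ y ∈ ball p c.R, ContDiffAt ℝ 2 b y := fun y hy =>
      (contDiffAt_const.mul (c.contDiffAt_sub hy)).add
        (contDiffAt_const.mul (contDiff_distSq p).contDiffAt)
    have hshift : ∀ y ∈ Ω ∩ ball p r, ContDiffAt ℝ 2 (fun y => w (y + (s : ℂ) * e)) y := by
      intro y hy
      exact (d.smooth _ (hmove s hs hsr y ⟨subset_closure hy.1,
        ball_subset_closedBall hy.2⟩).1).comp y (contDiffAt_id.add contDiffAt_const)
    have hb0 : ∀ y ∈ closure Ω ∩ closedBall p r, 0 ≤ A * (c.ρ y - c.N * (c.ρ y * c.ρ y)) :=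
      fun y hy => mul_nonneg hA (c.bounds (hbR (hsub₀ hy.2))
        (c.nonneg_of_closure (hbR (hsub₀ hy.2)) hy.1)).1
    refine le_of_lapC_pos
      (u := fun x => (2 * κ * s - (w (x + (s : ℂ) * e) - w x)) - s * b x) (c := 0)
      (K := closure Ω ∩ closedBall p r) (G := Ω ∩ ball p r)
      ((isCompact_closedBall p r).inter_left isClosed_closure)
      (c.isOpen.inter isOpen_ball)
      (inter_subset_inter subset_closure ball_subset_closedBall) ?_ ?_ ?_
    · refine (continuousOn_const.sub (ContinuousOn.sub ?_
        (d.cont.mono (inter_subset_inter_right _ hsub₀)))).sub (continuousOn_const.mul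
          (fun y hy => (hbc y (hbR (hsub₀ hy.2))).continuousAt.continuousWithinAt))
      intro y hy
      exact ((d.smooth _ (hmove s hs hsr y hy).1).continuousAt.comp
        (f := fun y : ℂ => y + (s : ℂ) * e) (by fun_prop)).continuousWithinAt
    · rintro y ⟨hy1, hy2⟩ hyG
      have hb1 := hb0 y ⟨hy1, hy2⟩
      have hb2 : 0 ≤ B * distSq p y := by rw [distSq_eq]; positivity
      obtain ⟨hmv1, hmv2⟩ := hmove s hs hsr y ⟨hy1, hy2⟩
      by_cases hyΩ : y ∈ Ω
      · have : dist y p = r := by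
          by_contra hne
          exact hyG ⟨hyΩ, mem_ball.2 (lt_of_le_of_ne (mem_closedBall.1 hy2) hne)⟩
        have h3 : distSq p y = r ^ 2 := by rw [distSq_eq, this]
        have hseg : ∀ t ∈ Icc (0 : ℝ) s, y + (t : ℂ) * e ∈ Ω ∩ ball p r₀ := by
          intro t ht
          rcases ht.1.eq_or_lt with h | h
          · rw [← h]; simpa using ⟨hyΩ, hsub₀ hy2⟩
          · exact (hmove t h (by linarith [ht.2]) y ⟨hy1, hy2⟩).1
        have hder : ∀ t ∈ Icc (0 : ℝ) s, HasDerivAt (fun t : ℝ => w (y + (t : ℂ) * e))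
            (fderiv ℝ w (y + (t : ℂ) * e) e) t := fun t ht =>
          hasDerivAt_line ((d.smooth _ (hseg t ht)).differentiableAt (by norm_num))
        have hmv := (convex_Icc 0 s).mul_sub_le_image_sub_of_le_deriv
          (f := fun t : ℝ => w (y + (t : ℂ) * e))
          (fun t ht => (hder t ht).continuousAt.continuousWithinAt)
          (fun t ht => (hder t (interior_subset ht)).differentiableAt.differentiableWithinAt)
          (C := -C) (fun t ht => by
            rw [(hder t (interior_subset ht)).deriv]
            have h5 := hgrad _ (hseg t (interior_subset ht))
            have h6 := (fderiv ℝ w (y + (t : ℂ) * e)).le_opNorm e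
            rw [c.norm_e, mul_one, Real.norm_eq_abs] at h6
            linarith [neg_abs_le (fderiv ℝ w (y + (t : ℂ) * e) e)])
          0 (by simp [hs.le]) s (by simp [hs.le]) hs.le
        simp only [Complex.ofReal_zero, zero_mul, add_zero, sub_zero] at hmv
        have : s * (B * distSq p y) = s * (2 * κ + C) := by rw [h3, hBr]
        simp only [b]
        nlinarith [mul_nonneg hs.le hb1]
      · rw [d.zero y ⟨c.mem_frontier_of hy1 hyΩ, hsub₀ hy2⟩]
        have h1 := hw _ hmv1
        have h2 : k * (c.m * s) ≤ k * c.ρ (y + (s : ℂ) * e) := by gcongr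
        have h3 : 2 * κ * s = k * (c.m * s) := by simp only [κ]; ring
        have h4 : 0 ≤ s * b y := mul_nonneg hs.le (add_nonneg hb1 hb2)
        linarith
    · rintro y ⟨hyΩ, hyr⟩ -
      have hyK : y ∈ closure Ω ∩ closedBall p r := ⟨subset_closure hyΩ, ball_subset_closedBall hyr⟩
      have hyR := hbR (hsub₀ hyK.2)
      have hwy := d.smooth y ⟨hyΩ, hsub₀ hyK.2⟩
      have hws := hshift y ⟨hyΩ, hyr⟩
      have hd1 : ContDiffAt ℝ 2 (fun x => w (x + (s : ℂ) * e) - w x) y := hws.sub hwy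
      have hd2 : ContDiffAt ℝ 2 (fun x => 2 * κ * s - (w (x + (s : ℂ) * e) - w x)) y :=
        contDiffAt_const.sub hd1
      have hd3 : ContDiffAt ℝ 2 (fun x => s * b x) y := contDiffAt_const.mul (hbc y hyR)
      refine ⟨hd2.sub hd3, ?_⟩
      have e1 : lapC b y = A * lapC (fun y => c.ρ y - c.N * (c.ρ y * c.ρ y)) y + B * 4 := by
        simp only [b]
        rw [lapC_add (contDiffAt_const.mul (c.contDiffAt_sub hyR))
          (contDiffAt_const.mul (contDiff_distSq p).contDiffAt),
          lapC_const_mul _ (c.contDiffAt_sub hyR), lapC_const_mul _ (contDiff_distSq p).contDiffAt,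
          lapC_distSq]
      rw [lapC_sub hd2 hd3, lapC_sub contDiffAt_const hd1, lapC_const, lapC_sub hws hwy,
        lapC_comp_add, lapC_const_mul _ (hbc y hyR), e1]
      have h1 := _root_.abs_le.1 (hlap y ⟨hyΩ, hsub₀ hyK.2⟩ s hs (hmove s hs hsr y hyK).1)
      have h2 := mul_le_mul_of_nonneg_left (c.lap_sub y hyR) hA
      have h3 : A = K + 4 * B + 1 := rfl
      have h4 : s * (A * lapC (fun y => c.ρ y - c.N * (c.ρ y * c.ρ y)) y + B * 4) ≤
          s * (-(K + 1)) := by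
        gcongr; linarith
      nlinarith
  -- pass to the limit
  set r₁ := min r (κ / (A * c.L + B * r + 1))
  have hD : 0 < A * c.L + B * r + 1 := by positivity
  have hr₁ : 0 < r₁ := by positivity
  refine ⟨κ, hκ, r₁, hr₁, (min_le_left _ _).trans (by linarith), ?_⟩
  rintro x ⟨hxΩ, hx⟩
  have hxr : x ∈ closedBall p r := ball_subset_closedBall (ball_subset_ball (min_le_left _ _) hx)
  have hxK : x ∈ closure Ω ∩ closedBall p r := ⟨subset_closure hxΩ, hxr⟩
  have hder : HasDerivAt (fun t : ℝ => w (x + (t : ℂ) * e)) (fderiv ℝ w x e) 0 := by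
    have := hasDerivAt_line (w := w) (x := x) (e := e) (t := 0)
      (by simpa using (d.smooth x ⟨hxΩ, hsub₀ hxr⟩).differentiableAt (by norm_num))
    simpa using this
  have hρ0 := c.nonneg_of_closure (hbR (hsub₀ hxr)) hxK.1
  have hρ1 := c.abs_le (hbR (hsub₀ hxr))
  rw [abs_of_nonneg hρ0] at hρ1
  have hdist : dist x p * (A * c.L + B * r + 1) ≤ κ := by
    have := (mem_ball.1 hx).le.trans (min_le_right _ _)
    rwa [le_div_iff₀ hD] at this
  have hb : A * (c.ρ x - c.N * (c.ρ x * c.ρ x)) + B * distSq p x ≤ κ := by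
    have h1 := (c.bounds (hbR (hsub₀ hxr)) hρ0).2.1
    have h2 : A * (c.ρ x - c.N * (c.ρ x * c.ρ x)) ≤ A * (c.L * dist x p) := by gcongr; linarith
    have h3 : B * distSq p x ≤ B * (dist x p * r) := by
      rw [distSq_eq, sq]; gcongr; exact mem_closedBall.1 hxr
    nlinarith [dist_nonneg (x := x) (y := p)]
  refine ge_of_tendsto hder.tendsto_slope_zero_right ?_
  filter_upwards [Ioo_mem_nhdsGT hr] with s hs
  have h1 := hmain s hs.1 hs.2 x hxK
  have h2 : s * (A * (c.ρ x - c.N * (c.ρ x * c.ρ x)) + B * distSq p x) ≤ s * κ :=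
    mul_le_mul_of_nonneg_left hb hs.1.le
  simp only [zero_add, Complex.ofReal_zero, zero_mul, add_zero, smul_eq_mul]
  rw [inv_mul_eq_div, le_div_iff₀ hs.1]
  linarith

end BdryChart
end Boundary

section RiemannMap

open Filter Topology Complex

/-- The Möbius transformation of the unit disc sending `a` to `0`. -/
def mob (a z : ℂ) : ℂ := (z - a) / (1 - starRingEnd ℂ a * z)

theorem mob_denom_ne_zero {a z : ℂ} (ha : ‖a‖ < 1) (hz : ‖z‖ < 1) :
    1 - starRingEnd ℂ a * z ≠ 0 := by
  intro h
  have h1 : starRingEnd ℂ a * z = 1 := (sub_eq_zero.1 h).symm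
  have h2 : ‖starRingEnd ℂ a * z‖ < 1 := by
    rw [norm_mul, RCLike.norm_conj]
    nlinarith [norm_nonneg a, norm_nonneg z]
  rw [h1] at h2
  simp at h2

theorem norm_mob_lt_one {a z : ℂ} (ha : ‖a‖ < 1) (hz : ‖z‖ < 1) : ‖mob a z‖ < 1 := by
  have hd := mob_denom_ne_zero ha hz
  rw [mob, norm_div, div_lt_one (norm_pos_iff.2 hd)]
  apply lt_of_pow_lt_pow_left₀ 2 (norm_nonneg _)
  rw [← Complex.normSq_eq_norm_sq, ← Complex.normSq_eq_norm_sq]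
  have h1 : Complex.normSq (1 - starRingEnd ℂ a * z) - Complex.normSq (z - a) =
      (1 - Complex.normSq a) * (1 - Complex.normSq z) := by
    simp [Complex.normSq_apply]; ring
  have h2 : Complex.normSq a < 1 := by rw [Complex.normSq_eq_norm_sq]; nlinarith [norm_nonneg a]
  have h3 : Complex.normSq z < 1 := by rw [Complex.normSq_eq_norm_sq]; nlinarith [norm_nonneg z]
  have := mul_pos (sub_pos.2 h2) (sub_pos.2 h3)
  linarith

theorem one_sub_conj_mul_ne_zero {a : ℂ} (ha : ‖a‖ < 1) : 1 - starRingEnd ℂ a * a ≠ 0 :=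
  mob_denom_ne_zero ha ha

theorem mob_injOn {a : ℂ} (ha : ‖a‖ < 1) : InjOn (mob a) (ball 0 1) := by
  intro x hx y hy h
  rw [mem_ball_zero_iff] at hx hy
  simp only [mob] at h
  rw [div_eq_div_iff (mob_denom_ne_zero ha hx) (mob_denom_ne_zero ha hy)] at h
  have : (x - y) * (1 - starRingEnd ℂ a * a) = 0 := by linear_combination h
  rcases mul_eq_zero.1 this with h | h
  · exact sub_eq_zero.1 h
  · exact absurd h (one_sub_conj_mul_ne_zero ha)

theorem hasDerivAt_mob {a z : ℂ} (ha : ‖a‖ < 1) (hz : ‖z‖ < 1) :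
    HasDerivAt (mob a) ((1 - starRingEnd ℂ a * a) / (1 - starRingEnd ℂ a * z) ^ 2) z := by
  have h1 : HasDerivAt (fun z : ℂ => z - a) 1 z := (hasDerivAt_id z).sub_const a
  have h2 : HasDerivAt (fun z : ℂ => 1 - starRingEnd ℂ a * z) (-(starRingEnd ℂ a)) z := by
    simpa using ((hasDerivAt_id z).const_mul (starRingEnd ℂ a)).const_sub 1
  have := h1.div h2 (mob_denom_ne_zero ha hz)
  rwa [show 1 * (1 - starRingEnd ℂ a * z) - (z - a) * -(starRingEnd ℂ a) =
    1 - starRingEnd ℂ a * a by ring] at this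

/-- Local form of Hurwitz's theorem. -/
theorem eventually_eq_zero_of_tendsto {ι : Type*} {φ : Filter ι} [φ.NeBot] {G : ι → ℂ → ℂ}
    {g : ℂ → ℂ} {U : Set ℂ} (hU : IsOpen U) (hG : TendstoLocallyUniformlyOn G g φ U)
    (hd : ∀ n, DifferentiableOn ℂ (G n) U) {z : ℂ} (hz : z ∈ U)
    (hne : ∃ r > 0, ∀ n, ∀ y ∈ ball z r, G n y ≠ 0) (h0 : g z = 0) : ∀ᶠ y in 𝓝 z, g y = 0 := by
  have hgd : DifferentiableOn ℂ g U := hG.differentiableOn (Eventually.of_forall hd) hU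
  have hga : AnalyticAt ℂ g z := hgd.analyticAt (hU.mem_nhds hz)
  rcases hga.eventually_eq_zero_or_eventually_ne_zero with h | h
  · exact h
  exfalso
  obtain ⟨r₁, hr₁, hne⟩ := hne
  obtain ⟨r₂, hr₂, hU₂⟩ := Metric.isOpen_iff.1 hU z hz
  obtain ⟨r₃, hr₃, h3⟩ := Metric.eventually_nhds_iff_ball.1 (eventually_nhdsWithin_iff.1 h)
  set r := min r₁ (min r₂ r₃) / 2
  have hr : 0 < r := by positivity
  have hrr : r < min r₁ (min r₂ r₃) := by
    have : 0 < min r₁ (min r₂ r₃) := by positivity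
    simp only [r]; linarith
  have hb1 : closedBall z r ⊆ ball z r₁ := closedBall_subset_ball (hrr.trans_le (min_le_left _ _))
  have hb2 : closedBall z r ⊆ U := (closedBall_subset_ball
    (hrr.trans_le ((min_le_right _ _).trans (min_le_left _ _)))).trans hU₂
  have hb3 : closedBall z r ⊆ ball z r₃ := closedBall_subset_ball
    (hrr.trans_le ((min_le_right _ _).trans (min_le_right _ _)))
  obtain ⟨y₀, hy₀, hmin⟩ := (isCompact_sphere z r).exists_isMinOn
    (NormedSpace.sphere_nonempty.2 hr.le)
    ((hgd.continuousOn.mono (sphere_subset_closedBall.trans hb2)).norm)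
  set m := ‖g y₀‖
  have hm : 0 < m := norm_pos_iff.2 (h3 _ (hb3 (sphere_subset_closedBall hy₀))
    (ne_of_mem_sphere hy₀ hr.ne'))
  have hunif := (tendstoLocallyUniformlyOn_iff_forall_isCompact hU).1 hG _ hb2
    (isCompact_closedBall z r)
  obtain ⟨n, hn⟩ := (Metric.tendstoUniformlyOn_iff.1 hunif (m / 2) (by positivity)).exists
  have hcl : closure (ball z r) = closedBall z r := closure_ball z hr.ne'
  have hdc : DiffContOnCl ℂ (fun y => (G n y)⁻¹) (ball z r) := by
    apply DifferentiableOn.diffContOnCl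
    rw [hcl]
    exact ((hd n).mono hb2).inv fun y hy => hne n y (hb1 hy)
  have key := Complex.norm_le_of_forall_mem_frontier_norm_le isBounded_ball hdc (C := 2 / m)
    (fun y hy => by
      rw [frontier_ball z hr.ne'] at hy
      have h1 : m ≤ ‖g y‖ := hmin hy
      have h2 := hn y (sphere_subset_closedBall hy)
      rw [dist_eq_norm] at h2
      have h4 := norm_sub_norm_le (g y) (G n y)
      rw [norm_inv, inv_le_comm₀ (norm_pos_iff.2 (hne n y (hb1 (sphere_subset_closedBall hy))))
        (by positivity), inv_div]
      linarith)
    (subset_closure (mem_ball_self hr))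
  have h5 := hn z (mem_closedBall_self hr.le)
  rw [h0, dist_zero_left] at h5
  rw [norm_inv, inv_le_comm₀ (norm_pos_iff.2 (hne n z (mem_ball_self hr₁))) (by positivity),
    inv_div] at key
  linarith

theorem norm_sub_le_of_mapsTo_unit {U : Set ℂ} {f : ℂ → ℂ} (hf : DifferentiableOn ℂ f U)
    (hm : MapsTo f U (ball 0 1)) {z : ℂ} {r : ℝ} (hr : 0 < r) (hb : ball z (2 * r) ⊆ U) {x y : ℂ}
    (hx : x ∈ ball z r) (hy : y ∈ ball z r) : ‖f y - f x‖ ≤ 2 / r * ‖y - x‖ := by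
  have hmem : ∀ w ∈ ball z r, closedBall w (r / 2) ⊆ U := fun w hw v hv => hb <| by
    rw [mem_ball] at *; rw [mem_closedBall] at hv
    linarith [dist_triangle v w z]
  have hsub : ball z r ⊆ U := (ball_subset_ball (by linarith)).trans hb
  refine (convex_ball z r).norm_image_sub_le_of_norm_deriv_le (𝕜 := ℂ)
    (fun w hw => (hf w (hsub hw)).differentiableAt
      (mem_of_superset (isOpen_ball.mem_nhds hw) hsub)) (fun w hw => ?_) hx hy
  have := Complex.norm_deriv_le_of_forall_mem_sphere_norm_le (f := f) (c := w) (R := r / 2) (C := 1)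
    (by positivity)
    (DifferentiableOn.diffContOnCl (by
      rw [closure_ball w (by positivity)]; exact hf.mono (hmem w hw)))
    (fun v hv => (mem_ball_zero_iff.1 (hm (hmem w hw (sphere_subset_closedBall hv)))).le)
  calc _ ≤ 1 / (r / 2) := this
    _ = 2 / r := by field_simp

/-- A normal family argument: ultrafilter limits of holomorphic maps into the unit disc. -/
theorem exists_tendstoLocallyUniformlyOn {ι : Type*} (φ : Ultrafilter ι) {U : Set ℂ}
    (hU : IsOpen U) {f : ι → ℂ → ℂ} (hf : ∀ n, DifferentiableOn ℂ (f n) U)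
    (hm : ∀ n, MapsTo (f n) U (ball 0 1)) :
    ∃ F : ℂ → ℂ, TendstoLocallyUniformlyOn f F φ U ∧ MapsTo F U (closedBall 0 1) := by
  have hlim : ∀ z : ℂ, ∃ w : ℂ, z ∈ U → w ∈ closedBall (0 : ℂ) 1 ∧
      Tendsto (fun n => f n z) φ (𝓝 w) := by
    intro z
    by_cases hz : z ∈ U
    · obtain ⟨w, hw, hle⟩ := (isCompact_closedBall (0 : ℂ) 1).ultrafilter_le_nhds
        (φ.map fun n => f n z) (by
          rw [le_principal_iff]
          exact mem_map.2 (univ_mem' fun n => ball_subset_closedBall (hm n hz)))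
      exact ⟨w, fun _ => ⟨hw, hle⟩⟩
    · exact ⟨0, fun h => absurd h hz⟩
  choose F hF using hlim
  refine ⟨F, ?_, fun z hz => (hF z hz).1⟩
  rw [Metric.tendstoLocallyUniformlyOn_iff]
  intro ε hε z hz
  obtain ⟨R, hR, hRU⟩ := Metric.isOpen_iff.1 hU z hz
  set r := R / 2
  have hr : 0 < r := by positivity
  have hb : ball z (2 * r) ⊆ U := by
    have : 2 * r = R := by simp only [r]; ring
    rwa [this]
  have hbr : ball z r ⊆ U := (ball_subset_ball (by linarith)).trans hb
  have hFl : ∀ y ∈ ball z r, ‖F y - F z‖ ≤ 2 / r * ‖y - z‖ := fun y hy =>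
    le_of_tendsto ((hF y (hbr hy)).2.sub (hF z hz).2).norm (Eventually.of_forall fun n =>
      norm_sub_le_of_mapsTo_unit (hf n) (hm n) hr hb (mem_ball_self hr) hy)
  set δ := min r (ε * r / 8)
  have hδ : 0 < δ := by positivity
  refine ⟨ball z δ, mem_nhdsWithin_of_mem_nhds (ball_mem_nhds z hδ), ?_⟩
  have hev : ∀ᶠ n in (φ : Filter ι), ‖f n z - F z‖ < ε / 4 := by
    have := (hF z hz).2.eventually (ball_mem_nhds (F z) (by positivity : 0 < ε / 4))
    simpa [dist_eq_norm] using this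
  filter_upwards [hev] with n hn y hy
  have hyr : y ∈ ball z r := ball_subset_ball (min_le_left _ _) hy
  have h1 := hFl y hyr
  have h2 := norm_sub_le_of_mapsTo_unit (hf n) (hm n) hr hb (mem_ball_self hr) hyr
  have h3 : 2 / r * ‖y - z‖ ≤ ε / 4 := by
    have : ‖y - z‖ ≤ ε * r / 8 := by
      rw [← dist_eq_norm]; exact (mem_ball.1 hy).le.trans (min_le_right _ _)
    calc _ ≤ 2 / r * (ε * r / 8) := by gcongr
      _ = ε / 4 := by field_simp; ring
  rw [dist_eq_norm]
  calc ‖F y - f n y‖ = ‖(F y - F z) - (f n z - F z) - (f n y - f n z)‖ := by congr 1; ring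
    _ ≤ ‖F y - F z‖ + ‖f n z - F z‖ + ‖f n y - f n z‖ :=
      (norm_sub_le _ _).trans (by gcongr; exact norm_sub_le _ _)
    _ < ε := by linarith

theorem hasDerivAt_of_sq_eq {q g : ℂ → ℂ} {q' z : ℂ} (hq : HasDerivAt q q' z)
    (hg : ContinuousAt g z) (hsq : ∀ x, g x ^ 2 = q x) (h0 : g z ≠ 0) :
    HasDerivAt g (q' / (2 * g z)) z := by
  rw [hasDerivAt_iff_tendsto_slope] at hq ⊢
  have h1 : Tendsto (fun y => g y + g z) (𝓝[≠] z) (𝓝 (2 * g z)) := by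
    rw [two_mul]
    exact (hg.tendsto.add_const _).mono_left nhdsWithin_le_nhds
  have h2 : 2 * g z ≠ 0 := by simpa using h0
  refine (hq.div h1 h2).congr' ?_
  filter_upwards [h1.eventually_ne h2] with y hy
  simp only [Pi.div_apply, slope_def_field]
  rw [← hsq, ← hsq]
  rw [div_div, mul_comm, ← div_div]
  congr 1
  rw [div_eq_iff hy]; ring

end RiemannMap

section RiemannMap

open Filter Topology Complex

/-- The competitors in the extremal problem of the Riemann mapping theorem. -/
structure IsCompetitor (U : Set ℂ) (f : ℂ → ℂ) : Prop where
  diff : DifferentiableOn ℂ f U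
  inj : InjOn f U
  maps : MapsTo f U (ball 0 1)
  zero : f 0 = 0
  deriv_ne : ∀ z ∈ U, deriv f z ≠ 0

variable {U : Set ℂ}

theorem IsCompetitor.exists_larger (hU : IsOpen U) (hsc : IsSimplyConnected U) (h0 : (0 : ℂ) ∈ U)
    {f : ℂ → ℂ} (hf : IsCompetitor U f) {w : ℂ} (hw : ‖w‖ < 1) (hwf : w ∉ f '' U) :
    ∃ h, IsCompetitor U h ∧ ‖deriv f 0‖ < ‖deriv h 0‖ := by
  have hf1 : ∀ z ∈ U, ‖f z‖ < 1 := fun z hz => mem_ball_zero_iff.1 (hf.maps hz)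
  have hfd : ∀ z ∈ U, HasDerivAt f (deriv f z) z := fun z hz =>
    (hf.diff.differentiableAt (hU.mem_nhds hz)).hasDerivAt
  set q : ℂ → ℂ := fun z => mob w (f z)
  have hqd : ∀ z ∈ U, HasDerivAt q ((1 - starRingEnd ℂ w * w) /
      (1 - starRingEnd ℂ w * f z) ^ 2 * deriv f z) z := fun z hz =>
    (hasDerivAt_mob hw (hf1 z hz)).comp z (hfd z hz)
  have hq0 : ∀ z ∈ U, q z ≠ 0 := by
    intro z hz h
    simp only [q, mob] at h
    rcases div_eq_zero_iff.1 h with h | h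
    · exact hwf ⟨z, hz, sub_eq_zero.1 h⟩
    · exact mob_denom_ne_zero hw (hf1 z hz) h
  obtain ⟨g, hgc, hg⟩ := exists_continuousOn_pow_eq hsc hU (g := q)
    (fun z hz => (hqd z hz).continuousAt.continuousWithinAt)
    (by rintro ⟨z, hz, h⟩; exact hq0 z hz h) two_ne_zero
  have hg0 : ∀ z ∈ U, g z ≠ 0 := fun z hz h => hq0 z hz (by rw [← hg, h]; simp)
  have hg1 : ∀ z ∈ U, ‖g z‖ < 1 := by
    intro z hz
    have : ‖g z‖ ^ 2 < 1 := by
      rw [← norm_pow, hg]; exact norm_mob_lt_one hw (hf1 z hz)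
    nlinarith [norm_nonneg (g z)]
  have hgd := fun z hz => hasDerivAt_of_sq_eq (hqd z hz) (hgc.continuousAt (hU.mem_nhds hz)) hg
    (hg0 z hz)
  set a := g 0
  have ha := hg1 0 h0
  have ha0 := hg0 0 h0
  have hhd := fun z hz => (hasDerivAt_mob ha (hg1 z hz)).comp z (hgd z hz)
  refine ⟨mob a ∘ g, ⟨fun z hz => (hhd z hz).differentiableAt.differentiableWithinAt, ?_, ?_, ?_,
    ?_⟩, ?_⟩
  · intro x hx y hy hxy
    have h1 := mob_injOn ha (mem_ball_zero_iff.2 (hg1 x hx)) (mem_ball_zero_iff.2 (hg1 y hy)) hxy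
    have h2 : q x = q y := by rw [← hg, ← hg, h1]
    exact hf.inj hx hy (mob_injOn hw (hf.maps hx) (hf.maps hy) h2)
  · exact fun z hz => mem_ball_zero_iff.2 (norm_mob_lt_one ha (hg1 z hz))
  · simp [mob, a]
  · intro z hz
    rw [(hhd z hz).deriv]
    have h1 := one_sub_conj_mul_ne_zero ha
    have h2 := one_sub_conj_mul_ne_zero hw
    have h3 := mob_denom_ne_zero ha (hg1 z hz)
    have h4 := mob_denom_ne_zero hw (hf1 z hz)
    have h5 := hf.deriv_ne z hz
    have h6 := hg0 z hz
    exact mul_ne_zero (div_ne_zero h1 (pow_ne_zero _ h3)) (div_ne_zero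
      (mul_ne_zero (div_ne_zero h2 (pow_ne_zero _ h4)) h5) (mul_ne_zero two_ne_zero h6))
  · rw [(hhd 0 h0).deriv, hf.zero]
    change _ < ‖(1 - starRingEnd ℂ a * a) / (1 - starRingEnd ℂ a * a) ^ 2 *
      (((1 - starRingEnd ℂ w * w) / (1 - starRingEnd ℂ w * 0) ^ 2 * deriv f 0) / (2 * a))‖
    have hta : 0 < ‖a‖ := norm_pos_iff.2 ha0
    have hfp : 0 < ‖deriv f 0‖ := norm_pos_iff.2 (hf.deriv_ne 0 h0)
    have haw : ‖w‖ = ‖a‖ ^ 2 := by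
      rw [← norm_pow, hg 0]; simp [q, mob, hf.zero]
    have e1 : ∀ b : ℂ, ‖b‖ < 1 → ‖1 - starRingEnd ℂ b * b‖ = 1 - ‖b‖ ^ 2 := by
      intro b hb
      rw [mul_comm, Complex.mul_conj, Complex.normSq_eq_norm_sq, ← Complex.ofReal_one,
        ← Complex.ofReal_sub, Complex.norm_real, Real.norm_of_nonneg]
      nlinarith [norm_nonneg b]
    simp only [mul_zero, sub_zero, one_pow, div_one, norm_mul, norm_div, norm_pow, e1 a ha,
      e1 w hw, haw]
    rw [Complex.norm_ofNat]
    have h1 : 0 < 1 - ‖a‖ ^ 2 := by nlinarith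
    have e2 : (1 - ‖a‖ ^ 2) / (1 - ‖a‖ ^ 2) ^ 2 * ((1 - (‖a‖ ^ 2) ^ 2) * ‖deriv f 0‖ / (2 * ‖a‖)) =
        (1 + ‖a‖ ^ 2) / (2 * ‖a‖) * ‖deriv f 0‖ := by
      field_simp; ring
    rw [e2]
    have : 1 < (1 + ‖a‖ ^ 2) / (2 * ‖a‖) := by
      rw [lt_div_iff₀ (by positivity)]
      nlinarith [mul_pos (sub_pos.2 ha) (sub_pos.2 ha)]
    nlinarith

/-- The Riemann mapping theorem for bounded simply connected domains. -/
theorem exists_riemann_map (hU : IsOpen U) (hsc : IsSimplyConnected U) (h0 : (0 : ℂ) ∈ U)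
    (hb : Bornology.IsBounded U) : ∃ F, IsCompetitor U F ∧ F '' U = ball 0 1 := by
  have hpc : IsPreconnected U := hsc.isPathConnected.isConnected.isPreconnected
  obtain ⟨r, hr, hrU⟩ := Metric.isOpen_iff.1 hU 0 h0
  have hbound : ∀ f, IsCompetitor U f → ‖deriv f 0‖ ≤ 2 / r := by
    intro f hf
    have hcb : closedBall (0 : ℂ) (r / 2) ⊆ U :=
      (closedBall_subset_ball (by linarith)).trans hrU
    have := Complex.norm_deriv_le_of_forall_mem_sphere_norm_le (f := f) (c := 0) (R := r / 2)
      (C := 1) (by positivity) (DifferentiableOn.diffContOnCl (by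
        rw [closure_ball _ (by positivity)]; exact hf.diff.mono hcb))
      (fun v hv => (mem_ball_zero_iff.1 (hf.maps (hcb (sphere_subset_closedBall hv)))).le)
    calc _ ≤ 1 / (r / 2) := this
      _ = _ := by field_simp
  obtain ⟨D, hD0, hD⟩ := hb.subset_ball_lt 0 0
  have hDc : (D : ℂ) ≠ 0 := by exact_mod_cast hD0.ne'
  have hcomp : IsCompetitor U (fun z => z / D) := by
    refine ⟨fun z _ => (differentiableAt_id.div_const _).differentiableWithinAt, ?_, ?_, by simp, ?_⟩
    · intro x _ y _ h
      exact (div_left_inj' hDc).1 h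
    · intro z hz
      have := mem_ball_zero_iff.1 (hD hz)
      rw [mem_ball_zero_iff, norm_div, Complex.norm_real, Real.norm_of_nonneg hD0.le,
        div_lt_one hD0]
      exact this
    · intro z _
      simp [hDc]
  set T : Set ℝ := {t | ∃ f, IsCompetitor U f ∧ t = ‖deriv f 0‖}
  have hTb : BddAbove T := ⟨2 / r, by rintro _ ⟨f, hf, rfl⟩; exact hbound f hf⟩
  have hTne : T.Nonempty := ⟨_, _, hcomp, rfl⟩
  obtain ⟨t, ht, htl, htT⟩ := exists_seq_tendsto_sSup hTne hTb
  choose f hf hft using htT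
  have hM : 0 < sSup T := lt_of_lt_of_le
    (norm_pos_iff.2 (hcomp.deriv_ne 0 h0)) (le_csSup hTb ⟨_, hcomp, rfl⟩)
  set φ : Ultrafilter ℕ := hyperfilter ℕ
  have hφ : (φ : Filter ℕ) ≤ atTop := Nat.hyperfilter_le_atTop
  obtain ⟨F, hF, hFm⟩ := exists_tendstoLocallyUniformlyOn φ hU (fun n => (hf n).diff)
    (fun n => (hf n).maps)
  have hFd : DifferentiableOn ℂ F U :=
    hF.differentiableOn (Eventually.of_forall fun n => (hf n).diff) hU
  have hdF := hF.deriv (Eventually.of_forall fun n => (hf n).diff) hU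
  have hF0 : F 0 = 0 := by
    refine tendsto_nhds_unique (hF.tendsto_at h0) ?_
    simp [(hf _).zero]
  have hM' : ‖deriv F 0‖ = sSup T := by
    have h1 := (hdF.tendsto_at h0).norm
    refine tendsto_nhds_unique h1 ((htl.mono_left hφ).congr ?_)
    intro n; simp [hft]
  have hane : AnalyticOnNhd ℂ F U := hFd.analyticOnNhd hU
  have hinj : InjOn F U := by
    intro a ha b hb hab
    by_contra hne
    have hG : TendstoLocallyUniformlyOn (fun n z => f n z - f n b) (fun z => F z - F b) φ U := by
      have h1 : TendstoLocallyUniformlyOn (fun n (_ : ℂ) => f n b) (fun _ => F b) φ U := by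
        rw [Metric.tendstoLocallyUniformlyOn_iff]
        intro ε hε x hx
        refine ⟨univ, univ_mem, ?_⟩
        have := (hF.tendsto_at hb).eventually (ball_mem_nhds _ hε)
        filter_upwards [this] with n hn y _
        rw [dist_comm]; exact hn
      exact hF.sub h1
    have := eventually_eq_zero_of_tendsto hU hG (fun n => (hf n).diff.sub_const _) ha
      (by
        refine ⟨min (dist a b) (Classical.choose (Metric.isOpen_iff.1 hU a ha)), ?_, ?_⟩
        · exact lt_min (dist_pos.2 hne) (Classical.choose_spec (Metric.isOpen_iff.1 hU a ha)).1
        · intro n y hy h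
          have hyU : y ∈ U := (Classical.choose_spec (Metric.isOpen_iff.1 hU a ha)).2
            (ball_subset_ball (min_le_right _ _) hy)
          have hyb : y = b := (hf n).inj hyU hb (sub_eq_zero.1 h)
          have : dist y a < dist a b := lt_of_lt_of_le hy (min_le_left _ _)
          rw [hyb, dist_comm] at this
          exact lt_irrefl _ this)
      (by simp [hab])
    have hconst : EqOn F (fun _ => F b) U :=
      hane.eqOn_of_preconnected_of_eventuallyEq (fun _ _ => analyticAt_const) hpc ha (by
        filter_upwards [this] with y hy using sub_eq_zero.1 hy)
    have : deriv F 0 = 0 := by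
      rw [(hconst.eventuallyEq_of_mem (hU.mem_nhds h0)).deriv_eq]; simp
    rw [this, norm_zero] at hM'
    exact hM.ne hM'
  have hder : ∀ z ∈ U, deriv F z ≠ 0 := by
    intro z hz h
    have := eventually_eq_zero_of_tendsto hU hdF (fun n => (hf n).diff.deriv hU) hz
      (by
        obtain ⟨s, hs, hsU⟩ := Metric.isOpen_iff.1 hU z hz
        exact ⟨s, hs, fun n y hy => (hf n).deriv_ne y (hsU hy)⟩) h
    have hz0 : EqOn (deriv F) 0 U :=
      (hFd.deriv hU).analyticOnNhd hU |>.eqOn_zero_of_preconnected_of_eventuallyEq_zero hpc hz this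
    rw [hz0 h0] at hM'
    simp only [Pi.zero_apply, norm_zero] at hM'
    exact hM.ne hM'
  have hmaps : MapsTo F U (ball 0 1) := by
    intro z hz
    have h1 : F '' U ∈ 𝓝 (F z) := by
      have hs : HasStrictDerivAt F (deriv F z) z := (hane z hz).hasStrictDerivAt
      rw [← hs.map_nhds_eq (hder z hz)]
      exact image_mem_map (hU.mem_nhds hz)
    have h2 : closedBall (0 : ℂ) 1 ∈ 𝓝 (F z) := mem_of_superset h1 hFm.image_subset
    rw [← interior_closedBall (0 : ℂ) one_ne_zero]
    exact mem_interior_iff_mem_nhds.2 h2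
  have hFc : IsCompetitor U F := ⟨hFd, hinj, hmaps, hF0, hder⟩
  refine ⟨F, hFc, Subset.antisymm hmaps.image_subset fun w hw => ?_⟩
  by_contra hwF
  obtain ⟨h, hh, hlt⟩ := hFc.exists_larger hU hsc h0 (mem_ball_zero_iff.1 hw) hwF
  rw [hM'] at hlt
  exact not_le.2 hlt (le_csSup hTb ⟨h, hh, rfl⟩)

end RiemannMap

section Boundary

open Filter Topology

namespace BdryChart

variable {Ω : Set ℂ} {p e : ℂ} (c : BdryChart Ω p e) {w : ℂ → ℝ} {r₀ : ℝ}

/-- The same chart seen from a nearby boundary point. -/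
def recenter {q : ℂ} (hq : q ∈ frontier Ω) (hqR : q ∈ ball p c.R) : BdryChart Ω q e :=
  have hsub : ball q (c.R - dist q p) ⊆ ball p c.R := ball_subset_ball' (by simp)
  { c with
    R := c.R - dist q p
    mem := hq
    R_pos := sub_pos.2 hqR
    smooth := fun x hx => c.smooth x (hsub hx)
    mem_iff := fun x hx => c.mem_iff x (hsub hx)
    frontier_iff := fun x hx => c.frontier_iff x (hsub hx)
    le_deriv := fun x hx => c.le_deriv x (hsub hx)
    norm_le := fun x hx => c.norm_le x (hsub hx)
    small := fun x hx => c.small x (hsub hx)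
    lap_sub := fun x hx => c.lap_sub x (hsub hx)
    lap_add := fun x hx => c.lap_add x (hsub hx) }

theorem norm_fderiv_le_of_pos (d : c.Data w r₀) {S K : ℝ} (hS : 0 ≤ S) (hK : 0 ≤ K)
    (hpos : ∀ x ∈ Ω ∩ ball p r₀, 0 < w x) (hwS : ∀ x ∈ Ω ∩ ball p r₀, w x ≤ S)
    (hlap : ∀ x ∈ Ω ∩ ball p r₀, |lapC w x| ≤ K) :
    ∃ C' ≥ 0, ∃ r > 0, r ≤ r₀ ∧ ∀ x ∈ Ω ∩ ball p r, ‖fderiv ℝ w x‖ ≤ C' := by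
  obtain ⟨C, hC, r, hr, hrr, h⟩ := c.le_const_mul d hS (K := K + 1) (by linarith) hwS
    (fun x hx => by have := _root_.abs_le.1 (hlap x hx); linarith)
  have hsub : Ω ∩ ball p r ⊆ Ω ∩ ball p r₀ := inter_subset_inter_right _ (ball_subset_ball hrr)
  obtain ⟨C', hC', r', hr', hrr', h'⟩ := c.norm_fderiv_le (d.shrink hr hrr) hC hK
    (fun x hx => by rw [abs_of_pos (hpos x (hsub hx))]; exact h x hx)
    (fun x hx => hlap x (hsub hx))
  exact ⟨C', hC', r', hr', hrr'.trans hrr, h'⟩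

theorem le_fderiv_of_pos (d : c.Data w r₀) {C K : ℝ} (hC : 0 ≤ C) (hK : 0 ≤ K)
    (hpos : ∀ x ∈ Ω ∩ ball p r₀, 0 < w x) (hneg : ∀ x ∈ Ω ∩ ball p r₀, lapC w x ≤ 0)
    (hgrad : ∀ x ∈ Ω ∩ ball p r₀, ‖fderiv ℝ w x‖ ≤ C)
    (hlap : ∀ x ∈ Ω ∩ ball p r₀, ∀ s : ℝ, 0 < s → x + (s : ℂ) * e ∈ Ω ∩ ball p r₀ →
      |lapC w (x + (s : ℂ) * e) - lapC w x| ≤ K * s) :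
    ∃ κ > 0, ∃ r > 0, r ≤ r₀ ∧ ∀ x ∈ Ω ∩ ball p r, κ ≤ fderiv ℝ w x e := by
  obtain ⟨k, hk, r, hr, hrr, h⟩ := c.const_mul_le d hpos hneg
  have hsub : Ω ∩ ball p r ⊆ Ω ∩ ball p r₀ := inter_subset_inter_right _ (ball_subset_ball hrr)
  obtain ⟨κ, hκ, r', hr', hrr', h'⟩ := c.le_fderiv (d.shrink hr hrr) hk hC hK h
    (fun x hx => hgrad x (hsub hx)) (fun x hx s hs hxs => hlap x (hsub hx) s hs (hsub hxs))
  exact ⟨κ, hκ, r', hr', hrr'.trans hrr, h'⟩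

end BdryChart
end Boundary

section Harmonic

open Filter Topology

theorem hasFDerivAt_re_comp {h : ℂ → ℂ} {z : ℂ} (hh : DifferentiableAt ℂ h z) :
    DifferentiableAt ℝ (fun y => (h y).re) z ∧
      ∀ v, fderiv ℝ (fun y => (h y).re) z v = (deriv h z * v).re := by
  have h1 : HasFDerivAt h ((ContinuousLinearMap.toSpanSingleton ℂ (deriv h z)).restrictScalars ℝ) z :=
    (hasDerivAt_iff_hasFDerivAt.1 hh.hasDerivAt).restrictScalars ℝ
  have h2 := Complex.reCLM.hasFDerivAt.comp z h1
  refine ⟨h2.differentiableAt, fun v => ?_⟩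
  have : fderiv ℝ (fun y => (h y).re) z = _ := h2.fderiv
  rw [this]
  simp [mul_comm]

theorem contDiffAt_re_comp {h : ℂ → ℂ} {z : ℂ} (hh : AnalyticAt ℂ h z) :
    ContDiffAt ℝ 2 (fun y => (h y).re) z :=
  Complex.reCLM.contDiff.contDiffAt.comp z (hh.contDiffAt.restrict_scalars ℝ)

theorem lapC_re_comp {h : ℂ → ℂ} {z : ℂ} (hh : AnalyticAt ℂ h z) :
    lapC (fun y => (h y).re) z = 0 := by
  have key : ∀ v : ℂ, fderiv ℝ (fun y => fderiv ℝ (fun y => (h y).re) y v) z v =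
      (deriv (deriv h) z * v * v).re := by
    intro v
    have h1 : (fun y => fderiv ℝ (fun y => (h y).re) y v) =ᶠ[𝓝 z] fun y => (deriv h y * v).re := by
      filter_upwards [hh.eventually_analyticAt] with y hy
      exact (hasFDerivAt_re_comp hy.differentiableAt).2 v
    rw [h1.fderiv_eq]
    have hd : DifferentiableAt ℂ (fun y => deriv h y * v) z := hh.deriv.differentiableAt.mul_const v
    rw [(hasFDerivAt_re_comp hd).2, deriv_mul_const hh.deriv.differentiableAt]
  rw [lapC, key, key]
  simp [mul_assoc]

/-- `-log ‖F‖` is locally the real part of a holomorphic function. -/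
theorem neg_log_norm_eventuallyEq {F : ℂ → ℂ} {z : ℂ} (hF : AnalyticAt ℂ F z) (h0 : F z ≠ 0) :
    ∃ h : ℂ → ℂ, AnalyticAt ℂ h z ∧ deriv h z = -(deriv F z / F z) ∧
      (fun y => -Real.log ‖F y‖) =ᶠ[𝓝 z] fun y => (h y).re := by
  have h1 : AnalyticAt ℂ (fun y => F y / F z) z := hF.div analyticAt_const h0
  have hs : F z / F z ∈ Complex.slitPlane := by rw [div_self h0]; simp
  have h2 : AnalyticAt ℂ (fun y => Complex.log (F y / F z)) z := h1.clog hs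
  have hd : HasDerivAt (fun y => Complex.log (F y / F z)) (deriv F z / F z) z := by
    have := (hF.differentiableAt.hasDerivAt.div_const (F z)).clog hs
    simpa [h0] using this
  refine ⟨fun y => -(Complex.log (F y / F z) + (Real.log ‖F z‖ : ℂ)),
    (h2.add analyticAt_const).neg, (hd.add_const _).neg.deriv, ?_⟩
  filter_upwards [hF.continuousAt.eventually_ne h0] with y hy
  have : (Complex.log (F y / F z)).re = Real.log ‖F y / F z‖ := Complex.log_re _
  simp only [Complex.neg_re, Complex.add_re, this, Complex.ofReal_re, norm_div]
  rw [Real.log_div (norm_ne_zero_iff.2 hy) (norm_ne_zero_iff.2 h0)]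
  ring

end Harmonic

section Cone

/-- The gradient of a real function, as a complex number. -/
def grad (w : ℂ → ℝ) (x : ℂ) : ℂ := ⟨fderiv ℝ w x 1, fderiv ℝ w x Complex.I⟩

theorem fderiv_eq_grad (w : ℂ → ℝ) (x v : ℂ) :
    fderiv ℝ w x v = v.re * (grad w x).re + v.im * (grad w x).im := by
  have : v = v.re • (1 : ℂ) + v.im • Complex.I := by simp [Complex.re_add_im]
  conv_lhs => rw [this]
  rw [map_add, map_smul, map_smul]; rfl

/-- A closed cone around the direction `n`. -/
def cone (n : ℂ) : Set ℂ :=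
  {v | 4 * |(v * starRingEnd ℂ n).im| ≤ 3 * (v * starRingEnd ℂ n).re}

theorem smul_mem_cone {n v : ℂ} {t : ℝ} (ht : 0 ≤ t) (hv : v ∈ cone n) : (t : ℂ) * v ∈ cone n := by
  have hv' : 4 * |(v * starRingEnd ℂ n).im| ≤ 3 * (v * starRingEnd ℂ n).re := hv
  change 4 * |((t : ℂ) * v * starRingEnd ℂ n).im| ≤ 3 * ((t : ℂ) * v * starRingEnd ℂ n).re
  rw [mul_assoc, Complex.im_ofReal_mul, Complex.re_ofReal_mul, abs_mul, abs_of_nonneg ht]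
  nlinarith

theorem mem_cone_of_pos {n v : ℂ}
    (h1 : 0 < (n * ⟨3 / 5, 4 / 5⟩).re * v.re + (n * ⟨3 / 5, 4 / 5⟩).im * v.im)
    (h2 : 0 < (n * ⟨3 / 5, -4 / 5⟩).re * v.re + (n * ⟨3 / 5, -4 / 5⟩).im * v.im) : v ∈ cone n := by
  change 4 * |(v * starRingEnd ℂ n).im| ≤ 3 * (v * starRingEnd ℂ n).re
  simp only [Complex.mul_re, Complex.mul_im, Complex.conj_re, Complex.conj_im] at *
  have : |v.re * -n.im + v.im * n.re| ≤ 3 / 4 * (v.re * n.re - v.im * -n.im) := by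
    rw [abs_le]; constructor <;> linarith
  linarith

theorem norm_mul_le_of_mem_cone {n v w : ℂ} (hn : ‖n‖ = 1) (hv : v ∈ cone n) (hw : w ∈ cone n) :
    7 / 25 * (‖v‖ * ‖w‖) ≤ v.re * w.re + v.im * w.im := by
  have key : ∀ u ∈ cone n, 4 * |(u * starRingEnd ℂ n).im| ≤ 3 * (u * starRingEnd ℂ n).re ∧
      ‖u‖ ≤ 5 / 4 * (u * starRingEnd ℂ n).re := by
    intro u hu
    have hu' : 4 * |(u * starRingEnd ℂ n).im| ≤ 3 * (u * starRingEnd ℂ n).re := hu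
    refine ⟨hu', ?_⟩
    have h1 : ‖u‖ = ‖u * starRingEnd ℂ n‖ := by rw [norm_mul, RCLike.norm_conj, hn, mul_one]
    rw [h1]
    set a := u * starRingEnd ℂ n
    have h3 := abs_nonneg a.im
    apply le_of_sq_le_sq _ (by linarith)
    rw [← Complex.normSq_eq_norm_sq, Complex.normSq_apply]
    have h2 : a.im * a.im = |a.im| * |a.im| := (abs_mul_abs_self _).symm
    nlinarith
  obtain ⟨hv1, hv2⟩ := key v hv
  obtain ⟨hw1, hw2⟩ := key w hw
  have hnn : n.re * n.re + n.im * n.im = 1 := by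
    rw [← Complex.normSq_apply, Complex.normSq_eq_norm_sq, hn]; norm_num
  set a := v * starRingEnd ℂ n
  set b := w * starRingEnd ℂ n
  have e1 : v.re * w.re + v.im * w.im = a.re * b.re + a.im * b.im := by
    simp only [a, b, Complex.mul_re, Complex.mul_im, Complex.conj_re, Complex.conj_im]
    linear_combination (-(v.re * w.re + v.im * w.im)) * hnn
  have ha : 0 ≤ a.re := by linarith [abs_nonneg a.im]
  have hb : 0 ≤ b.re := by linarith [abs_nonneg b.im]
  have h1 : ‖v‖ * ‖w‖ ≤ (5 / 4 * a.re) * (5 / 4 * b.re) := by gcongr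
  have h2 : |a.im| * |b.im| ≤ (3 / 4 * a.re) * (3 / 4 * b.re) := by
    gcongr <;> linarith
  have h3 := neg_abs_le (a.im * b.im)
  rw [abs_mul] at h3
  rw [e1]
  linarith

end Cone

section Field

open Filter Topology

/-- Charts exist at every boundary point, for all directions in an open half-plane. -/
def HasCharts (Ω : Set ℂ) : Prop :=
  ∀ p ∈ frontier Ω, ∃ n : ℂ, ‖n‖ = 1 ∧
    ∀ e : ℂ, ‖e‖ = 1 → 0 < (e * starRingEnd ℂ n).re → Nonempty (BdryChart Ω p e)

theorem norm_dir {s : ℝ} (hs : s ^ 2 = 16 / 25) : ‖(⟨3 / 5, s⟩ : ℂ)‖ = 1 := by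
  have : ‖(⟨3 / 5, s⟩ : ℂ)‖ ^ 2 = 1 := by
    rw [← Complex.normSq_eq_norm_sq, Complex.normSq_apply]; nlinarith
  nlinarith [norm_nonneg (⟨3 / 5, s⟩ : ℂ)]

theorem HasCharts.exists_pair {Ω : Set ℂ} (h : HasCharts Ω) {p : ℂ} (hp : p ∈ frontier Ω) :
    ∃ n : ℂ, ‖n‖ = 1 ∧ Nonempty (BdryChart Ω p (n * ⟨3 / 5, 4 / 5⟩)) ∧
      Nonempty (BdryChart Ω p (n * ⟨3 / 5, -4 / 5⟩)) := by
  obtain ⟨n, hn, he⟩ := h p hp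
  have key : ∀ s : ℝ, s ^ 2 = 16 / 25 → Nonempty (BdryChart Ω p (n * ⟨3 / 5, s⟩)) := by
    intro s hs
    apply he
    · rw [norm_mul, hn, norm_dir hs, mul_one]
    · rw [mul_right_comm, Complex.mul_conj, Complex.normSq_eq_norm_sq, hn]
      simp
  exact ⟨n, hn, key _ (by norm_num), key _ (by norm_num)⟩

variable {Ω : Set ℂ} {F : ℂ → ℂ}

theorem exists_inverse (hU : IsOpen Ω) (hF : IsCompetitor Ω F) (hs : F '' Ω = ball 0 1) :
    ∃ φ : ℂ → ℂ, (∀ z ∈ ball (0 : ℂ) 1, φ z ∈ Ω ∧ F (φ z) = z) ∧ (∀ x ∈ Ω, φ (F x) = x) ∧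
      ∀ z ∈ ball (0 : ℂ) 1, HasDerivAt φ (deriv F (φ z))⁻¹ z := by
  have hex : ∀ z : ℂ, ∃ x : ℂ, z ∈ ball (0 : ℂ) 1 → x ∈ Ω ∧ F x = z := by
    intro z
    by_cases hz : z ∈ ball (0 : ℂ) 1
    · rw [← hs] at hz
      obtain ⟨x, hx, rfl⟩ := hz
      exact ⟨x, fun _ => ⟨hx, rfl⟩⟩
    · exact ⟨0, fun h => absurd h hz⟩
  choose φ hφ using hex
  have hinv : ∀ x ∈ Ω, φ (F x) = x := fun x hx =>
    hF.inj (hφ _ (hF.maps hx)).1 hx (hφ _ (hF.maps hx)).2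
  refine ⟨φ, hφ, hinv, fun z hz => ?_⟩
  obtain ⟨hx, hFx⟩ := hφ z hz
  set x := φ z
  have hst : HasStrictDerivAt F (deriv F x) x :=
    (hF.diff.analyticAt (hU.mem_nhds hx)).hasStrictDerivAt
  have hcont : ContinuousAt φ z := by
    rw [ContinuousAt, ← hFx, ← hst.map_nhds_eq (hF.deriv_ne x hx), tendsto_map'_iff]
    rw [show φ (F x) = x from hinv x hx]
    refine tendsto_id.congr' ?_
    filter_upwards [hU.mem_nhds hx] with y hy using (hinv y hy).symm
  refine HasDerivAt.of_local_left_inverse hcont hst.hasDerivAt (hF.deriv_ne x hx) ?_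
  filter_upwards [isOpen_ball.mem_nhds hz] with y hy using (hφ y hy).2

theorem eventually_lt_norm (hU : IsOpen Ω) (hF : IsCompetitor Ω F) (hs : F '' Ω = ball 0 1)
    {p : ℂ} (hp : p ∈ frontier Ω) {s : ℝ} (hs1 : s < 1) : ∀ᶠ x in 𝓝 p, x ∈ Ω → s < ‖F x‖ := by
  obtain ⟨φ, hφ, hinv, hφd⟩ := exists_inverse hU hF hs
  have hsub : closedBall (0 : ℂ) s ⊆ ball 0 1 := closedBall_subset_ball hs1
  have hK : IsCompact (φ '' closedBall 0 s) := (isCompact_closedBall 0 s).image_of_continuousOn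
    fun z hz => (hφd z (hsub hz)).continuousAt.continuousWithinAt
  have hpK : p ∉ φ '' closedBall 0 s := by
    rintro ⟨z, hz, rfl⟩
    rw [hU.frontier_eq] at hp
    exact hp.2 (hφ z (hsub hz)).1
  filter_upwards [hK.isClosed.isOpen_compl.mem_nhds hpK] with x hx hxΩ
  by_contra! hle
  exact hx ⟨F x, mem_closedBall_zero_iff.2 hle, hinv x hxΩ⟩

open Classical in
/-- Green's function with pole at the origin, extended by zero. -/
def green (Ω : Set ℂ) (F : ℂ → ℂ) (x : ℂ) : ℝ := if x ∈ Ω then -Real.log ‖F x‖ else 0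

theorem green_eventuallyEq (hU : IsOpen Ω) (hF : IsCompetitor Ω F) {x : ℂ} (hx : x ∈ Ω)
    (h0 : F x ≠ 0) : ∃ h : ℂ → ℂ, AnalyticAt ℂ h x ∧ deriv h x = -(deriv F x / F x) ∧
      green Ω F =ᶠ[𝓝 x] fun y => (h y).re := by
  obtain ⟨h, h1, h2, h3⟩ := neg_log_norm_eventuallyEq
    (hF.diff.analyticAt (hU.mem_nhds hx)) h0
  refine ⟨h, h1, h2, EventuallyEq.trans ?_ h3⟩
  filter_upwards [hU.mem_nhds hx] with y hy
  simp [green, hy]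

theorem fderiv_green (hU : IsOpen Ω) (hF : IsCompetitor Ω F) {x : ℂ} (hx : x ∈ Ω)
    (h0 : F x ≠ 0) (v : ℂ) : fderiv ℝ (green Ω F) x v = (-(deriv F x / F x) * v).re := by
  obtain ⟨h, h1, h2, h3⟩ := green_eventuallyEq hU hF hx h0
  rw [h3.fderiv_eq, (hasFDerivAt_re_comp h1.differentiableAt).2, h2]

theorem exists_green_data (hU : IsOpen Ω) (hF : IsCompetitor Ω F) (hs : F '' Ω = ball 0 1)
    {p e : ℂ} (c : BdryChart Ω p e) :
    ∃ r₀, c.Data (green Ω F) r₀ ∧ ∀ x ∈ Ω ∩ ball p r₀, F x ≠ 0 ∧ 0 < green Ω F x ∧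
      green Ω F x ≤ 1 ∧ lapC (green Ω F) x = 0 := by
  have he : Real.exp (-1) < 1 := by simp
  obtain ⟨R, hR, hRF⟩ := Metric.eventually_nhds_iff_ball.1 (eventually_lt_norm hU hF hs c.mem he)
  have hsub : ball p (min R c.R) ⊆ ball p R := ball_subset_ball (min_le_left _ _)
  have hF1 : ∀ x ∈ Ω, ‖F x‖ < 1 := fun x hx => mem_ball_zero_iff.1 (hF.maps hx)
  have hne : ∀ x ∈ Ω ∩ ball p (min R c.R), F x ≠ 0 := fun x hx => norm_pos_iff.1
    ((Real.exp_pos _).trans (hRF x (hsub hx.2) hx.1))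
  have hzero : ∀ x ∈ frontier Ω, green Ω F x = 0 := by
    intro x hx
    rw [hU.frontier_eq] at hx
    simp [green, hx.2]
  refine ⟨min R c.R, ⟨lt_min hR c.R_pos, min_le_right _ _, ?_, ?_, fun x hx => hzero x hx.1⟩, ?_⟩
  · intro x hx
    by_cases hxΩ : x ∈ Ω
    · obtain ⟨h, h1, -, h3⟩ := green_eventuallyEq hU hF hxΩ (hne x ⟨hxΩ, hx.2⟩)
      have : ContinuousAt (fun y => (h y).re) x := (contDiffAt_re_comp h1).continuousAt
      exact (this.congr h3.symm).continuousWithinAt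
    · have hxf : x ∈ frontier Ω := by rw [hU.frontier_eq]; exact ⟨hx.1, hxΩ⟩
      apply ContinuousAt.continuousWithinAt
      rw [ContinuousAt, hzero x hxf, Metric.tendsto_nhds]
      intro ε hε
      have hlt : Real.exp (-ε) < 1 := by simpa using hε
      filter_upwards [eventually_lt_norm hU hF hs hxf hlt] with y hy
      by_cases hyΩ : y ∈ Ω
      · have h1 := hy hyΩ
        have h2 : -ε < Real.log ‖F y‖ := by
          rw [Real.lt_log_iff_exp_lt ((Real.exp_pos _).trans h1)]; exact h1
        have h3 : Real.log ‖F y‖ ≤ 0 := Real.log_nonpos (norm_nonneg _) (hF1 y hyΩ).le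
        simp only [green, hyΩ, if_true, Real.dist_eq, sub_zero]
        rw [abs_of_nonneg (by linarith)]; linarith
      · simpa [green, hyΩ] using hε
  · rintro x hx
    obtain ⟨h, h1, -, h3⟩ := green_eventuallyEq hU hF hx.1 (hne x hx)
    exact (contDiffAt_re_comp h1).congr_of_eventuallyEq h3
  · rintro x hx
    obtain ⟨h, h1, -, h3⟩ := green_eventuallyEq hU hF hx.1 (hne x hx)
    have h4 := hRF x (hsub hx.2) hx.1
    refine ⟨hne x hx, ?_, ?_, ?_⟩
    · simp only [green, hx.1, if_true]
      have := Real.log_neg (norm_pos_iff.2 (hne x hx)) (hF1 x hx.1)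
      linarith
    · simp only [green, hx.1, if_true]
      have := (Real.lt_log_iff_exp_lt ((Real.exp_pos _).trans h4)).2 h4
      linarith
    · rw [lapC_congr h3, lapC_re_comp h1]

theorem exists_green_bounds (hU : IsOpen Ω) (hF : IsCompetitor Ω F) (hs : F '' Ω = ball 0 1)
    {p e : ℂ} (c : BdryChart Ω p e) :
    ∃ C ≥ 0, ∃ κ > 0, ∃ r > 0, ∀ x ∈ Ω ∩ ball p r, F x ≠ 0 ∧ 1 / 2 < ‖F x‖ ∧
      ‖fderiv ℝ (green Ω F) x‖ ≤ C ∧ κ ≤ fderiv ℝ (green Ω F) x e := by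
  obtain ⟨r₀, d, h⟩ := exists_green_data hU hF hs c
  obtain ⟨C, hC, r₁, hr₁, hrr₁, h₁⟩ := c.norm_fderiv_le_of_pos d zero_le_one le_rfl
    (fun x hx => (h x hx).2.1) (fun x hx => (h x hx).2.2.1)
    (fun x hx => by rw [(h x hx).2.2.2]; simp)
  have hsub : Ω ∩ ball p r₁ ⊆ Ω ∩ ball p r₀ := inter_subset_inter_right _ (ball_subset_ball hrr₁)
  obtain ⟨κ, hκ, r₂, hr₂, hrr₂, h₂⟩ := c.le_fderiv_of_pos (d.shrink hr₁ hrr₁) hC (K := 0) le_rfl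
    (fun x hx => (h x (hsub hx)).2.1) (fun x hx => (h x (hsub hx)).2.2.2.le) h₁
    (fun x hx s _ hxs => by rw [(h x (hsub hx)).2.2.2, (h _ (hsub hxs)).2.2.2]; simp)
  obtain ⟨r₃, hr₃, h₃⟩ := Metric.eventually_nhds_iff_ball.1
    (eventually_lt_norm hU hF hs c.mem (show (1 / 2 : ℝ) < 1 by norm_num))
  refine ⟨C, hC, κ, hκ, min r₂ r₃, lt_min hr₂ hr₃, fun x hx => ?_⟩
  have hx2 : x ∈ Ω ∩ ball p r₂ := ⟨hx.1, ball_subset_ball (min_le_left _ _) hx.2⟩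
  have hx1 : x ∈ Ω ∩ ball p r₁ := ⟨hx.1, ball_subset_ball hrr₂ hx2.2⟩
  exact ⟨(h x (hsub hx1)).1, h₃ x (ball_subset_ball (min_le_right _ _) hx.2) hx.1, h₁ x hx1,
    h₂ x hx2⟩

/-- Near a boundary point, `-F / F'` points into a cone and `F'` is bounded above and below. -/
theorem exists_cone_bounds (hU : IsOpen Ω) (hF : IsCompetitor Ω F) (hs : F '' Ω = ball 0 1)
    {p n : ℂ} (c₁ : BdryChart Ω p (n * ⟨3 / 5, 4 / 5⟩)) (c₂ : BdryChart Ω p (n * ⟨3 / 5, -4 / 5⟩)) :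
    ∃ C ≥ 0, ∃ r > 0, ∀ x ∈ Ω ∩ ball p r, -(F x / deriv F x) ∈ cone n ∧
      ‖deriv F x‖ ≤ C ∧ ‖(deriv F x)⁻¹‖ ≤ C := by
  obtain ⟨C, hC, κ₁, hκ₁, r₁, hr₁, h₁⟩ := exists_green_bounds hU hF hs c₁
  obtain ⟨C₂, hC₂, κ₂, hκ₂, r₂, hr₂, h₂⟩ := exists_green_bounds hU hF hs c₂
  refine ⟨max C (2 / κ₁), le_max_of_le_left hC, min r₁ r₂, lt_min hr₁ hr₂, fun x hx => ?_⟩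
  obtain ⟨hne, hhalf, hnorm, hk1⟩ := h₁ x ⟨hx.1, ball_subset_ball (min_le_left _ _) hx.2⟩
  obtain ⟨-, -, -, hk2⟩ := h₂ x ⟨hx.1, ball_subset_ball (min_le_right _ _) hx.2⟩
  have hd := hF.deriv_ne x hx.1
  have hF1 : ‖F x‖ < 1 := mem_ball_zero_iff.1 (hF.maps hx.1)
  set Q := deriv F x / F x
  have hQ : Q ≠ 0 := div_ne_zero hd hne
  have hQd : deriv F x = Q * F x := by simp only [Q]; field_simp
  have hQle : ‖Q‖ ≤ C := by
    have h3 := (fderiv ℝ (green Ω F) x).le_opNorm (-(starRingEnd ℂ Q))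
    rw [fderiv_green hU hF hx.1 hne, norm_neg, RCLike.norm_conj] at h3
    have h4 : (-Q * -(starRingEnd ℂ Q)).re = ‖Q‖ * ‖Q‖ := by
      rw [neg_mul_neg, Complex.mul_conj, Complex.normSq_eq_norm_sq, Complex.ofReal_re, sq]
    change ‖(-Q * -(starRingEnd ℂ Q)).re‖ ≤ _ at h3
    rw [h4, Real.norm_of_nonneg (by positivity)] at h3
    exact (le_of_mul_le_mul_right h3 (norm_pos_iff.2 hQ)).trans hnorm
  have hQge : κ₁ ≤ ‖Q‖ := by
    rw [fderiv_green hU hF hx.1 hne] at hk1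
    calc κ₁ ≤ _ := hk1
      _ ≤ ‖-Q * (n * ⟨3 / 5, 4 / 5⟩)‖ := Complex.re_le_norm _
      _ = ‖Q‖ := by rw [norm_mul, c₁.norm_e, norm_neg, mul_one]
  refine ⟨?_, ?_, ?_⟩
  · have hv : -(starRingEnd ℂ Q) ∈ cone n := by
      rw [fderiv_green hU hF hx.1 hne] at hk1 hk2
      have e : ∀ v : ℂ, (-Q * v).re =
          v.re * (-(starRingEnd ℂ Q)).re + v.im * (-(starRingEnd ℂ Q)).im := by
        intro v; simp; ring
      exact mem_cone_of_pos (by rw [← e]; exact hκ₁.trans_le hk1)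
        (by rw [← e]; exact hκ₂.trans_le hk2)
    have : -(F x / deriv F x) = (((Complex.normSq Q)⁻¹ : ℝ) : ℂ) * -(starRingEnd ℂ Q) := by
      have h1 : F x / deriv F x = Q⁻¹ := by simp [Q]
      rw [h1, Complex.inv_def]; ring
    rw [this]
    exact smul_mem_cone (inv_nonneg.2 (Complex.normSq_nonneg _)) hv
  · refine le_trans ?_ (le_max_left _ _)
    rw [hQd, norm_mul]
    nlinarith [norm_nonneg Q]
  · refine le_trans ?_ (le_max_right _ _)
    rw [hQd, norm_inv, norm_mul, inv_le_comm₀ (by positivity) (by positivity), inv_div]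
    nlinarith

end Field

section Field

open Filter Topology

variable {Ω : Set ℂ} {F : ℂ → ℂ}

theorem exists_deriv_bounds (hU : IsOpen Ω) (hb : Bornology.IsBounded Ω) (hch : HasCharts Ω)
    (hF : IsCompetitor Ω F) (hs : F '' Ω = ball 0 1) :
    ∃ C > 0, ∀ x ∈ Ω, ‖deriv F x‖ ≤ C ∧ ‖(deriv F x)⁻¹‖ ≤ C := by
  have hK : IsCompact (closure Ω) := hb.isCompact_closure
  have hcl : ∃ C > 0, ∀ x ∈ closure Ω, x ∈ Ω → ‖deriv F x‖ ≤ C ∧ ‖(deriv F x)⁻¹‖ ≤ C := by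
    refine hK.induction_on
      (p := fun s => ∃ C > 0, ∀ x ∈ s, x ∈ Ω → ‖deriv F x‖ ≤ C ∧ ‖(deriv F x)⁻¹‖ ≤ C)
      ⟨1, one_pos, by simp⟩ ?_ ?_ ?_
    · rintro s t hst ⟨C, hC, h⟩
      exact ⟨C, hC, fun x hx => h x (hst hx)⟩
    · rintro s t ⟨C, hC, h⟩ ⟨C', hC', h'⟩
      refine ⟨max C C', lt_max_of_lt_left hC, ?_⟩
      rintro x (hx | hx) hxΩ
      · exact ⟨(h x hx hxΩ).1.trans (le_max_left _ _), (h x hx hxΩ).2.trans (le_max_left _ _)⟩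
      · exact ⟨(h' x hx hxΩ).1.trans (le_max_right _ _), (h' x hx hxΩ).2.trans (le_max_right _ _)⟩
    · intro p hp
      by_cases hpΩ : p ∈ Ω
      · have hc : ContinuousAt (deriv F) p :=
          ((hF.diff.deriv hU).differentiableAt (hU.mem_nhds hpΩ)).continuousAt
        have hc' : ContinuousAt (fun x => (deriv F x)⁻¹) p := hc.inv₀ (hF.deriv_ne p hpΩ)
        refine ⟨_, mem_nhdsWithin_of_mem_nhds
          ((hc.norm.eventually_lt_const (lt_add_one _)).and
            (hc'.norm.eventually_lt_const (lt_add_one _))),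
          max (‖deriv F p‖ + 1) (‖(deriv F p)⁻¹‖ + 1), by positivity, fun x hx _ => ?_⟩
        exact ⟨hx.1.le.trans (le_max_left _ _), hx.2.le.trans (le_max_right _ _)⟩
      · have hpf : p ∈ frontier Ω := by rw [hU.frontier_eq]; exact ⟨hp, hpΩ⟩
        obtain ⟨n, hn, ⟨c₁⟩, ⟨c₂⟩⟩ := hch.exists_pair hpf
        obtain ⟨C, hC, r, hr, h⟩ := exists_cone_bounds hU hF hs c₁ c₂
        refine ⟨_, mem_nhdsWithin_of_mem_nhds (ball_mem_nhds p hr), C + 1, by linarith,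
          fun x hx hxΩ => ?_⟩
        have := h x ⟨hxΩ, hx⟩
        exact ⟨this.2.1.trans (by linarith), this.2.2.trans (by linarith)⟩
  obtain ⟨C, hC, h⟩ := hcl
  exact ⟨C, hC, fun x hx => h x (subset_closure hx) hx⟩

theorem exists_cone_radius (hU : IsOpen Ω) (hb : Bornology.IsBounded Ω) (hch : HasCharts Ω)
    (hF : IsCompetitor Ω F) (hs : F '' Ω = ball 0 1) :
    ∃ δ > 0, ∀ p ∈ frontier Ω, ∃ n : ℂ, ‖n‖ = 1 ∧
      Nonempty (BdryChart Ω p (n * ⟨3 / 5, 4 / 5⟩)) ∧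
      Nonempty (BdryChart Ω p (n * ⟨3 / 5, -4 / 5⟩)) ∧
      ∀ x ∈ Ω ∩ ball p δ, -(F x / deriv F x) ∈ cone n := by
  have key : ∀ q : frontier Ω, ∃ R > 0, ∀ p ∈ frontier Ω, p ∈ ball (q : ℂ) R →
      ∃ n : ℂ, ‖n‖ = 1 ∧
      Nonempty (BdryChart Ω p (n * ⟨3 / 5, 4 / 5⟩)) ∧
      Nonempty (BdryChart Ω p (n * ⟨3 / 5, -4 / 5⟩)) ∧
      ∀ x ∈ Ω ∩ ball (q : ℂ) R, -(F x / deriv F x) ∈ cone n := by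
    rintro ⟨q, hq⟩
    obtain ⟨n, hn, ⟨c₁⟩, ⟨c₂⟩⟩ := hch.exists_pair hq
    obtain ⟨C, hC, r, hr, h⟩ := exists_cone_bounds hU hF hs c₁ c₂
    refine ⟨min r (min c₁.R c₂.R), lt_min hr (lt_min c₁.R_pos c₂.R_pos), fun p hp hpq => ?_⟩
    refine ⟨n, hn, ⟨c₁.recenter hp (ball_subset_ball ?_ hpq)⟩,
      ⟨c₂.recenter hp (ball_subset_ball ?_ hpq)⟩, fun x hx => (h x ⟨hx.1, ball_subset_ball ?_ hx.2⟩).1⟩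
    · exact (min_le_right _ _).trans (min_le_left _ _)
    · exact (min_le_right _ _).trans (min_le_right _ _)
    · exact min_le_left _ _
  choose R hR h using key
  have hcomp : IsCompact (frontier Ω) :=
    hb.isCompact_closure.of_isClosed_subset isClosed_frontier frontier_subset_closure
  obtain ⟨δ, hδ, hcov⟩ := lebesgue_number_lemma_of_metric (c := fun q : frontier Ω => ball (q : ℂ) (R q))
    hcomp (fun _ => isOpen_ball) (fun p hp => mem_iUnion.2 ⟨⟨p, hp⟩, mem_ball_self (hR _)⟩)
  refine ⟨δ, hδ, fun p hp => ?_⟩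
  obtain ⟨q, hq⟩ := hcov p hp
  obtain ⟨n, hn, h1, h2, h3⟩ := h q p hp (hq (mem_ball_self hδ))
  exact ⟨n, hn, h1, h2, fun x hx => h3 x ⟨hx.1, hq hx.2⟩⟩

/-- A holomorphic field vanishing at the origin and transversal to the boundary. -/
structure TransversalField (Ω : Set ℂ) (X : ℂ → ℂ) (C c₀ : ℝ) : Prop where
  diff : DifferentiableOn ℂ X Ω
  C_pos : 0 < C
  c₀_pos : 0 < c₀
  norm_le_mul : ∀ x ∈ Ω, ‖X x‖ ≤ C * ‖x‖
  norm_le : ∀ x ∈ Ω, ‖X x‖ ≤ C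
  norm_deriv_le : ∀ x ∈ Ω, ‖deriv X x‖ ≤ C
  cone : ∀ p ∈ frontier Ω, ∃ n : ℂ, ‖n‖ = 1 ∧
    Nonempty (BdryChart Ω p (n * ⟨3 / 5, 4 / 5⟩)) ∧
    Nonempty (BdryChart Ω p (n * ⟨3 / 5, -4 / 5⟩)) ∧
    ∀ᶠ x in 𝓝[Ω] p, -X x ∈ cone n ∧ c₀ ≤ ‖X x‖

theorem exists_field (hU : IsOpen Ω) (hb : Bornology.IsBounded Ω) (hsc : IsSimplyConnected Ω)
    (h0 : 0 ∈ Ω) (hch : HasCharts Ω) : ∃ X C c₀, TransversalField Ω X C c₀ := by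
  obtain ⟨F, hF, hs⟩ := exists_riemann_map hU hsc h0 hb
  obtain ⟨C, hC, hbd⟩ := exists_deriv_bounds hU hb hch hF hs
  obtain ⟨δ, hδ, hcone⟩ := exists_cone_radius hU hb hch hF hs
  obtain ⟨φ, hφ, hinv, hφd⟩ := exists_inverse hU hF hs
  have hF1 : ∀ x ∈ Ω, ‖F x‖ < 1 := fun x hx => mem_ball_zero_iff.1 (hF.maps hx)
  have hφdiff : DifferentiableOn ℂ φ (ball 0 1) := fun z hz =>
    (hφd z hz).differentiableAt.differentiableWithinAt
  obtain ⟨r, hr0, hr1, hrδ⟩ : ∃ r : ℝ, 0 < r ∧ r < 1 ∧ C * (1 - r) < δ / 2 := by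
    refine ⟨max (1 / 2) (1 - δ / (4 * C)), by positivity, max_lt (by norm_num) ?_, ?_⟩
    · have : 0 < δ / (4 * C) := by positivity
      linarith
    · have h1 : 1 - max (1 / 2) (1 - δ / (4 * C)) ≤ δ / (4 * C) := by
        linarith [le_max_right (1 / 2) (1 - δ / (4 * C))]
      calc _ ≤ C * (δ / (4 * C)) := by gcongr
        _ = δ / 4 := by field_simp
        _ < δ / 2 := by linarith
  set Z : ℂ → ℂ := fun z => z * deriv φ z
  have hZdiff : DifferentiableOn ℂ Z (ball 0 1) :=
    differentiableOn_id.mul (hφdiff.deriv isOpen_ball)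
  have hrF : ∀ x ∈ Ω, (r : ℂ) * F x ∈ closedBall (0 : ℂ) r := by
    intro x hx
    rw [mem_closedBall_zero_iff, norm_mul, Complex.norm_of_nonneg hr0.le]
    nlinarith [hF1 x hx]
  have hsub : closedBall (0 : ℂ) r ⊆ ball 0 1 := closedBall_subset_ball hr1
  obtain ⟨M, hM⟩ : ∃ M, ∀ z ∈ closedBall (0 : ℂ) r, ‖deriv Z z‖ ≤ M :=
    (isCompact_closedBall 0 r).exists_bound_of_continuousOn
      ((hZdiff.deriv isOpen_ball).continuousOn.mono hsub)
  have hM0 : 0 ≤ M := (norm_nonneg _).trans (hM 0 (mem_closedBall_self hr0.le))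
  obtain ⟨B, hB, hFB⟩ : ∃ B > 0, ∀ x ∈ Ω, ‖F x‖ ≤ B * ‖x‖ := by
    have h1 := (hF.diff.differentiableAt (hU.mem_nhds h0)).isBigO_sub
    simp only [hF.zero, sub_zero] at h1
    obtain ⟨B, hB, h2⟩ := h1.exists_pos
    obtain ⟨ε, hε, h3⟩ := Metric.eventually_nhds_iff_ball.1 h2.bound
    refine ⟨max B (1 / ε), lt_max_of_lt_left hB, fun x hx => ?_⟩
    by_cases hxε : x ∈ ball (0 : ℂ) ε
    · exact (h3 x hxε).trans (by gcongr; exact le_max_left _ _)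
    · rw [mem_ball_zero_iff, not_lt] at hxε
      calc ‖F x‖ ≤ 1 := (hF1 x hx).le
        _ = 1 / ε * ε := by field_simp
        _ ≤ max B (1 / ε) * ‖x‖ := by gcongr; exact le_max_right _ _
  have hX : ∀ x ∈ Ω, Z (r * F x) = F (φ (r * F x)) / deriv F (φ (r * F x)) := by
    intro x hx
    have h1 := hsub (hrF x hx)
    rw [(hφ _ h1).2, div_eq_mul_inv, ← (hφd _ h1).deriv]
  have hXn : ∀ x ∈ Ω, ‖Z (r * F x)‖ ≤ C * ‖F x‖ := by
    intro x hx
    have h1 := hsub (hrF x hx)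
    rw [hX x hx, (hφ _ h1).2, div_eq_mul_inv, norm_mul, norm_mul, Complex.norm_of_nonneg hr0.le]
    calc r * ‖F x‖ * ‖(deriv F (φ (r * F x)))⁻¹‖ ≤ 1 * ‖F x‖ * C := by
          gcongr; exact (hbd _ (hφ _ h1).1).2
      _ = _ := by ring
  refine ⟨fun x => Z (r * F x), C + C * B + M * C, r / 2 / C, ?_, by positivity, by positivity,
    ?_, ?_, ?_, ?_⟩
  · exact hZdiff.comp (hF.diff.const_mul _) fun x hx => hsub (hrF x hx)
  · intro x hx
    calc _ ≤ C * ‖F x‖ := hXn x hx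
      _ ≤ C * (B * ‖x‖) := by gcongr; exact hFB x hx
      _ ≤ (C + C * B + M * C) * ‖x‖ := by
        rw [← mul_assoc]; gcongr; nlinarith [mul_nonneg hM0 hC.le]
  · intro x hx
    calc _ ≤ C * ‖F x‖ := hXn x hx
      _ ≤ C * 1 := by gcongr; exact (hF1 x hx).le
      _ ≤ (C + C * B + M * C) := by nlinarith [mul_nonneg hM0 hC.le, mul_pos hC hB]
  · intro x hx
    have h1 : HasDerivAt Z (deriv Z (r * F x)) (r * F x) :=
      (hZdiff.differentiableAt (isOpen_ball.mem_nhds (hsub (hrF x hx)))).hasDerivAt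
    have h2 : HasDerivAt (fun x => (r : ℂ) * F x) (r * deriv F x) x :=
      (hF.diff.differentiableAt (hU.mem_nhds hx)).hasDerivAt.const_mul _
    have h3 : HasDerivAt (fun x => Z (r * F x)) (deriv Z (r * F x) * (r * deriv F x)) x :=
      HasDerivAt.comp (h₂ := Z) (h := fun x => (r : ℂ) * F x) x h1 h2
    rw [h3.deriv, norm_mul, norm_mul, Complex.norm_of_nonneg hr0.le]
    calc _ ≤ M * (1 * C) := by
          gcongr
          · exact hM _ (hrF x hx)
          · exact (hbd x hx).1
      _ ≤ _ := by nlinarith [mul_pos hC hB]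
  · intro p hp
    obtain ⟨n, hn, hc1, hc2, hc⟩ := hcone p hp
    refine ⟨n, hn, hc1, hc2, ?_⟩
    have e1 := eventually_lt_norm hU hF hs hp (show (1 / 2 : ℝ) < 1 by norm_num)
    filter_upwards [self_mem_nhdsWithin, mem_nhdsWithin_of_mem_nhds e1,
      mem_nhdsWithin_of_mem_nhds (ball_mem_nhds p (half_pos hδ))] with x hx hx1 hx2
    have h1 := hsub (hrF x hx)
    have hdist : ‖φ (r * F x) - x‖ ≤ C * (1 - r) := by
      calc _ = ‖φ (r * F x) - φ (F x)‖ := by rw [hinv x hx]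
        _ ≤ C * ‖r * F x - F x‖ := by
            refine (convex_ball (0 : ℂ) 1).norm_image_sub_le_of_norm_hasDerivWithin_le
              (f' := fun z => (deriv F (φ z))⁻¹)
              (fun z hz => (hφd z hz).hasDerivWithinAt) (fun z hz => (hbd _ (hφ z hz).1).2)
              (hF.maps hx) h1
        _ = C * ((1 - r) * ‖F x‖) := by
            rw [show (r : ℂ) * F x - F x = -(((1 - r : ℝ) : ℂ) * F x) by push_cast; ring, norm_neg,
              norm_mul, Complex.norm_of_nonneg (by linarith)]
        _ ≤ C * ((1 - r) * 1) := by
            have := (hF1 x hx).le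
            have : 0 ≤ 1 - r := by linarith
            gcongr
        _ = _ := by ring
    constructor
    · rw [hX x hx]
      refine hc _ ⟨(hφ _ h1).1, ?_⟩
      rw [mem_ball, dist_eq_norm] at hx2 ⊢
      calc _ = ‖(φ (r * F x) - x) + (x - p)‖ := by ring_nf
        _ ≤ _ := norm_add_le _ _
        _ < δ := by linarith
    · rw [hX x hx, (hφ _ h1).2, norm_div, norm_mul, Complex.norm_of_nonneg hr0.le]
      have h4 := hx1 hx
      have h5 := (hbd _ (hφ _ h1).1).1
      have h6 : 0 < ‖deriv F (φ (r * F x))‖ := norm_pos_iff.2 (hF.deriv_ne _ (hφ _ h1).1)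
      rw [div_div]
      calc r / (2 * C) = r * (1 / 2) / C := by field_simp
        _ ≤ _ := by gcongr

end Field

section Weight

open Filter Topology

variable {Ω : Set ℂ} {K : ℂ → ℝ} {k₀ k₁ : ℝ}

/-- Quantitative regularity and positivity of a weight. -/
structure IsWeight (Ω : Set ℂ) (K : ℂ → ℝ) (k₀ k₁ : ℝ) : Prop where
  pos : 0 < k₀
  cont : ContinuousOn K (closure Ω)
  smooth : ∀ x ∈ Ω, ContDiffAt ℝ 1 K x
  ge : ∀ x ∈ Ω, k₀ ≤ K x
  le : ∀ x ∈ Ω, K x ≤ k₁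
  norm_fderiv_le : ∀ x ∈ Ω, ‖fderiv ℝ K x‖ ≤ k₁

theorem exists_norm_fderiv_le (hU : IsOpen Ω) (hb : Bornology.IsBounded Ω)
    (hK : ContDiffOn ℝ 1 K (closure Ω)) : ∃ C, ∀ x ∈ Ω, ‖fderiv ℝ K x‖ ≤ C := by
  suffices h : ∃ C, ∀ x ∈ closure Ω, x ∈ Ω → ‖fderiv ℝ K x‖ ≤ C by
    obtain ⟨C, h⟩ := h
    exact ⟨C, fun x hx => h x (subset_closure hx) hx⟩
  refine hb.isCompact_closure.induction_on
    (p := fun s => ∃ C, ∀ x ∈ s, x ∈ Ω → ‖fderiv ℝ K x‖ ≤ C) ⟨0, by simp⟩ ?_ ?_ ?_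
  · rintro s t hst ⟨C, h⟩
    exact ⟨C, fun x hx => h x (hst hx)⟩
  · rintro s t ⟨C, h⟩ ⟨C', h'⟩
    refine ⟨max C C', ?_⟩
    rintro x (hx | hx) hxΩ
    · exact (h x hx hxΩ).trans (le_max_left _ _)
    · exact (h' x hx hxΩ).trans (le_max_right _ _)
  · intro p hp
    have h1 : ContDiffWithinAt ℝ (0 + 1) K (closure Ω) p := by simpa using hK p hp
    obtain ⟨v, hv, -, -, f', hf', hc⟩ :=
      (contDiffWithinAt_succ_iff_hasFDerivWithinAt' (by simp)).1 h1
    rw [insert_eq_of_mem hp] at hv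
    have hc' : ∀ᶠ x in 𝓝[closure Ω] p, ‖f' x‖ < ‖f' p‖ + 1 :=
      hc.continuousWithinAt.norm.eventually_lt_const (lt_add_one _)
    refine ⟨_, inter_mem hv hc', ‖f' p‖ + 1, fun x hx hxΩ => ?_⟩
    have h2 : HasFDerivAt K (f' x) x := (hf' x hx.1).hasFDerivAt
      (mem_of_superset (hU.mem_nhds hxΩ) subset_closure)
    rw [h2.fderiv]; exact le_of_lt hx.2

theorem exists_isWeight (hU : IsOpen Ω) (hb : Bornology.IsBounded Ω) (h0 : 0 ∈ Ω)
    (hK : ContDiffOn ℝ 1 K (closure Ω)) (hpos : ∀ x ∈ closure Ω, 0 < K x) :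
    ∃ k₀ k₁, IsWeight Ω K k₀ k₁ := by
  obtain ⟨C, hC⟩ := exists_norm_fderiv_le hU hb hK
  have hcomp := hb.isCompact_closure
  obtain ⟨m, hm, hmin⟩ := hcomp.exists_isMinOn ⟨0, subset_closure h0⟩ hK.continuousOn
  obtain ⟨M, hM⟩ := hcomp.exists_bound_of_continuousOn hK.continuousOn
  refine ⟨K m, max M C, hpos m hm, hK.continuousOn, fun x hx => ?_, fun x hx => ?_, fun x hx => ?_,
    fun x hx => (hC x hx).trans (le_max_right _ _)⟩
  · exact hK.contDiffAt (mem_of_superset (hU.mem_nhds hx) subset_closure)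
  · exact hmin (subset_closure hx)
  · exact (le_abs_self _).trans ((hM x (subset_closure hx)).trans (le_max_left _ _))

/-- The logarithmic differential of `|x| ^ (2 * α) * K x`. -/
def logDiff (α : ℝ) (K : ℂ → ℝ) (x : ℂ) : ℂ →L[ℝ] ℝ :=
  (2 * α / ‖x‖ ^ 2) • innerSL ℝ x + (K x)⁻¹ • fderiv ℝ K x

theorem IsWeight.norm_logDiff_le (hK : IsWeight Ω K k₀ k₁) (α : ℝ) {x : ℂ} (hx : x ∈ Ω)
    (hx0 : x ≠ 0) : ‖logDiff α K x‖ ≤ 2 * |α| / ‖x‖ + k₁ / k₀ := by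
  have hn : 0 < ‖x‖ := norm_pos_iff.2 hx0
  have hKx := hK.pos.trans_le (hK.ge x hx)
  refine (norm_add_le _ _).trans (add_le_add (le_of_eq ?_) ?_)
  · rw [norm_smul, innerSL_apply_norm, norm_div, norm_mul, norm_pow, norm_norm, Real.norm_eq_abs,
      Real.norm_eq_abs, abs_two]
    field_simp
  · rw [norm_smul, norm_inv, Real.norm_of_nonneg hKx.le, div_eq_inv_mul]
    have := hK.pos
    gcongr
    · exact hK.ge x hx
    · exact hK.norm_fderiv_le x hx

/-- The right-hand side of the Liouville equation. -/
def source (α : ℝ) (K : ℂ → ℝ) (lam : ℝ) (u : ℂ → ℝ) (x : ℂ) : ℝ :=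
  lam * ‖x‖ ^ (2 * α) * K x * Real.exp (u x)

/-- A solution of the singular Liouville equation. -/
structure IsSolution (Ω : Set ℂ) (α : ℝ) (K : ℂ → ℝ) (lam : ℝ) (u : ℂ → ℝ) : Prop where
  lam_pos : 0 < lam
  cont : ContinuousOn u (closure Ω)
  smooth : ∀ x ∈ Ω, x ≠ 0 → ContDiffAt ℝ 2 u x
  eq : ∀ x ∈ Ω, x ≠ 0 → lapC u x = -source α K lam u x
  zero : ∀ x ∈ frontier Ω, u x = 0

theorem hasFDerivAt_source {α lam : ℝ} {u : ℂ → ℝ} {x : ℂ} (hx : x ≠ 0) (hK0 : K x ≠ 0)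
    (hK : DifferentiableAt ℝ K x) (hu : DifferentiableAt ℝ u x) :
    HasFDerivAt (source α K lam u) (source α K lam u x • (logDiff α K x + fderiv ℝ u x)) x := by
  have hn : 0 < ‖x‖ := norm_pos_iff.2 hx
  have h1 : HasFDerivAt (fun x : ℂ => (‖x‖ ^ 2) ^ α)
      ((α * (‖x‖ ^ 2) ^ (α - 1)) • (2 • innerSL ℝ x)) x :=
    HasFDerivAt.rpow_const (hasStrictFDerivAt_norm_sq x).hasFDerivAt (Or.inl (by positivity))
  have h2 := ((h1.const_mul lam).mul hK.hasFDerivAt).mul hu.hasFDerivAt.exp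
  have e : source α K lam u = fun x => lam * (‖x‖ ^ 2) ^ α * K x * Real.exp (u x) := by
    ext y
    rw [source, Real.rpow_mul (norm_nonneg _)]; simp
  rw [e]
  refine h2.congr_fderiv ?_
  ext v
  have h3 : (‖x‖ ^ 2) ^ (α - 1) = (‖x‖ ^ 2) ^ α / ‖x‖ ^ 2 := Real.rpow_sub_one (by positivity) _
  simp [logDiff, h3]
  field_simp
  ring

theorem contDiffAt_source {α lam : ℝ} {u : ℂ → ℝ} {x : ℂ} (hx : x ≠ 0)
    (hK : ContDiffAt ℝ 1 K x) (hu : ContDiffAt ℝ 1 u x) : ContDiffAt ℝ 1 (source α K lam u) x := by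
  have hn : ‖x‖ ≠ 0 := norm_ne_zero_iff.2 hx
  exact ((contDiffAt_const.mul ((contDiffAt_norm ℝ hx).rpow_const_of_ne hn)).mul hK).mul hu.exp

theorem source_pos {α lam : ℝ} {u : ℂ → ℝ} {x : ℂ} (hl : 0 < lam) (hx : x ≠ 0) (hK : 0 < K x) :
    0 < source α K lam u x := by
  have hn : 0 < ‖x‖ := norm_pos_iff.2 hx
  unfold source; positivity

end Weight

section Solution

open Filter Topology

theorem le_of_lapC_pos_punctured {U : Set ℂ} {w : ℂ → ℝ} {c : ℝ} (hU : IsOpen U)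
    (hb : Bornology.IsBounded U) (h0 : 0 ∈ U) (hcont : ContinuousOn w (closure U))
    (hbd : ∀ x ∈ frontier U, w x ≤ c)
    (hlap : ∀ x ∈ U, x ≠ 0 → ContDiffAt ℝ 2 w x ∧ 0 < lapC w x) : ∀ x ∈ U, w x ≤ c := by
  obtain ⟨D, hD0, hD⟩ : ∃ D > 0, ∀ x ∈ closure U, ‖x‖ ≤ D := by
    obtain ⟨D, hD⟩ := hb.closure.exists_norm_le
    exact ⟨max D 1, by positivity, fun x hx => (hD x hx).trans (le_max_left _ _)⟩
  obtain ⟨M, hM⟩ := hb.isCompact_closure.exists_bound_of_continuousOn hcont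
  have hM0 : 0 ≤ M := (norm_nonneg _).trans (hM 0 (subset_closure h0))
  have hne : ∀ x ∈ U, x ≠ 0 → w x ≤ c := by
    intro x₀ hx₀ hx₀0
    have hn : 0 < ‖x₀‖ := norm_pos_iff.2 hx₀0
    have key : ∀ ε > 0, w x₀ - ε * (-Real.log ‖x₀‖) ≤ c + ε * Real.log D := by
      intro ε hε
      set r := min (‖x₀‖ / 2) (D * Real.exp (-((M + |c|) / ε))) with hr
      have hr0 : 0 < r := lt_min (by positivity) (by positivity)
      have hrx : r < ‖x₀‖ := (min_le_left _ _).trans_lt (by linarith)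
      have hrlog : M + |c| ≤ ε * (Real.log D - Real.log r) := by
        have h1 : Real.log r ≤ Real.log D - (M + |c|) / ε := by
          calc _ ≤ Real.log (D * Real.exp (-((M + |c|) / ε))) :=
                Real.log_le_log hr0 (min_le_right _ _)
            _ = _ := by rw [Real.log_mul hD0.ne' (Real.exp_pos _).ne', Real.log_exp]; ring
        calc M + |c| = ε * ((M + |c|) / ε) := by field_simp
          _ ≤ _ := by gcongr; linarith
      have hlogn : ∀ x : ℂ, x ≠ 0 → ContDiffAt ℝ 2 (fun y : ℂ => -Real.log ‖y‖) x ∧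
          lapC (fun y : ℂ => -Real.log ‖y‖) x = 0 := by
        intro x hx
        obtain ⟨h, h1, -, h2⟩ := neg_log_norm_eventuallyEq (F := fun y => y) analyticAt_id hx
        exact ⟨(contDiffAt_re_comp h1).congr_of_eventuallyEq h2,
          by rw [lapC_congr h2, lapC_re_comp h1]⟩
      refine le_of_lapC_pos (u := fun x => w x - ε * (-Real.log ‖x‖)) (K := closure U \ ball 0 r)
        (G := U \ closedBall 0 r) (hb.isCompact_closure.diff isOpen_ball)
        (hU.sdiff isClosed_closedBall) (sdiff_subset_sdiff subset_closure ball_subset_closedBall)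
        ?_ ?_ ?_ x₀ ⟨subset_closure hx₀, by simp [hrx.le]⟩
      · refine (hcont.mono sdiff_subset).sub (continuousOn_const.mul fun x hx => ?_)
        have hx0 : x ≠ 0 := by rintro rfl; exact hx.2 (mem_ball_self hr0)
        exact (hlogn x hx0).1.continuousAt.continuousWithinAt
      · rintro x ⟨hx, hxr⟩ hxG
        rw [mem_ball_zero_iff, not_lt] at hxr
        have hx0 : 0 < ‖x‖ := hr0.trans_le hxr
        by_cases hxU : x ∈ U
        · have hxr' : ‖x‖ = r := le_antisymm (by
            by_contra! h
            exact hxG ⟨hxU, by simpa using h⟩) hxr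
          have h1 := (le_abs_self _).trans (hM x hx)
          have h2 := neg_abs_le c
          simp only [hxr']
          linarith
        · have hxf : x ∈ frontier U := by rw [hU.frontier_eq]; exact ⟨hx, hxU⟩
          have h1 := Real.log_le_log hx0 (hD x hx)
          have h2 := hbd x hxf
          have h3 : ε * Real.log ‖x‖ ≤ ε * Real.log D := by gcongr
          linarith
      · rintro x ⟨hx, hxr⟩ -
        have hx0 : x ≠ 0 := by rintro rfl; exact hxr (mem_closedBall_self hr0.le)
        obtain ⟨h1, h2⟩ := hlap x hx hx0
        obtain ⟨h3, h4⟩ := hlogn x hx0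
        refine ⟨h1.sub (contDiffAt_const.mul h3), ?_⟩
        rw [lapC_sub h1 (contDiffAt_const.mul h3), lapC_const_mul _ h3, h4]
        simpa using h2
    by_contra! hlt
    have hL : 0 ≤ Real.log D - Real.log ‖x₀‖ :=
      sub_nonneg.2 (Real.log_le_log hn (hD x₀ (subset_closure hx₀)))
    have hpos : 0 < w x₀ - c := by linarith
    have h1 := key ((w x₀ - c) / (Real.log D - Real.log ‖x₀‖ + 1)) (by positivity)
    have h2 : (w x₀ - c) / (Real.log D - Real.log ‖x₀‖ + 1) * (Real.log D - Real.log ‖x₀‖)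
        < w x₀ - c := by
      rw [div_mul_eq_mul_div, div_lt_iff₀ (by linarith)]
      nlinarith
    nlinarith
  intro x hx
  by_cases hx0 : x = 0
  · subst hx0
    have hc : ContinuousAt w 0 :=
      hcont.continuousAt (mem_of_superset (hU.mem_nhds h0) subset_closure)
    refine le_of_tendsto (hc.tendsto.mono_left (nhdsWithin_le_nhds (s := {0}ᶜ))) ?_
    filter_upwards [self_mem_nhdsWithin, mem_nhdsWithin_of_mem_nhds (hU.mem_nhds h0)] with x hx hxU
    exact hne x hxU hx
  · exact hne x hx hx0

variable {Ω : Set ℂ} {K : ℂ → ℝ} {k₀ k₁ α lam : ℝ} {u : ℂ → ℝ}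

theorem lapC_neg {z : ℂ} (hu : ContDiffAt ℝ 2 u z) : lapC (fun y => -u y) z = -lapC u z := by
  have := lapC_const_mul (-1) hu
  simpa using this

theorem IsSolution.pos (hu : IsSolution Ω α K lam u) (hK : IsWeight Ω K k₀ k₁) (hU : IsOpen Ω)
    (hb : Bornology.IsBounded Ω) (h0 : 0 ∈ Ω) : ∀ x ∈ Ω, 0 < u x := by
  have hsrc : ∀ x ∈ Ω, x ≠ 0 → 0 < source α K lam u x := fun x hx hx0 =>
    source_pos hu.lam_pos hx0 (hK.pos.trans_le (hK.ge x hx))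
  have hlap : ∀ x ∈ Ω, x ≠ 0 → ContDiffAt ℝ 2 (fun y => -u y) x ∧ 0 < lapC (fun y => -u y) x := by
    intro x hx hx0
    refine ⟨(hu.smooth x hx hx0).neg, ?_⟩
    rw [lapC_neg (hu.smooth x hx hx0), hu.eq x hx hx0, neg_neg]
    exact hsrc x hx hx0
  have hnonneg : ∀ x ∈ Ω, -u x ≤ 0 :=
    le_of_lapC_pos_punctured hU hb h0 hu.cont.neg (fun x hx => by simp [hu.zero x hx]) hlap
  have hne : ∀ x ∈ Ω, x ≠ 0 → 0 < u x := by
    intro x hx hx0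
    by_contra! hle
    have hz : u x = 0 := le_antisymm hle (by linarith [hnonneg x hx])
    have hmax : IsLocalMax (fun y => -u y) x := by
      filter_upwards [hU.mem_nhds hx] with y hy
      rw [hz, neg_zero]; exact hnonneg y hy
    exact absurd (hmax.lapC_nonpos (hlap x hx hx0).1) (not_le.2 (hlap x hx hx0).2)
  intro x hx
  by_cases hx0 : x = 0
  · subst hx0
    obtain ⟨r, hr, hrΩ⟩ := nhds_basis_closedBall.mem_iff.1 (hU.mem_nhds h0)
    have hsub : sphere (0 : ℂ) r ⊆ Ω := sphere_subset_closedBall.trans hrΩ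
    obtain ⟨m, hm, hmin⟩ := (isCompact_sphere (0 : ℂ) r).exists_isMinOn
      (NormedSpace.sphere_nonempty.2 hr.le) (hu.cont.mono (hsub.trans subset_closure))
    have hm0 : m ≠ 0 := by
      rintro rfl
      simp at hm; linarith
    have := le_of_lapC_pos_punctured (U := ball (0 : ℂ) r) (w := fun y => -u y) (c := -u m)
      isOpen_ball isBounded_ball (mem_ball_self hr)
      (by
        rw [closure_ball _ hr.ne']
        exact (hu.cont.mono (hrΩ.trans subset_closure)).neg)
      (by
        rw [frontier_ball _ hr.ne']
        exact fun x hx => neg_le_neg (hmin hx))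
      (fun x hx => hlap x (hrΩ (ball_subset_closedBall hx))) 0 (mem_ball_self hr)
    linarith [hne m (hsub hm) hm0]
  · exact hne x hx hx0

theorem continuousOn_source (hK : ContinuousOn K (closure Ω)) (hu : ContinuousOn u (closure Ω)) :
    ContinuousOn (source α K lam u) (closure Ω \ {0}) := by
  refine ((continuousOn_const.mul ?_).mul (hK.mono sdiff_subset)).mul
    (hu.mono sdiff_subset).rexp
  exact continuousOn_id.norm.rpow_const fun x hx => Or.inl (norm_ne_zero_iff.2 hx.2)

theorem IsSolution.le_fderiv (hu : IsSolution Ω α K lam u) (hK : IsWeight Ω K k₀ k₁)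
    (hb : Bornology.IsBounded Ω) (h0 : 0 ∈ Ω) {p e : ℂ} (c : BdryChart Ω p e) :
    ∃ κ > 0, ∀ᶠ x in 𝓝[Ω] p, κ ≤ fderiv ℝ u x e := by
  have hU := c.isOpen
  have hp0 : p ≠ 0 := by
    rintro rfl
    have := c.mem
    rw [hU.frontier_eq] at this
    exact this.2 h0
  have hn : 0 < ‖p‖ := norm_pos_iff.2 hp0
  set r₀ := min c.R (‖p‖ / 2)
  have hr₀ : 0 < r₀ := lt_min c.R_pos (by positivity)
  have hfar : ∀ x ∈ closedBall p (‖p‖ / 2), ‖p‖ / 2 ≤ ‖x‖ := by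
    intro x hx
    rw [mem_closedBall, dist_eq_norm] at hx
    linarith [norm_sub_norm_le p x, norm_sub_rev p x]
  have hfar' : ∀ x ∈ ball p r₀, ‖p‖ / 2 ≤ ‖x‖ := fun x hx =>
    hfar x (ball_subset_closedBall (ball_subset_ball (min_le_right _ _) hx))
  have hne : ∀ x ∈ ball p r₀, x ≠ 0 := fun x hx => norm_pos_iff.1
    (lt_of_lt_of_le (by positivity) (hfar' x hx))
  have hpos := hu.pos hK hU hb h0
  have hcomp : IsCompact (closure Ω ∩ closedBall p (‖p‖ / 2)) :=
    hb.isCompact_closure.inter_right isClosed_closedBall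
  have hsub : Ω ∩ ball p r₀ ⊆ closure Ω ∩ closedBall p (‖p‖ / 2) :=
    inter_subset_inter subset_closure
      ((ball_subset_ball (min_le_right _ _)).trans ball_subset_closedBall)
  obtain ⟨S, hS⟩ := hcomp.exists_bound_of_continuousOn (hu.cont.mono inter_subset_left)
  obtain ⟨M, hM⟩ := hcomp.exists_bound_of_continuousOn
    ((continuousOn_source (α := α) (lam := lam) hK.cont hu.cont).mono fun x hx => ⟨hx.1, by
      have := hfar x hx.2
      rintro rfl
      simp at this; linarith⟩)
  have hpcl : p ∈ closure Ω ∩ closedBall p (‖p‖ / 2) :=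
    ⟨frontier_subset_closure c.mem, mem_closedBall_self (by positivity)⟩
  have hS0 : 0 ≤ S := (norm_nonneg _).trans (hS p hpcl)
  have hM0 : 0 ≤ M := (norm_nonneg _).trans (hM p hpcl)
  have hlap : ∀ x ∈ Ω ∩ ball p r₀, lapC u x = -source α K lam u x := fun x hx =>
    hu.eq x hx.1 (hne x hx.2)
  have hsrc : ∀ x ∈ Ω ∩ ball p r₀, 0 < source α K lam u x := fun x hx =>
    source_pos hu.lam_pos (hne x hx.2) (hK.pos.trans_le (hK.ge x hx.1))
  have d : c.Data u r₀ := ⟨hr₀, min_le_left _ _, hu.cont.mono inter_subset_left,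
    fun x hx => hu.smooth x hx.1 (hne x hx.2), fun x hx => hu.zero x hx.1⟩
  obtain ⟨C, hC, r₁, hr₁, hrr₁, hgrad⟩ := c.norm_fderiv_le_of_pos d hS0 hM0
    (fun x hx => hpos x hx.1) (fun x hx => (le_abs_self _).trans (hS x (hsub hx)))
    (fun x hx => by rw [hlap x hx, abs_neg]; exact hM x (hsub hx))
  have hs1 : Ω ∩ ball p r₁ ⊆ Ω ∩ ball p r₀ := inter_subset_inter_right _ (ball_subset_ball hrr₁)
  set B := M * (2 * |α| / (‖p‖ / 2) + k₁ / k₀ + C)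
  have hder : ∀ x ∈ Ω ∩ ball p r₁, HasFDerivAt (source α K lam u)
      (source α K lam u x • (logDiff α K x + fderiv ℝ u x)) x ∧
      ‖source α K lam u x • (logDiff α K x + fderiv ℝ u x)‖ ≤ B := by
    intro x hx
    have hx0 := hs1 hx
    refine ⟨hasFDerivAt_source (hne x hx0.2) (hK.pos.trans_le (hK.ge x hx.1)).ne'
      ((hK.smooth x hx.1).differentiableAt (by norm_num))
      ((d.smooth x hx0).differentiableAt (by norm_num)), ?_⟩
    rw [norm_smul]
    refine mul_le_mul (hM x (hsub hx0)) ?_ (norm_nonneg _) hM0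
    refine (norm_add_le _ _).trans (add_le_add ?_ (hgrad x hx))
    refine (hK.norm_logDiff_le α hx.1 (hne x hx0.2)).trans ?_
    gcongr
    exact hfar' x hx0.2
  have hB0 : 0 ≤ max B 0 := le_max_right _ _
  obtain ⟨κ, hκ, r, hr, hrr, h⟩ := c.le_fderiv_of_pos (d.shrink hr₁ hrr₁) hC hB0
    (fun x hx => hpos x hx.1)
    (fun x hx => by rw [hlap x (hs1 hx)]; linarith [hsrc x (hs1 hx)]) hgrad (by
      intro x hx s hs hxs
      have hin : ∀ t ∈ Icc 0 s, x + (t : ℂ) * e ∈ Ω ∩ ball p r₁ := by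
        intro t ht
        have h1 := BdryChart.segment_mem hx.2 hxs.2 ht
        have hbR : ball p r₁ ⊆ ball p c.R := ball_subset_ball (hrr₁.trans d.le)
        refine ⟨(c.mem_iff _ (hbR h1)).2 ?_, h1⟩
        have h2 := c.mono ht.1 (hbR hx.2) (hbR h1)
        have h3 := (c.mem_iff _ (hbR hx.2)).1 hx.1
        nlinarith [mul_nonneg c.m_pos.le ht.1]
      have hline : ∀ t ∈ Icc 0 s, HasDerivWithinAt
          (fun t : ℝ => source α K lam u (x + (t : ℂ) * e))
          (fderiv ℝ (source α K lam u) (x + (t : ℂ) * e) e) (Icc 0 s) t := fun t ht =>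
        (BdryChart.hasDerivAt_line (hder _ (hin t ht)).1.differentiableAt).hasDerivWithinAt
      have := (convex_Icc 0 s).norm_image_sub_le_of_norm_hasDerivWithin_le hline (C := B)
        (fun t ht => by
          rw [(hder _ (hin t ht)).1.fderiv]
          refine ((_ : ℂ →L[ℝ] ℝ).le_opNorm e).trans ?_
          rw [c.norm_e, mul_one]
          exact (hder _ (hin t ht)).2) (left_mem_Icc.2 hs.le) (right_mem_Icc.2 hs.le)
      rw [hlap _ (hs1 hx), hlap _ (hs1 hxs), abs_sub_comm]
      simp only [Complex.ofReal_zero, zero_mul, add_zero, sub_zero, Real.norm_eq_abs,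
        abs_of_pos hs] at this
      calc _ = |source α K lam u (x + (s : ℂ) * e) - source α K lam u x| := by ring_nf
        _ ≤ B * s := this
        _ ≤ _ := by gcongr; exact le_max_left _ _)
  refine ⟨κ, hκ, ?_⟩
  filter_upwards [self_mem_nhdsWithin, mem_nhdsWithin_of_mem_nhds (ball_mem_nhds p hr)] with x hx hx'
  exact h x ⟨hx, hx'⟩

end Solution

section Solution

open Filter Topology

variable {Ω : Set ℂ} {K : ℂ → ℝ} {k₀ k₁ α lam : ℝ} {u : ℂ → ℝ} {X : ℂ → ℂ} {C c₀ : ℝ}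

/-- Near the boundary, the gradient of a solution is transversal to the field. -/
theorem IsSolution.exists_collar (hu : IsSolution Ω α K lam u) (hK : IsWeight Ω K k₀ k₁)
    (hU : IsOpen Ω) (hb : Bornology.IsBounded Ω) (h0 : 0 ∈ Ω) (hX : TransversalField Ω X C c₀) :
    ∃ ε > 0, ∀ x ∈ Ω, u x ≤ ε → 7 / 25 * (c₀ * ‖grad u x‖) ≤ fderiv ℝ u x (-X x) := by
  suffices h : ∃ ε > 0, ∀ x ∈ closure Ω, x ∈ Ω → u x ≤ ε →
      7 / 25 * (c₀ * ‖grad u x‖) ≤ fderiv ℝ u x (-X x) by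
    obtain ⟨ε, hε, h⟩ := h
    exact ⟨ε, hε, fun x hx => h x (subset_closure hx) hx⟩
  have hpos := hu.pos hK hU hb h0
  refine hb.isCompact_closure.induction_on (p := fun s => ∃ ε > 0, ∀ x ∈ s, x ∈ Ω → u x ≤ ε →
      7 / 25 * (c₀ * ‖grad u x‖) ≤ fderiv ℝ u x (-X x)) ⟨1, one_pos, by simp⟩ ?_ ?_ ?_
  · rintro s t hst ⟨ε, hε, h⟩
    exact ⟨ε, hε, fun x hx => h x (hst hx)⟩
  · rintro s t ⟨ε, hε, h⟩ ⟨ε', hε', h'⟩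
    refine ⟨min ε ε', lt_min hε hε', ?_⟩
    rintro x (hx | hx) hxΩ hux
    · exact h x hx hxΩ (hux.trans (min_le_left _ _))
    · exact h' x hx hxΩ (hux.trans (min_le_right _ _))
  · intro p hp
    by_cases hpΩ : p ∈ Ω
    · have h1 : ∀ᶠ x in 𝓝[closure Ω] p, u p / 2 < u x :=
        (hu.cont p hp).eventually_const_lt (by linarith [hpos p hpΩ])
      exact ⟨_, h1, u p / 2, by linarith [hpos p hpΩ], fun x hx _ hux => absurd hux (not_le.2 hx)⟩
    · have hpf : p ∈ frontier Ω := by rw [hU.frontier_eq]; exact ⟨hp, hpΩ⟩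
      obtain ⟨n, hn, ⟨c₁⟩, ⟨c₂⟩, hc⟩ := hX.cone p hpf
      obtain ⟨κ₁, hκ₁, h₁⟩ := hu.le_fderiv hK hb h0 c₁
      obtain ⟨κ₂, hκ₂, h₂⟩ := hu.le_fderiv hK hb h0 c₂
      have hev : ∀ᶠ x in 𝓝[Ω] p, 7 / 25 * (c₀ * ‖grad u x‖) ≤ fderiv ℝ u x (-X x) := by
        filter_upwards [hc, h₁, h₂] with x hx hx1 hx2
        rw [fderiv_eq_grad] at hx1 hx2 ⊢
        have := norm_mul_le_of_mem_cone hn hx.1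
          (mem_cone_of_pos (hκ₁.trans_le hx1) (hκ₂.trans_le hx2))
        refine le_trans ?_ this
        rw [norm_neg]
        gcongr
        exact hx.2
      rw [eventually_nhdsWithin_iff] at hev
      exact ⟨_, mem_nhdsWithin_of_mem_nhds hev, 1, one_pos, fun x hx hxΩ _ => hx hxΩ⟩

theorem IsSolution.exists_source_le (hu : IsSolution Ω α K lam u) (hK : IsWeight Ω K k₀ k₁)
    (hU : IsOpen Ω) (h0 : 0 ∈ Ω) :
    ∃ B ≥ 0, ∀ᶠ x in 𝓝 0, 0 ≤ source α K lam u x ∧ source α K lam u x ≤ B * ‖x‖ ^ (2 * α) := by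
  have hc : ContinuousAt u 0 :=
    hu.cont.continuousAt (mem_of_superset (hU.mem_nhds h0) subset_closure)
  have hl := hu.lam_pos
  have hk := hK.pos
  have hk1 : 0 ≤ k₁ := hk.le.trans ((hK.ge 0 h0).trans (hK.le 0 h0))
  refine ⟨lam * k₁ * Real.exp (u 0 + 1), by positivity, ?_⟩
  filter_upwards [hU.mem_nhds h0, hc.eventually_lt_const (lt_add_one _)] with x hx hux
  have h1 := hK.le x hx
  have h2 : 0 ≤ K x := hk.le.trans (hK.ge x hx)
  unfold source
  refine ⟨by positivity, ?_⟩
  calc lam * ‖x‖ ^ (2 * α) * K x * Real.exp (u x)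
      ≤ lam * ‖x‖ ^ (2 * α) * k₁ * Real.exp (u 0 + 1) := by gcongr
    _ = _ := by ring

theorem IsSolution.tendsto_sq_mul_source (hα : -1 < α) (hu : IsSolution Ω α K lam u)
    (hK : IsWeight Ω K k₀ k₁) (hU : IsOpen Ω) (h0 : 0 ∈ Ω) :
    Tendsto (fun x => ‖x‖ ^ 2 * source α K lam u x) (𝓝[≠] 0) (𝓝 0) := by
  obtain ⟨B, hB, h⟩ := hu.exists_source_le hK hU h0
  have h2 : Tendsto (fun x : ℂ => B * ‖x‖ ^ (2 + 2 * α)) (𝓝[≠] 0) (𝓝 0) := by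
    have : ContinuousAt (fun x : ℂ => B * ‖x‖ ^ (2 + 2 * α)) 0 :=
      continuousAt_const.mul (continuousAt_id.norm.rpow_const (Or.inr (by linarith)))
    have h3 := this.tendsto
    simp only [norm_zero, Real.zero_rpow (show 2 + 2 * α ≠ 0 by linarith), mul_zero] at h3
    exact h3.mono_left nhdsWithin_le_nhds
  refine squeeze_zero' ?_ ?_ h2
  · filter_upwards [nhdsWithin_le_nhds h] with x hx
    exact mul_nonneg (by positivity) hx.1
  · filter_upwards [nhdsWithin_le_nhds h, self_mem_nhdsWithin] with x hx hx0
    have hn : 0 < ‖x‖ := norm_pos_iff.2 hx0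
    rw [Real.rpow_add hn]
    calc _ ≤ ‖x‖ ^ 2 * (B * ‖x‖ ^ (2 * α)) := by gcongr; exact hx.2
      _ = _ := by norm_num; ring

theorem rpow_le_of_mem {a b s : ℝ} (ha : 0 < a) (h1 : a / 2 ≤ b) (h2 : b ≤ 2 * a) :
    b ^ s ≤ (2 ^ s + (1 / 2) ^ s) * a ^ s := by
  have hb : 0 < b := by linarith
  rw [add_mul, ← Real.mul_rpow zero_le_two ha.le, ← Real.mul_rpow (by norm_num) ha.le]
  rcases le_total 0 s with hs | hs
  · have := Real.rpow_le_rpow hb.le h2 hs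
    have : 0 ≤ (1 / 2 * a) ^ s := by positivity
    linarith
  · have := Real.rpow_le_rpow_of_nonpos (show 0 < 1 / 2 * a by linarith)
      (show 1 / 2 * a ≤ b by linarith) hs
    have : 0 ≤ (2 * a) ^ s := by positivity
    linarith

theorem IsSolution.tendsto_norm_mul_fderiv (hα : -1 < α) (hu : IsSolution Ω α K lam u)
    (hK : IsWeight Ω K k₀ k₁) (hU : IsOpen Ω) (h0 : 0 ∈ Ω) :
    Tendsto (fun x => ‖x‖ * ‖fderiv ℝ u x‖) (𝓝[≠] 0) (𝓝 0) := by
  obtain ⟨B, hB, hsrc⟩ := hu.exists_source_le hK hU h0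
  have hc : ContinuousAt u 0 :=
    hu.cont.continuousAt (mem_of_superset (hU.mem_nhds h0) subset_closure)
  set E := B * (2 ^ (2 * α) + (1 / 2) ^ (2 * α)) with hE
  have hE0 : 0 ≤ E := by positivity
  have main : ∀ S > 0, ∀ᶠ x in 𝓝[≠] (0 : ℂ),
      ‖x‖ * ‖fderiv ℝ u x‖ ≤ 8 * S + (E * ‖x‖ ^ (2 + 2 * α) + ‖x‖ ^ 2) := by
    intro S hS
    have hev : ∀ᶠ y in 𝓝 (0 : ℂ), y ∈ Ω ∧ |u y - u 0| ≤ S ∧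
        0 ≤ source α K lam u y ∧ source α K lam u y ≤ B * ‖y‖ ^ (2 * α) := by
      filter_upwards [hU.mem_nhds h0, hsrc, Metric.tendsto_nhds.1 hc S hS] with y h1 h2 h3
      exact ⟨h1, le_of_lt (by rwa [Real.dist_eq] at h3), h2⟩
    obtain ⟨ρ, hρ, hball⟩ := Metric.eventually_nhds_iff_ball.1 hev
    filter_upwards [self_mem_nhdsWithin,
      mem_nhdsWithin_of_mem_nhds (ball_mem_nhds (0 : ℂ) (half_pos hρ))] with x hx0 hxρ
    have hn : 0 < ‖x‖ := norm_pos_iff.2 hx0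
    rw [mem_ball_zero_iff] at hxρ
    have hb : ∀ y ∈ ball x (‖x‖ / 2), y ∈ ball (0 : ℂ) ρ ∧ ‖x‖ / 2 ≤ ‖y‖ ∧ ‖y‖ ≤ 2 * ‖x‖ := by
      intro y hy
      rw [mem_ball, dist_eq_norm] at hy
      have h1 := norm_sub_norm_le y x
      have h2 := norm_sub_norm_le x y
      rw [norm_sub_rev] at h2
      refine ⟨mem_ball_zero_iff.2 ?_, ?_, ?_⟩ <;> linarith
    have hy0 : ∀ y ∈ ball x (‖x‖ / 2), y ≠ 0 := fun y hy => norm_pos_iff.1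
      (lt_of_lt_of_le (by positivity) (hb y hy).2.1)
    have := norm_fderiv_le_of_abs_lapC_lt (w := u) (x₀ := x) (r := ‖x‖ / 2) (c := u 0) (S := S)
      (K := E * ‖x‖ ^ (2 * α) + 1) (by positivity)
      (fun y hy => hu.smooth y (hball y (hb y hy).1).1 (hy0 y hy))
      (fun y hy => (hball y (hb y hy).1).2.1)
      (fun y hy => by
        obtain ⟨hyΩ, -, h1, h2⟩ := hball y (hb y hy).1
        rw [hu.eq y hyΩ (hy0 y hy), abs_neg, abs_of_nonneg h1]
        refine (h2.trans ?_).trans_lt (lt_add_one _)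
        rw [hE, mul_assoc]
        gcongr
        exact rpow_le_of_mem hn (hb y hy).2.1 (hb y hy).2.2)
    calc ‖x‖ * ‖fderiv ℝ u x‖
        ≤ ‖x‖ * (2 * (2 * S / (‖x‖ / 2) + (E * ‖x‖ ^ (2 * α) + 1) * (‖x‖ / 2))) := by gcongr
      _ = 8 * S + (E * (‖x‖ ^ 2 * ‖x‖ ^ (2 * α)) + ‖x‖ ^ 2) := by field_simp; ring
      _ = _ := by rw [Real.rpow_add hn]; norm_num
  have hz : Tendsto (fun x : ℂ => E * ‖x‖ ^ (2 + 2 * α) + ‖x‖ ^ 2) (𝓝[≠] 0) (𝓝 0) := by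
    have : ContinuousAt (fun x : ℂ => E * ‖x‖ ^ (2 + 2 * α) + ‖x‖ ^ 2) 0 :=
      (continuousAt_const.mul (continuousAt_id.norm.rpow_const (Or.inr (by linarith)))).add
        (continuousAt_id.norm.pow 2)
    have h3 := this.tendsto
    simp only [norm_zero, Real.zero_rpow (show 2 + 2 * α ≠ 0 by linarith), mul_zero] at h3
    norm_num at h3
    exact h3.mono_left nhdsWithin_le_nhds
  rw [Metric.tendsto_nhds]
  intro ε hε
  filter_upwards [main (ε / 16) (by positivity), hz.eventually_lt_const (half_pos hε)] with x h1 h2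
  rw [Real.dist_eq, sub_zero, abs_of_nonneg (by positivity)]
  linarith

end Solution

section Stress

open Filter Topology

/-- A component of the stress-energy flux associated with a gradient `(p, q)`, a field `(a, b)` and
a source `f`; the other component is obtained by swapping the coordinates. -/
def stress (A D : ℝ) (p q a b f : ℂ → ℝ) (x : ℂ) : ℝ :=
  p x + A * ((a x * p x + b x * q x) * p x - (p x * p x + q x * q x) / 2 * a x + f x * a x) + D * a x

variable {p q a b f : ℂ → ℝ} {x : ℂ}

theorem fderiv_stress (A D : ℝ) (hp : DifferentiableAt ℝ p x) (hq : DifferentiableAt ℝ q x)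
    (ha : DifferentiableAt ℝ a x) (hb : DifferentiableAt ℝ b x) (hf : DifferentiableAt ℝ f x)
    (v : ℂ) : fderiv ℝ (stress A D p q a b f) x v = fderiv ℝ p x v +
      A * ((fderiv ℝ a x v * p x + a x * fderiv ℝ p x v + fderiv ℝ b x v * q x +
          b x * fderiv ℝ q x v) * p x + (a x * p x + b x * q x) * fderiv ℝ p x v -
        (p x * fderiv ℝ p x v + q x * fderiv ℝ q x v) * a x -
        (p x * p x + q x * q x) / 2 * fderiv ℝ a x v + fderiv ℝ f x v * a x +
        f x * fderiv ℝ a x v) + D * fderiv ℝ a x v := by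
  have hp' := hp.hasFDerivAt
  have hq' := hq.hasFDerivAt
  have ha' := ha.hasFDerivAt
  have hb' := hb.hasFDerivAt
  have hf' := hf.hasFDerivAt
  have h := (hp'.add ((((((ha'.mul hp').add (hb'.mul hq')).mul hp').sub
    ((((hp'.mul hp').add (hq'.mul hq')).mul_const (2⁻¹ : ℝ)).mul ha')).add
      (hf'.mul ha')).const_mul A)).add (ha'.const_mul D)
  have e : HasFDerivAt (stress A D p q a b f) _ x := h
  rw [e.fderiv]
  simp
  ring

theorem div_stress (A D : ℝ) (hp : DifferentiableAt ℝ p x) (hq : DifferentiableAt ℝ q x)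
    (ha : DifferentiableAt ℝ a x) (hb : DifferentiableAt ℝ b x) (hf : DifferentiableAt ℝ f x)
    {l₁ l₂ : ℝ} (hpq : fderiv ℝ p x Complex.I = fderiv ℝ q x 1)
    (hlap : fderiv ℝ p x 1 + fderiv ℝ q x Complex.I = -f x)
    (hab : fderiv ℝ a x 1 = fderiv ℝ b x Complex.I)
    (hab' : fderiv ℝ a x Complex.I = -fderiv ℝ b x 1)
    (hf1 : fderiv ℝ f x 1 = f x * (l₁ + p x)) (hf2 : fderiv ℝ f x Complex.I = f x * (l₂ + q x)) :
    fderiv ℝ (stress A D p q a b f) x 1 + fderiv ℝ (stress A D q p b a f) x Complex.I =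
      -f x + A * f x * (a x * l₁ + b x * l₂ + 2 * fderiv ℝ a x 1) + D * (2 * fderiv ℝ a x 1) := by
  rw [fderiv_stress A D hp hq ha hb hf, fderiv_stress A D hq hp hb ha hf, hf1, hf2, hpq, hab', hab]
  have h1 : fderiv ℝ p x 1 = -f x - fderiv ℝ q x Complex.I := by linarith
  rw [h1]
  ring

theorem contDiffAt_stress (A D : ℝ) (hp : ContDiffAt ℝ 1 p x) (hq : ContDiffAt ℝ 1 q x)
    (ha : ContDiffAt ℝ 1 a x) (hb : ContDiffAt ℝ 1 b x) (hf : ContDiffAt ℝ 1 f x) :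
    ContDiffAt ℝ 1 (stress A D p q a b f) x := by
  unfold stress
  fun_prop

/-- The flux points outward where `(a, b)` is transversal to the gradient `(p, q)`. -/
theorem stress_nonpos {A D c : ℝ} (hA : 0 ≤ A) (hD : 0 ≤ D) (hc : 0 ≤ c) (hAD : 1 ≤ 2 * A * D * c ^ 2)
    (hf : 0 ≤ f x) (h : c * √(p x * p x + q x * q x) ≤ -(a x * p x + b x * q x)) :
    p x * stress A D p q a b f x + q x * stress A D q p b a f x ≤ 0 := by
  have e : p x * stress A D p q a b f x + q x * stress A D q p b a f x =
      (p x * p x + q x * q x) - A / 2 * (p x * p x + q x * q x) * (-(a x * p x + b x * q x)) -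
        A * f x * (-(a x * p x + b x * q x)) - D * (-(a x * p x + b x * q x)) := by
    unfold stress; ring
  rw [e]
  have hg0 : 0 ≤ p x * p x + q x * q x := add_nonneg (mul_self_nonneg _) (mul_self_nonneg _)
  rw [← Real.mul_self_sqrt hg0]
  set g := √(p x * p x + q x * q x)
  have hg : 0 ≤ g := Real.sqrt_nonneg _
  set t := -(a x * p x + b x * q x)
  have ht : 0 ≤ t := (mul_nonneg hc hg).trans h
  have h1 : A / 2 * (g * g) * (c * g) ≤ A / 2 * (g * g) * t := by gcongr
  have h2 : 0 ≤ A * f x * t := by positivity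
  have h3 : D * (c * g) ≤ D * t := by gcongr
  have hAc : 0 < A * c := by
    rcases (mul_nonneg hA hc).eq_or_lt with h0 | h0
    · have : 2 * A * D * c ^ 2 = 2 * (A * c) * (D * c) := by ring
      rw [this, ← h0] at hAD; norm_num at hAD
    · exact h0
  have h4 : g - A * c / 2 * (g * g) - D * c ≤ 0 := by
    have : 0 ≤ 2 * (A * c) * (A * c / 2 * (g * g) + D * c - g) := by
      nlinarith [sq_nonneg (A * c * g - 1)]
    have := nonneg_of_mul_nonneg_right this (by positivity)
    linarith
  have h5 : g * (g - A * c / 2 * (g * g) - D * c) ≤ 0 := mul_nonpos_of_nonneg_of_nonpos hg h4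
  nlinarith

theorem tendsto_norm_mul_stress (A D : ℝ) {C : ℝ} (hp : Tendsto (fun x => ‖x‖ * p x) (𝓝[≠] 0) (𝓝 0))
    (hq : Tendsto (fun x => ‖x‖ * q x) (𝓝[≠] 0) (𝓝 0))
    (hf : Tendsto (fun x => ‖x‖ ^ 2 * f x) (𝓝[≠] 0) (𝓝 0))
    (ha : ∀ᶠ x in 𝓝[≠] 0, |a x| ≤ C * ‖x‖) (hb : ∀ᶠ x in 𝓝[≠] 0, |b x| ≤ C * ‖x‖) :
    Tendsto (fun x => ‖x‖ * stress A D p q a b f x) (𝓝[≠] 0) (𝓝 0) := by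
  have hbdd : ∀ a : ℂ → ℝ, (∀ᶠ x in 𝓝[≠] 0, |a x| ≤ C * ‖x‖) →
      IsBoundedUnder (· ≤ ·) (𝓝[≠] 0) (norm ∘ fun x : ℂ => a x / ‖x‖) := by
    intro a ha
    refine ⟨C, eventually_map.2 ?_⟩
    filter_upwards [ha, self_mem_nhdsWithin] with x hx hx0
    have hn : 0 < ‖x‖ := norm_pos_iff.2 hx0
    simp only [Function.comp, norm_div, Real.norm_eq_abs]
    rwa [abs_norm, div_le_iff₀ hn]
  have hn : Tendsto (fun x : ℂ => ‖x‖ ^ 2) (𝓝[≠] 0) (𝓝 0) := by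
    have : ContinuousAt (fun x : ℂ => ‖x‖ ^ 2) 0 := continuousAt_id.norm.pow 2
    have h := this.tendsto
    norm_num at h
    exact h.mono_left nhdsWithin_le_nhds
  have hpp := hp.mul hp
  have hqq := hq.mul hq
  have hqp := hq.mul hp
  simp only [mul_zero] at hpp hqq hqp
  have h1 : Tendsto (fun x : ℂ => ‖x‖ * p x + (A * ((‖x‖ * p x * (‖x‖ * p x)) * (a x / ‖x‖) +
      (‖x‖ * q x * (‖x‖ * p x)) * (b x / ‖x‖) -
      (‖x‖ * p x * (‖x‖ * p x) + ‖x‖ * q x * (‖x‖ * q x)) * (a x / ‖x‖) / 2 +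
      (‖x‖ ^ 2 * f x) * (a x / ‖x‖)) + D * (‖x‖ ^ 2 * (a x / ‖x‖)))) (𝓝[≠] 0) (𝓝 0) := by
    have hs := hpp.add hqq
    simp only [add_zero] at hs
    have := hp.add (((((((hpp.zero_mul_isBoundedUnder_le (hbdd a ha))).add
      (hqp.zero_mul_isBoundedUnder_le (hbdd b hb))).sub
        ((hs.zero_mul_isBoundedUnder_le (hbdd a ha)).div_const 2)).add
        (hf.zero_mul_isBoundedUnder_le (hbdd a ha))).const_mul A).add
        ((hn.zero_mul_isBoundedUnder_le (hbdd a ha)).const_mul D))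
    simpa using this
  refine h1.congr' ?_
  filter_upwards [self_mem_nhdsWithin] with x hx0
  have hn : 0 < ‖x‖ := norm_pos_iff.2 hx0
  unfold stress
  field_simp
  ring

end Stress

section Cutoff

open Filter Topology

theorem integral_fderiv_eq_zero {g : ℂ → ℝ} (hg : ContDiff ℝ 1 g) (hs : HasCompactSupport g)
    (v : ℂ) : Integrable (fun x => fderiv ℝ g x v) ∧ ∫ x, fderiv ℝ g x v = 0 := by
  have hi : Integrable (fun x => fderiv ℝ g x v) :=
    ((hg.continuous_fderiv one_ne_zero).clm_apply continuous_const).integrable_of_hasCompactSupport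
      (hs.fderiv_apply (𝕜 := ℝ) v)
  refine ⟨hi, ?_⟩
  have h := integral_mul_fderiv_eq_neg_fderiv_mul_of_integrable (μ := volume) (f := fun _ : ℂ => (1 : ℝ))
    (g := g) (v := v) (by simp) (by simpa using hi)
    (by simpa using hg.continuous.integrable_of_hasCompactSupport hs)
    (fun x _ => differentiableAt_const _) (fun x _ => (hg.differentiable one_ne_zero) x)
  simpa using h

variable {Ω : Set ℂ} {u N : ℂ → ℝ} {χ : ℝ → ℝ} {ζ : ℂ → ℝ}

/-- A cut-off `χ (u x) * ζ x` vanishing near the boundary of `Ω` and near the origin. -/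
structure IsCutoff (Ω : Set ℂ) (u : ℂ → ℝ) (χ : ℝ → ℝ) (ζ : ℂ → ℝ) : Prop where
  isOpen : IsOpen Ω
  bounded : Bornology.IsBounded Ω
  cont : ContinuousOn u (closure Ω)
  smooth : ∀ x ∈ Ω, x ≠ 0 → ContDiffAt ℝ 1 u x
  zero : ∀ x ∈ frontier Ω, u x = 0
  contDiff_left : ContDiff ℝ 1 χ
  contDiff_right : ContDiff ℝ 1 ζ
  eventually_left : ∃ ε > 0, ∀ s ≤ ε, χ s = 0
  eventually_right : ∀ᶠ x in 𝓝 0, ζ x = 0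

namespace IsCutoff

theorem eventuallyEq_mul (h : IsCutoff Ω u χ ζ) {x : ℂ} (hx : x ∈ Ω) :
    indicator Ω (fun x => χ (u x) * ζ x * N x) =ᶠ[𝓝 x] fun x => χ (u x) * ζ x * N x := by
  filter_upwards [h.isOpen.mem_nhds hx] with y hy using indicator_of_mem hy _

theorem eventuallyEq_zero (h : IsCutoff Ω u χ ζ) {x : ℂ} (hx : ¬ (x ∈ Ω ∧ x ≠ 0)) :
    indicator Ω (fun x => χ (u x) * ζ x * N x) =ᶠ[𝓝 x] fun _ => 0 := by
  by_cases hx0 : x = 0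
  · subst hx0
    filter_upwards [h.eventually_right] with y hy
    simp [indicator, hy]
  · have hxΩ : x ∉ Ω := fun hm => hx ⟨hm, hx0⟩
    by_cases hc : x ∈ closure Ω
    · have hf : x ∈ frontier Ω := by rw [h.isOpen.frontier_eq]; exact ⟨hc, hxΩ⟩
      obtain ⟨ε, hε, hχ⟩ := h.eventually_left
      have h1 : ∀ᶠ y in 𝓝[closure Ω] x, u y < ε :=
        (h.cont x hc).eventually_lt_const (by rwa [h.zero x hf])
      filter_upwards [eventually_nhdsWithin_iff.1 h1] with y hy
      by_cases hyΩ : y ∈ Ω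
      · rw [indicator_of_mem hyΩ, hχ _ (hy (subset_closure hyΩ)).le]; simp
      · exact indicator_of_notMem hyΩ _
    · filter_upwards [isClosed_closure.isOpen_compl.mem_nhds hc] with y hy
      exact indicator_of_notMem (fun hm => hy (subset_closure hm)) _

theorem contDiff (h : IsCutoff Ω u χ ζ) (hN : ∀ x ∈ Ω, x ≠ 0 → ContDiffAt ℝ 1 N x) :
    ContDiff ℝ 1 (indicator Ω fun x => χ (u x) * ζ x * N x) := by
  refine contDiff_iff_contDiffAt.2 fun x => ?_
  by_cases hx : x ∈ Ω ∧ x ≠ 0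
  · refine ContDiffAt.congr_of_eventuallyEq ?_ (h.eventuallyEq_mul hx.1)
    exact ((h.contDiff_left.contDiffAt.comp x (h.smooth x hx.1 hx.2)).mul
      h.contDiff_right.contDiffAt).mul (hN x hx.1 hx.2)
  · exact contDiffAt_const.congr_of_eventuallyEq (h.eventuallyEq_zero hx)

theorem hasCompactSupport (h : IsCutoff Ω u χ ζ) :
    HasCompactSupport (indicator Ω fun x => χ (u x) * ζ x * N x) :=
  HasCompactSupport.intro h.bounded.isCompact_closure fun _ hx =>
    indicator_of_notMem (fun hm => hx (subset_closure hm)) _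

theorem fderiv_eq_zero (h : IsCutoff Ω u χ ζ) {x : ℂ} (hx : ¬ (x ∈ Ω ∧ x ≠ 0)) (v : ℂ) :
    fderiv ℝ (indicator Ω fun x => χ (u x) * ζ x * N x) x v = 0 := by
  rw [(h.eventuallyEq_zero hx).fderiv_eq]; simp

theorem fderiv_eq (h : IsCutoff Ω u χ ζ) {x : ℂ} (hx : x ∈ Ω) (hx0 : x ≠ 0)
    (hN : DifferentiableAt ℝ N x) (v : ℂ) :
    fderiv ℝ (indicator Ω fun x => χ (u x) * ζ x * N x) x v =
      deriv χ (u x) * ζ x * (fderiv ℝ u x v * N x) + χ (u x) * (fderiv ℝ ζ x v * N x) +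
        χ (u x) * ζ x * fderiv ℝ N x v := by
  rw [(h.eventuallyEq_mul hx).fderiv_eq]
  have h1 := ((h.contDiff_left.differentiable one_ne_zero) (u x)).hasDerivAt.comp_hasFDerivAt x
    ((h.smooth x hx hx0).differentiableAt one_ne_zero).hasFDerivAt
  have h2 := ((h.contDiff_right.differentiable one_ne_zero) x).hasFDerivAt
  have h3 := (h1.mul h2).mul hN.hasFDerivAt
  have e : HasFDerivAt (fun x => χ (u x) * ζ x * N x) _ x := h3
  rw [e.fderiv]
  simp
  ring

end IsCutoff

end Cutoff

section Profile

open Filter Topology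

theorem exists_deriv_smoothTransition_le :
    ∃ T > 0, ∀ s, |deriv Real.smoothTransition s| ≤ T := by
  have hc : Continuous (deriv Real.smoothTransition) :=
    (Real.smoothTransition.contDiff (n := 1)).continuous_deriv le_rfl
  obtain ⟨T, hT⟩ := isCompact_Icc.exists_bound_of_continuousOn
    (s := Icc (0 : ℝ) 1) hc.continuousOn
  refine ⟨max T 1, by positivity, fun s => ?_⟩
  by_cases hs : s ∈ Icc (0 : ℝ) 1
  · exact (hT s hs).trans (le_max_left _ _)
  · have h0 : deriv Real.smoothTransition s = 0 := by
      rcases not_and_or.1 hs with h | h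
      · have : Real.smoothTransition =ᶠ[𝓝 s] fun _ => 0 := by
          filter_upwards [eventually_lt_nhds (not_le.1 h)] with y hy
          exact Real.smoothTransition.zero_of_nonpos hy.le
        rw [this.deriv_eq]; simp
      · have : Real.smoothTransition =ᶠ[𝓝 s] fun _ => 1 := by
          filter_upwards [eventually_gt_nhds (not_le.1 h)] with y hy
          exact Real.smoothTransition.one_of_one_le hy.le
        rw [this.deriv_eq]; simp
    rw [h0, abs_zero]; positivity

/-- The boundary profile, rising from `0` to `1` between `ε` and `2 * ε`. -/
def bdryProfile (ε s : ℝ) : ℝ := Real.smoothTransition ((s - ε) / ε)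

/-- The profile at the origin, rising from `0` to `1` between the radii `δ` and `√2 * δ`. -/
def originProfile (δ : ℝ) (x : ℂ) : ℝ := Real.smoothTransition (‖x‖ ^ 2 / δ ^ 2 - 1)

theorem deriv_bdryProfile_nonneg {ε : ℝ} (hε : 0 < ε) (s : ℝ) : 0 ≤ deriv (bdryProfile ε) s := by
  have h : Monotone (bdryProfile ε) := fun a b hab =>
    Real.smoothTransition.monotone (by gcongr)
  exact h.deriv_nonneg

theorem deriv_bdryProfile_eq_zero {ε s : ℝ} (hε : 0 < ε) (hs : 2 * ε < s) :
    deriv (bdryProfile ε) s = 0 := by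
  have : bdryProfile ε =ᶠ[𝓝 s] fun _ => 1 := by
    filter_upwards [eventually_gt_nhds hs] with y hy
    exact Real.smoothTransition.one_of_one_le (by rw [le_div_iff₀ hε]; linarith)
  rw [this.deriv_eq]; simp

theorem fderiv_originProfile (δ : ℝ) (x v : ℂ) : fderiv ℝ (originProfile δ) x v =
    deriv Real.smoothTransition (‖x‖ ^ 2 / δ ^ 2 - 1) * (2 * innerSL ℝ x v / δ ^ 2) := by
  have h1 : HasFDerivAt (fun x : ℂ => ‖x‖ ^ 2 * (δ ^ 2)⁻¹ - 1) ((δ ^ 2)⁻¹ • (2 • innerSL ℝ x)) x :=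
    ((hasStrictFDerivAt_norm_sq x).hasFDerivAt.mul_const _).sub_const _
  have h2 := ((Real.smoothTransition.contDiff (n := 1)).differentiable one_ne_zero
    (‖x‖ ^ 2 * (δ ^ 2)⁻¹ - 1)).hasDerivAt.comp_hasFDerivAt x h1
  have h3 : HasFDerivAt (originProfile δ) _ x := h2
  rw [h3.fderiv]
  simp only [smul_apply, smul_eq_mul, nsmul_eq_mul, Nat.cast_ofNat,
    div_eq_mul_inv]
  ring

theorem contDiff_originProfile (δ : ℝ) : ContDiff ℝ 1 (originProfile δ) :=
  Real.smoothTransition.contDiff.comp (((contDiff_norm_sq ℝ).div_const _).sub contDiff_const)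

theorem contDiff_bdryProfile (ε : ℝ) : ContDiff ℝ 1 (bdryProfile ε) :=
  Real.smoothTransition.contDiff.comp ((contDiff_id.sub contDiff_const).div_const _)

theorem abs_fderiv_originProfile_mul_le {T δ : ℝ} (hT0 : 0 < T)
    (hT : ∀ s, |deriv Real.smoothTransition s| ≤ T) (hδ : 0 < δ) {x v : ℂ} {t : ℝ}
    (hv : ‖v‖ = 1) (h : ‖x‖ < 2 * δ → ‖x‖ * |t| ≤ 1) :
    |fderiv ℝ (originProfile δ) x v * t| ≤
      indicator (ball 0 (2 * δ)) (fun _ => 2 * T / δ ^ 2) x := by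
  rw [fderiv_originProfile]
  by_cases hx : ‖x‖ < 2 * δ
  · rw [indicator_of_mem (mem_ball_zero_iff.2 hx)]
    have h1 : |innerSL ℝ x v| ≤ ‖x‖ := by
      have := abs_real_inner_le_norm x v
      rwa [hv, mul_one] at this
    rw [abs_mul, abs_mul, abs_div, abs_mul, abs_two, abs_of_pos (by positivity : 0 < δ ^ 2)]
    calc _ ≤ T * (2 * ‖x‖ / δ ^ 2) * |t| := by gcongr; exact hT _
      _ = 2 * T / δ ^ 2 * (‖x‖ * |t|) := by ring
      _ ≤ 2 * T / δ ^ 2 * 1 := by gcongr; exact h hx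
      _ = _ := mul_one _
  · rw [indicator_of_notMem (by rwa [mem_ball_zero_iff])]
    have h1 : 1 < ‖x‖ ^ 2 / δ ^ 2 - 1 := by
      have : 4 ≤ ‖x‖ ^ 2 / δ ^ 2 := by
        rw [le_div_iff₀ (by positivity)]
        nlinarith [not_lt.1 hx]
      linarith
    have : Real.smoothTransition =ᶠ[𝓝 (‖x‖ ^ 2 / δ ^ 2 - 1)] fun _ => 1 := by
      filter_upwards [eventually_gt_nhds h1] with y hy
      exact Real.smoothTransition.one_of_one_le hy.le
    rw [this.deriv_eq]; simp

theorem isCutoff_profile {Ω : Set ℂ} {u : ℂ → ℝ} (hU : IsOpen Ω) (hb : Bornology.IsBounded Ω)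
    (hc : ContinuousOn u (closure Ω)) (hs : ∀ x ∈ Ω, x ≠ 0 → ContDiffAt ℝ 1 u x)
    (hz : ∀ x ∈ frontier Ω, u x = 0) {ε δ : ℝ} (hε : 0 < ε) (hδ : 0 < δ) :
    IsCutoff Ω u (bdryProfile ε) (originProfile δ) where
  isOpen := hU
  bounded := hb
  cont := hc
  smooth := hs
  zero := hz
  contDiff_left := contDiff_bdryProfile ε
  contDiff_right := contDiff_originProfile δ
  eventually_left := ⟨ε, hε, fun s h => Real.smoothTransition.zero_of_nonpos
    (div_nonpos_of_nonpos_of_nonneg (by linarith) hε.le)⟩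
  eventually_right := by
    filter_upwards [ball_mem_nhds (0 : ℂ) hδ] with x hx
    refine Real.smoothTransition.zero_of_nonpos ?_
    rw [sub_nonpos, div_le_one (by positivity)]
    have := mem_ball_zero_iff.1 hx
    gcongr

end Profile

section Mass

open Filter Topology

variable {Ω : Set ℂ} {u f N₁ N₂ : ℂ → ℝ} {B ε₀ : ℝ}

/-- A field whose divergence is controlled by `-f / 2 + B`, pointing outward near `∂Ω`. -/
structure IsFlux (Ω : Set ℂ) (u f N₁ N₂ : ℂ → ℝ) (B ε₀ : ℝ) : Prop where
  isOpen : IsOpen Ω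
  bounded : Bornology.IsBounded Ω
  cont : ContinuousOn u (closure Ω)
  smooth : ∀ x ∈ Ω, x ≠ 0 → ContDiffAt ℝ 1 u x
  zero : ∀ x ∈ frontier Ω, u x = 0
  pos : ∀ x ∈ Ω, 0 < u x
  smooth_source : ∀ x ∈ Ω, x ≠ 0 → ContDiffAt ℝ 1 f x
  source_nonneg : ∀ x ∈ Ω, x ≠ 0 → 0 ≤ f x
  smooth₁ : ∀ x ∈ Ω, x ≠ 0 → ContDiffAt ℝ 1 N₁ x
  smooth₂ : ∀ x ∈ Ω, x ≠ 0 → ContDiffAt ℝ 1 N₂ x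
  bound_nonneg : 0 ≤ B
  div_le : ∀ x ∈ Ω, x ≠ 0 → fderiv ℝ N₁ x 1 + fderiv ℝ N₂ x Complex.I ≤ -(1 / 2) * f x + B
  collar_pos : 0 < ε₀
  outward : ∀ x ∈ Ω, x ≠ 0 → u x ≤ ε₀ → fderiv ℝ u x 1 * N₁ x + fderiv ℝ u x Complex.I * N₂ x ≤ 0
  small : ∀ᶠ x in 𝓝 0, x ≠ 0 → ‖x‖ * |N₁ x| ≤ 1 ∧ ‖x‖ * |N₂ x| ≤ 1

namespace IsFlux

/-- The divergence inequality multiplied by a cut-off. -/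
theorem div_cutoff_le (h : IsFlux Ω u f N₁ N₂ B ε₀) {T ε δ : ℝ} (hT0 : 0 < T)
    (hT : ∀ s, |deriv Real.smoothTransition s| ≤ T) (hε : 0 < ε) (hε₀ : 2 * ε ≤ ε₀) (hδ : 0 < δ)
    (hN : ∀ x : ℂ, ‖x‖ < 2 * δ → x ≠ 0 → ‖x‖ * |N₁ x| ≤ 1 ∧ ‖x‖ * |N₂ x| ≤ 1) (x : ℂ) :
    fderiv ℝ (indicator Ω fun x => bdryProfile ε (u x) * originProfile δ x * N₁ x) x 1 +
      fderiv ℝ (indicator Ω fun x => bdryProfile ε (u x) * originProfile δ x * N₂ x) x Complex.I ≤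
    -(1 / 2) * indicator Ω (fun x => bdryProfile ε (u x) * originProfile δ x * f x) x +
      indicator Ω (fun _ => B) x + indicator (ball 0 (2 * δ)) (fun _ => 4 * T / δ ^ 2) x := by
  have hc := isCutoff_profile h.isOpen h.bounded h.cont h.smooth h.zero hε hδ
  have hind : 0 ≤ indicator (ball (0 : ℂ) (2 * δ)) (fun _ => 4 * T / δ ^ 2) x :=
    indicator_nonneg (fun _ _ => by positivity) x
  have hB : 0 ≤ indicator Ω (fun _ => B) x := indicator_nonneg (fun _ _ => h.bound_nonneg) x
  by_cases hx : x ∈ Ω ∧ x ≠ 0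
  · obtain ⟨hxΩ, hx0⟩ := hx
    rw [hc.fderiv_eq hxΩ hx0 ((h.smooth₁ x hxΩ hx0).differentiableAt one_ne_zero),
      hc.fderiv_eq hxΩ hx0 ((h.smooth₂ x hxΩ hx0).differentiableAt one_ne_zero),
      indicator_of_mem hxΩ, indicator_of_mem hxΩ]
    have hχ0 : 0 ≤ bdryProfile ε (u x) := Real.smoothTransition.nonneg _
    have hχ1 : bdryProfile ε (u x) ≤ 1 := Real.smoothTransition.le_one _
    have hζ0 : 0 ≤ originProfile δ x := Real.smoothTransition.nonneg _
    have hζ1 : originProfile δ x ≤ 1 := Real.smoothTransition.le_one _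
    have hd := deriv_bdryProfile_nonneg hε (u x)
    have h1 : deriv (bdryProfile ε) (u x) * originProfile δ x *
        (fderiv ℝ u x 1 * N₁ x + fderiv ℝ u x Complex.I * N₂ x) ≤ 0 := by
      rcases le_or_gt (u x) (2 * ε) with hu | hu
      · exact mul_nonpos_of_nonneg_of_nonpos (mul_nonneg hd hζ0)
          (h.outward x hxΩ hx0 (hu.trans hε₀))
      · rw [deriv_bdryProfile_eq_zero hε hu]; simp
    have ha := abs_fderiv_originProfile_mul_le hT0 hT hδ (x := x) (v := 1) (t := N₁ x) (by simp)
      (fun hx => (hN x hx hx0).1)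
    have hb := abs_fderiv_originProfile_mul_le hT0 hT hδ (x := x) (v := Complex.I) (t := N₂ x)
      (by simp) (fun hx => (hN x hx hx0).2)
    have hab : indicator (ball (0 : ℂ) (2 * δ)) (fun _ => 4 * T / δ ^ 2) x =
        indicator (ball (0 : ℂ) (2 * δ)) (fun _ => 2 * T / δ ^ 2) x +
        indicator (ball (0 : ℂ) (2 * δ)) (fun _ => 2 * T / δ ^ 2) x := by
      by_cases hm : x ∈ ball (0 : ℂ) (2 * δ)
      · rw [indicator_of_mem hm, indicator_of_mem hm]; ring
      · rw [indicator_of_notMem hm, indicator_of_notMem hm]; ring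
    have h2 : bdryProfile ε (u x) * (fderiv ℝ (originProfile δ) x 1 * N₁ x +
        fderiv ℝ (originProfile δ) x Complex.I * N₂ x) ≤
        indicator (ball (0 : ℂ) (2 * δ)) (fun _ => 4 * T / δ ^ 2) x := by
      refine (mul_le_mul_of_nonneg_left (b := _) (c := _) ?_ hχ0).trans (mul_le_of_le_one_left hind hχ1)
      rw [hab]
      exact add_le_add ((le_abs_self _).trans ha) ((le_abs_self _).trans hb)
    have h3 : bdryProfile ε (u x) * originProfile δ x *
        (fderiv ℝ N₁ x 1 + fderiv ℝ N₂ x Complex.I) ≤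
        bdryProfile ε (u x) * originProfile δ x * (-(1 / 2) * f x) + B := by
      have h4 := mul_le_mul_of_nonneg_left (h.div_le x hxΩ hx0) (mul_nonneg hχ0 hζ0)
      have h5 : bdryProfile ε (u x) * originProfile δ x * B ≤ B :=
        mul_le_of_le_one_left h.bound_nonneg (mul_le_one₀ hχ1 hζ0 hζ1)
      linarith
    linarith
  · rw [hc.fderiv_eq_zero hx, hc.fderiv_eq_zero hx]
    have : indicator Ω (fun x => bdryProfile ε (u x) * originProfile δ x * f x) x = 0 :=
      (hc.eventuallyEq_zero (N := f) hx).eq_of_nhds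
    rw [this]
    linarith

theorem integral_cutoff_le (h : IsFlux Ω u f N₁ N₂ B ε₀) {T ε δ : ℝ} (hT0 : 0 < T)
    (hT : ∀ s, |deriv Real.smoothTransition s| ≤ T) (hε : 0 < ε) (hε₀ : 2 * ε ≤ ε₀) (hδ : 0 < δ)
    (hN : ∀ x : ℂ, ‖x‖ < 2 * δ → x ≠ 0 → ‖x‖ * |N₁ x| ≤ 1 ∧ ‖x‖ * |N₂ x| ≤ 1) :
    ∫ x in Ω, bdryProfile ε (u x) * originProfile δ x * f x ≤
      2 * B * volume.real Ω + 32 * T * π := by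
  have hc := isCutoff_profile h.isOpen h.bounded h.cont h.smooth h.zero hε hδ
  obtain ⟨i1, e1⟩ := integral_fderiv_eq_zero (hc.contDiff h.smooth₁) hc.hasCompactSupport 1
  obtain ⟨i2, e2⟩ := integral_fderiv_eq_zero (hc.contDiff h.smooth₂) hc.hasCompactSupport Complex.I
  have i3 := (hc.contDiff h.smooth_source).continuous.integrable_of_hasCompactSupport
    hc.hasCompactSupport (μ := volume)
  have i4 : Integrable (indicator Ω fun _ => B) :=
    (integrable_indicator_iff h.isOpen.measurableSet).2
      (integrableOn_const h.bounded.measure_lt_top.ne)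
  have i5 : Integrable (indicator (ball (0 : ℂ) (2 * δ)) fun _ => 4 * T / δ ^ 2) :=
    (integrable_indicator_iff measurableSet_ball).2 (integrableOn_const measure_ball_lt_top.ne)
  have key := integral_mono (i1.add i2) (((i3.const_mul (-(1 / 2))).add i4).add i5)
    (h.div_cutoff_le hT0 hT hε hε₀ hδ hN)
  rw [integral_add' i1 i2, e1, e2, integral_add' ((i3.const_mul _).add i4) i5,
    integral_add' (i3.const_mul _) i4, integral_const_mul,
    integral_indicator h.isOpen.measurableSet, integral_indicator h.isOpen.measurableSet,
    integral_indicator measurableSet_ball, setIntegral_const, setIntegral_const] at key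
  have hv : volume.real (ball (0 : ℂ) (2 * δ)) = 4 * δ ^ 2 * π := by
    rw [Measure.real, Complex.volume_ball]
    simp [ENNReal.toReal_ofReal hδ.le]
    ring
  rw [hv, smul_eq_mul, smul_eq_mul] at key
  have : 4 * δ ^ 2 * π * (4 * T / δ ^ 2) = 16 * T * π := by field_simp; ring
  linarith

/-- The total mass of the source is controlled by the divergence bound. -/
theorem integral_le (h : IsFlux Ω u f N₁ N₂ B ε₀) {T : ℝ} (hT0 : 0 < T)
    (hT : ∀ s, |deriv Real.smoothTransition s| ≤ T) :
    ∫ x in Ω, f x ≤ 2 * B * volume.real Ω + 32 * T * π := by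
  have hR : 0 ≤ 2 * B * volume.real Ω + 32 * T * π := by
    have := h.bound_nonneg
    positivity
  by_cases hf : IntegrableOn f Ω
  swap
  · rwa [integral_undef hf]
  obtain ⟨r, hr, hsmall⟩ := Metric.eventually_nhds_iff.1 h.small
  have h0 : Tendsto (fun n : ℕ => 1 / ((n : ℝ) + 1)) atTop (𝓝 0) := tendsto_one_div_add_atTop_nhds_zero_nat
  have hp : ∀ n : ℕ, 0 < 1 / ((n : ℝ) + 1) := fun n => by positivity
  have h2 : Tendsto (fun n : ℕ => 2 * (1 / ((n : ℝ) + 1))) atTop (𝓝 0) := by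
    simpa using h0.const_mul 2
  have hae : ∀ᵐ x ∂(volume.restrict Ω), x ∈ Ω ∧ x ≠ 0 := by
    refine (ae_restrict_mem h.isOpen.measurableSet).and (ae_restrict_of_ae ?_)
    exact Measure.ae_ne volume 0
  have hlim : Tendsto (fun n : ℕ => ∫ x in Ω, bdryProfile (1 / ((n : ℝ) + 1)) (u x) *
      originProfile (1 / ((n : ℝ) + 1)) x * f x) atTop (𝓝 (∫ x in Ω, f x)) := by
    refine tendsto_integral_of_dominated_convergence f (fun n => ?_) hf (fun n => ?_) ?_
    · have hc := isCutoff_profile h.isOpen h.bounded h.cont h.smooth h.zero (hp n) (hp n)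
      exact (aestronglyMeasurable_indicator_iff h.isOpen.measurableSet).1
        (hc.contDiff h.smooth_source).continuous.aestronglyMeasurable
    · filter_upwards [hae] with x hx
      have hfx := h.source_nonneg x hx.1 hx.2
      have hχ0 : 0 ≤ bdryProfile (1 / ((n : ℝ) + 1)) (u x) := Real.smoothTransition.nonneg _
      have hχ1 : bdryProfile (1 / ((n : ℝ) + 1)) (u x) ≤ 1 := Real.smoothTransition.le_one _
      have hζ0 : 0 ≤ originProfile (1 / ((n : ℝ) + 1)) x := Real.smoothTransition.nonneg _
      have hζ1 : originProfile (1 / ((n : ℝ) + 1)) x ≤ 1 := Real.smoothTransition.le_one _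
      rw [Real.norm_of_nonneg (mul_nonneg (mul_nonneg hχ0 hζ0) hfx)]
      exact mul_le_of_le_one_left hfx (mul_le_one₀ hχ1 hζ0 hζ1)
    · filter_upwards [hae] with x hx
      refine tendsto_const_nhds.congr' ?_
      have hxn : 0 < ‖x‖ := norm_pos_iff.2 hx.2
      filter_upwards [h2.eventually_lt_const (h.pos x hx.1), h2.eventually_lt_const hxn] with n hn hn'
      have e1 : bdryProfile (1 / ((n : ℝ) + 1)) (u x) = 1 :=
        Real.smoothTransition.one_of_one_le (by rw [le_div_iff₀ (hp n)]; linarith)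
      have e2 : originProfile (1 / ((n : ℝ) + 1)) x = 1 := by
        refine Real.smoothTransition.one_of_one_le ?_
        have := hp n
        have : 2 ≤ ‖x‖ ^ 2 / (1 / ((n : ℝ) + 1)) ^ 2 := by
          rw [le_div_iff₀ (by positivity)]
          nlinarith
        linarith
      rw [e1, e2]; ring
  refine le_of_tendsto hlim ?_
  filter_upwards [h2.eventually_le_const h.collar_pos, h2.eventually_le_const hr] with n hn hn'
  refine h.integral_cutoff_le hT0 hT (hp n) hn (hp n) fun x hx hx0 => hsmall ?_ hx0
  rw [dist_zero_right]
  exact hx.trans_le hn'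

end IsFlux

end Mass

section MassBound

open Filter Topology

variable {Ω : Set ℂ} {K u : ℂ → ℝ} {α k₀ k₁ lam C c₀ : ℝ} {X : ℂ → ℂ}

theorem fderiv_fderiv_comm (hu : ContDiffAt ℝ 2 u x) (v w : ℂ) :
    fderiv ℝ (fun y => fderiv ℝ u y v) x w = fderiv ℝ (fun y => fderiv ℝ u y w) x v := by
  have hd : DifferentiableAt ℝ (fderiv ℝ u) x :=
    (hu.fderiv_right (m := 1) (by norm_num)).differentiableAt one_ne_zero
  have hs : IsSymmSndFDerivAt ℝ u x := hu.isSymmSndFDerivAt (by simp)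
  have e : ∀ a b : ℂ, fderiv ℝ (fun y => fderiv ℝ u y a) x b = fderiv ℝ (fderiv ℝ u) x b a := by
    intro a b
    rw [fderiv_clm_apply hd (differentiableAt_const a)]
    simp
  rw [e, e, hs.eq]

theorem contDiffAt_components (hX : AnalyticAt ℂ X x) :
    ContDiffAt ℝ 1 (fun y => (X y).re) x ∧ ContDiffAt ℝ 1 (fun y => (X y).im) x ∧
      (∀ v, fderiv ℝ (fun y => (X y).re) x v = (deriv X x * v).re) ∧
      ∀ v, fderiv ℝ (fun y => (X y).im) x v = (deriv X x * v).im := by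
  have e : (fun y => (X y).im) = fun y => (-Complex.I * X y).re := by ext y; simp
  have hX' : AnalyticAt ℂ (fun y => -Complex.I * X y) x := analyticAt_const.mul hX
  refine ⟨(contDiffAt_re_comp hX).of_le (by norm_num), ?_,
    (hasFDerivAt_re_comp hX.differentiableAt).2, fun v => ?_⟩
  · rw [e]; exact (contDiffAt_re_comp hX').of_le (by norm_num)
  · rw [e, (hasFDerivAt_re_comp hX'.differentiableAt).2, deriv_const_mul _ hX.differentiableAt]
    simp

theorem eventually_norm_mul_abs_le_one {F : ℂ → ℝ}
    (h : Tendsto (fun x => ‖x‖ * F x) (𝓝[≠] 0) (𝓝 0)) :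
    ∀ᶠ x in 𝓝 0, x ≠ 0 → ‖x‖ * |F x| ≤ 1 := by
  have e := h.abs.eventually_le_const (u := 1) (by simp)
  filter_upwards [eventually_nhdsWithin_iff.1 e] with x h1 hx0
  simpa [abs_mul] using h1 hx0

theorem IsSolution.exists_isFlux (hα : -1 < α) (hu : IsSolution Ω α K lam u)
    (hK : IsWeight Ω K k₀ k₁) (hU : IsOpen Ω) (hb : Bornology.IsBounded Ω) (h0 : 0 ∈ Ω)
    (hX : TransversalField Ω X C c₀) {A D M : ℝ} (hM : M = 2 * |α| * C + k₁ / k₀ * C + 2 * C)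
    (hA : A = 1 / (2 * M)) (hD : D = 1 / (2 * A * (7 / 25 * c₀) ^ 2)) :
    ∃ N₁ N₂ ε, IsFlux Ω u (source α K lam u) N₁ N₂ (D * (2 * C)) ε := by
  have hC := hX.C_pos
  have hc₀ := hX.c₀_pos
  have hk₀ := hK.pos
  have hk₁ : 0 ≤ k₁ := hk₀.le.trans ((hK.ge 0 h0).trans (hK.le 0 h0))
  have hM0 : 0 < M := by rw [hM]; positivity
  have hA0 : 0 < A := by rw [hA]; positivity
  have hD0 : 0 < D := by rw [hD]; positivity
  have hAD : 1 ≤ 2 * A * D * (7 / 25 * c₀) ^ 2 := by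
    rw [hD]; refine le_of_eq ?_; field_simp
  obtain ⟨ε, hε, hcollar⟩ := hu.exists_collar hK hU hb h0 hX
  set f := source α K lam u with hf
  set p : ℂ → ℝ := fun x => fderiv ℝ u x 1 with hp
  set q : ℂ → ℝ := fun x => fderiv ℝ u x Complex.I with hq
  set a : ℂ → ℝ := fun x => (X x).re with ha
  set b : ℂ → ℝ := fun x => (X x).im with hbdef
  have hXan : ∀ x ∈ Ω, AnalyticAt ℂ X x := fun x hx => hX.diff.analyticAt (hU.mem_nhds hx)
  have hfs : ∀ x ∈ Ω, x ≠ 0 → ContDiffAt ℝ 1 f x := fun x hx hx0 =>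
    contDiffAt_source hx0 (hK.smooth x hx) ((hu.smooth x hx hx0).of_le (by norm_num))
  have hf0 : ∀ x ∈ Ω, x ≠ 0 → 0 ≤ f x := fun x hx hx0 =>
    (source_pos hu.lam_pos hx0 (hk₀.trans_le (hK.ge x hx))).le
  have hps : ∀ x ∈ Ω, x ≠ 0 → ContDiffAt ℝ 1 p x := fun x hx hx0 =>
    (hu.smooth x hx hx0).fderiv_apply_right 1
  have hqs : ∀ x ∈ Ω, x ≠ 0 → ContDiffAt ℝ 1 q x := fun x hx hx0 =>
    (hu.smooth x hx hx0).fderiv_apply_right Complex.I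
  have hgrad := hu.tendsto_norm_mul_fderiv hα hK hU h0
  have hlim : ∀ v : ℂ, ‖v‖ = 1 → Tendsto (fun x => ‖x‖ * fderiv ℝ u x v) (𝓝[≠] 0) (𝓝 0) := by
    intro v hv
    refine squeeze_zero_norm (fun x => ?_) hgrad
    rw [norm_mul, norm_norm]
    gcongr
    simpa [hv] using (fderiv ℝ u x).le_opNorm v
  have hnhds : ∀ᶠ x in 𝓝[≠] (0 : ℂ), x ∈ Ω := mem_nhdsWithin_of_mem_nhds (hU.mem_nhds h0)
  have hab : ∀ᶠ x in 𝓝[≠] (0 : ℂ), |a x| ≤ C * ‖x‖ := by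
    filter_upwards [hnhds] with x hx using (Complex.abs_re_le_norm _).trans (hX.norm_le_mul x hx)
  have hbb : ∀ᶠ x in 𝓝[≠] (0 : ℂ), |b x| ≤ C * ‖x‖ := by
    filter_upwards [hnhds] with x hx using (Complex.abs_im_le_norm _).trans (hX.norm_le_mul x hx)
  have hsq := hu.tendsto_sq_mul_source hα hK hU h0
  have t1 := tendsto_norm_mul_stress A D (hlim 1 (by simp)) (hlim Complex.I (by simp)) hsq hab hbb
  have t2 := tendsto_norm_mul_stress A D (hlim Complex.I (by simp)) (hlim 1 (by simp)) hsq hbb hab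
  refine ⟨stress A D p q a b f, stress A D q p b a f, ε, hU, hb, hu.cont,
    fun x hx hx0 => (hu.smooth x hx hx0).of_le (by norm_num), hu.zero, hu.pos hK hU hb h0, hfs, hf0,
    fun x hx hx0 => ?_, fun x hx hx0 => ?_, by positivity, fun x hx hx0 => ?_, hε,
    fun x hx hx0 hux => ?_, ?_⟩
  · obtain ⟨h1, h2, -, -⟩ := contDiffAt_components (hXan x hx)
    exact contDiffAt_stress A D (hps x hx hx0) (hqs x hx hx0) h1 h2 (hfs x hx hx0)
  · obtain ⟨h1, h2, -, -⟩ := contDiffAt_components (hXan x hx)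
    exact contDiffAt_stress A D (hqs x hx hx0) (hps x hx hx0) h2 h1 (hfs x hx hx0)
  · obtain ⟨h1, h2, h3, h4⟩ := contDiffAt_components (hXan x hx)
    have hux := hu.smooth x hx hx0
    have hKx := hk₀.trans_le (hK.ge x hx)
    have hfd := (hasFDerivAt_source (α := α) (lam := lam) hx0 hKx.ne'
      ((hK.smooth x hx).differentiableAt one_ne_zero) (hux.differentiableAt two_ne_zero)).fderiv
    rw [div_stress A D ((hps x hx hx0).differentiableAt one_ne_zero)
      ((hqs x hx hx0).differentiableAt one_ne_zero) (h1.differentiableAt one_ne_zero)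
      (h2.differentiableAt one_ne_zero) ((hfs x hx hx0).differentiableAt one_ne_zero)
      (l₁ := logDiff α K x 1) (l₂ := logDiff α K x Complex.I)
      (fderiv_fderiv_comm hux 1 Complex.I) (hu.eq x hx hx0) (by rw [h3, h4]; simp)
      (by rw [h3, h4]; simp) (by rw [hfd]; simp [hp, hf, mul_add]) (by rw [hfd]; simp [hq, hf, mul_add])]
    have hre : |fderiv ℝ a x 1| ≤ C := by
      rw [h3, mul_one]
      exact (Complex.abs_re_le_norm _).trans (hX.norm_deriv_le x hx)
    have hl : a x * logDiff α K x 1 + b x * logDiff α K x Complex.I ≤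
        2 * |α| * C + k₁ / k₀ * C := by
      have e : a x * logDiff α K x 1 + b x * logDiff α K x Complex.I = logDiff α K x (X x) := by
        have : X x = (X x).re • (1 : ℂ) + (X x).im • Complex.I := by simp [Complex.re_add_im]
        conv_rhs => rw [this, map_add, map_smul, map_smul]
        rfl
      have hn : 0 < ‖x‖ := norm_pos_iff.2 hx0
      rw [e]
      calc logDiff α K x (X x) ≤ ‖logDiff α K x‖ * ‖X x‖ :=
            (le_abs_self _).trans ((logDiff α K x).le_opNorm _)
        _ ≤ (2 * |α| / ‖x‖ + k₁ / k₀) * ‖X x‖ := by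
            gcongr; exact hK.norm_logDiff_le α hx hx0
        _ = 2 * |α| / ‖x‖ * ‖X x‖ + k₁ / k₀ * ‖X x‖ := by ring
        _ ≤ 2 * |α| / ‖x‖ * (C * ‖x‖) + k₁ / k₀ * C := by
            gcongr
            · exact hX.norm_le_mul x hx
            · exact hX.norm_le x hx
        _ = _ := by field_simp
    have hre' := (abs_le.1 hre).2
    have h5 : A * f x * (a x * logDiff α K x 1 + b x * logDiff α K x Complex.I +
        2 * fderiv ℝ a x 1) ≤ A * f x * M := by
      have := hf0 x hx hx0
      gcongr
      rw [hM]; linarith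
    have h6 : A * f x * M = f x / 2 := by rw [hA]; field_simp
    have h7 : D * (2 * fderiv ℝ a x 1) ≤ D * (2 * C) := by gcongr
    linarith
  · refine stress_nonpos (p := p) (q := q) (a := a) (b := b) (f := f) (x := x) hA0.le hD0.le (c := 7 / 25 * c₀) (by positivity) hAD (hf0 x hx hx0) ?_
    have h1 := hcollar x hx hux
    rw [map_neg, fderiv_eq_grad, Complex.norm_def, Complex.normSq_apply] at h1
    simpa [grad, mul_assoc] using h1
  · filter_upwards [eventually_norm_mul_abs_le_one t1, eventually_norm_mul_abs_le_one t2]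
      with x h1 h2 hx0 using ⟨h1 hx0, h2 hx0⟩

theorem exists_mass_bound (hU : IsOpen Ω) (hb : Bornology.IsBounded Ω) (hsc : IsSimplyConnected Ω)
    (h0 : 0 ∈ Ω) (hch : HasCharts Ω) (hα : -1 < α) (hK : ContDiffOn ℝ 1 K (closure Ω))
    (hpos : ∀ x ∈ closure Ω, 0 < K x) :
    ∃ B > 0, ∀ lam u, IsSolution Ω α K lam u → ∫ x in Ω, source α K lam u x ≤ B := by
  obtain ⟨k₀, k₁, hw⟩ := exists_isWeight hU hb h0 hK hpos
  obtain ⟨X, C, c₀, hX⟩ := exists_field hU hb hsc h0 hch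
  obtain ⟨T, hT0, hT⟩ := exists_deriv_smoothTransition_le
  set M := 2 * |α| * C + k₁ / k₀ * C + 2 * C with hM
  set A := 1 / (2 * M) with hA
  set D := 1 / (2 * A * (7 / 25 * c₀) ^ 2) with hD
  refine ⟨max (2 * (D * (2 * C)) * volume.real Ω + 32 * T * π) 1, by positivity, fun lam u hu => ?_⟩
  obtain ⟨N₁, N₂, ε, h⟩ := hu.exists_isFlux hα hw hU hb h0 hX hM hA hD
  exact (h.integral_le hT0 hT).trans (le_max_left _ _)

end MassBound

section Charts

open Filter Topology

theorem ContDiffAt.continuousAt_lapC {w : ℂ → ℝ} {z : ℂ} (h : ContDiffAt ℝ 2 w z) :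
    ContinuousAt (lapC w) z := by
  have key : ∀ v : ℂ, ContinuousAt (fun x => fderiv ℝ (fun y => fderiv ℝ w y v) x v) z := fun v =>
    (((h.fderiv_apply_right v).fderiv_right (m := 0) (by norm_num)).clm_apply
      contDiffAt_const).continuousAt
  exact (key 1).add (key Complex.I)

theorem exists_bdryChart {Ω V : Set ℂ} {p : ℂ} {ρ : ℂ → ℝ} (hU : IsOpen Ω) (hp : p ∈ frontier Ω)
    (hV : V ∈ 𝓝 p) (hs : ∀ x ∈ V, ContDiffAt ℝ 2 ρ x) (hd : fderiv ℝ ρ p ≠ 0)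
    (hmem : ∀ x ∈ V, x ∈ Ω ↔ 0 < ρ x) (hfr : ∀ x ∈ V, x ∈ frontier Ω ↔ ρ x = 0) :
    ∃ n : ℂ, ‖n‖ = 1 ∧
      ∀ e : ℂ, ‖e‖ = 1 → 0 < (e * starRingEnd ℂ n).re → Nonempty (BdryChart Ω p e) := by
  have hρp : ρ p = 0 := (hfr p (mem_of_mem_nhds hV)).1 hp
  have hsp : ContDiffAt ℝ 2 ρ p := hs p (mem_of_mem_nhds hV)
  set G := grad ρ p with hG
  have hG0 : G ≠ 0 := fun h => hd (by ext; simp [fderiv_eq_grad, ← hG, h])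
  have hGn : 0 < ‖G‖ := norm_pos_iff.2 hG0
  refine ⟨(‖G‖⁻¹ : ℝ) * G, by simp [hGn.ne'], fun e he hen => ?_⟩
  have hde : 0 < fderiv ℝ ρ p e := by
    have : fderiv ℝ ρ p e = ‖G‖ * (e * starRingEnd ℂ ((‖G‖⁻¹ : ℝ) * G)).re := by
      rw [fderiv_eq_grad, ← hG]
      simp
      field_simp
    rw [this]; positivity
  set γ : ℂ → ℝ := fun x => fderiv ℝ ρ x 1 * fderiv ℝ ρ x 1 +
    fderiv ℝ ρ x Complex.I * fderiv ℝ ρ x Complex.I with hγ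
  have hγp : 0 < γ p := by
    have : γ p = ‖G‖ ^ 2 := by rw [Complex.sq_norm, Complex.normSq_apply]; rfl
    rw [this]; positivity
  set N := (|lapC ρ p| + 6) / (2 * γ p) with hN
  have hN0 : 0 ≤ N := by positivity
  have hNγ : N * (2 * γ p) = |lapC ρ p| + 6 := by rw [hN]; field_simp
  have hcd : ContinuousAt (fderiv ℝ ρ) p := (hsp.fderiv_right (m := 0) (by norm_num)).continuousAt
  have hca : ∀ v, ContinuousAt (fun x => fderiv ℝ ρ x v) p := fun v =>
    hcd.clm_apply continuousAt_const
  have hcγ : ContinuousAt γ p :=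
    ((hca 1).mul (hca 1)).add ((hca Complex.I).mul (hca Complex.I))
  have hcl := hsp.continuousAt_lapC
  have hcρ := hsp.continuousAt
  have hq : ∀ x ∈ V, lapC (fun y => N * (ρ y * ρ y)) x = N * (2 * ρ x * lapC ρ x + 2 * γ x) := by
    intro x hx
    rw [lapC_const_mul N ((hs x hx).mul (hs x hx)), lapC_mul (hs x hx) (hs x hx)]
    simp only [hγ]; ring
  have hcq : ContinuousAt (fun x => N * (2 * ρ x * lapC ρ x + 2 * γ x)) p := by fun_prop
  have ev : ∀ᶠ x in 𝓝 p, x ∈ V ∧ fderiv ℝ ρ p e / 2 ≤ fderiv ℝ ρ x e ∧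
      ‖fderiv ℝ ρ x‖ ≤ ‖fderiv ℝ ρ p‖ + 1 ∧ N * |ρ x| ≤ 1 / 2 ∧
      lapC ρ x - N * (2 * ρ x * lapC ρ x + 2 * γ x) ≤ -1 ∧
      5 ≤ lapC ρ x + N * (2 * ρ x * lapC ρ x + 2 * γ x) := by
    refine (eventually_mem_set.2 hV).and (((hca e).eventually_const_le (half_lt_self hde)).and
      ((hcd.norm.eventually_le_const (lt_add_one _)).and
        (((continuousAt_const.mul hcρ.abs).eventually_le_const (by simp [hρp])).and
          (((hcl.sub hcq).eventually_le_const ?_).and ((hcl.add hcq).eventually_const_le ?_)))))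
    · simp only [Pi.sub_apply]; rw [hρp]; linarith [le_abs_self (lapC ρ p)]
    · simp only [Pi.add_apply]; rw [hρp]; linarith [neg_abs_le (lapC ρ p)]
  obtain ⟨R, hR, h⟩ := Metric.eventually_nhds_iff_ball.1 ev
  exact ⟨{
    ρ := ρ
    R := R
    m := fderiv ℝ ρ p e / 2
    L := ‖fderiv ℝ ρ p‖ + 1
    N := N
    isOpen := hU
    mem := hp
    norm_e := he
    R_pos := hR
    m_pos := half_pos hde
    L_pos := by positivity
    N_nonneg := hN0
    smooth := fun x hx => hs x (h x hx).1
    mem_iff := fun x hx => hmem x (h x hx).1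
    frontier_iff := fun x hx => hfr x (h x hx).1
    le_deriv := fun x hx => (h x hx).2.1
    norm_le := fun x hx => (h x hx).2.2.1
    small := fun x hx => (h x hx).2.2.2.1
    lap_sub := fun x hx => by
      have hx' := hs x (h x hx).1
      rw [lapC_sub hx' (contDiffAt_const.mul (hx'.mul hx')), hq x (h x hx).1]
      exact (h x hx).2.2.2.2.1
    lap_add := fun x hx => by
      have hx' := hs x (h x hx).1
      rw [lapC_add hx' (contDiffAt_const.mul (hx'.mul hx')), hq x (h x hx).1]
      exact (h x hx).2.2.2.2.2 }⟩

end Charts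

section Plane

open Filter Topology

/-- The standard isometry between `ℂ` and the Euclidean plane. -/
def toPlane : ℂ ≃ₗᵢ[ℝ] Plane := Complex.orthonormalBasisOneI.repr

theorem toPlane_one : toPlane 1 = EuclideanSpace.single 0 1 := by
  have := Complex.orthonormalBasisOneI.repr_self 0
  simpa [toPlane] using this

theorem toPlane_I : toPlane Complex.I = EuclideanSpace.single 1 1 := by
  have := Complex.orthonormalBasisOneI.repr_self 1
  simpa [toPlane] using this

theorem fderiv_comp_toPlane (w : Plane → ℝ) (z v : ℂ) :
    fderiv ℝ (fun y => w (toPlane y)) z v = fderiv ℝ w (toPlane z) (toPlane v) := by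
  have := toPlane.toContinuousLinearEquiv.comp_right_fderiv (f := w) (x := z)
  exact congrArg (fun L => L v) this

theorem lapC_comp_toPlane (w : Plane → ℝ) (z : ℂ) :
    lapC (fun y => w (toPlane y)) z = lap w (toPlane z) := by
  unfold lapC lap
  simp only [fderiv_comp_toPlane, Fin.sum_univ_two, toPlane_one, toPlane_I]
  rw [fderiv_comp_toPlane (fun x => fderiv ℝ w x (EuclideanSpace.single 0 1)),
    fderiv_comp_toPlane (fun x => fderiv ℝ w x (EuclideanSpace.single 1 1)), toPlane_one, toPlane_I]

theorem contDiffAt_comp_toPlane {n : WithTop ℕ∞} {w : Plane → ℝ} {z : ℂ}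
    (h : ContDiffAt ℝ n w (toPlane z)) : ContDiffAt ℝ n (fun y => w (toPlane y)) z :=
  h.comp z toPlane.contDiff.contDiffAt

theorem closure_preimage_toPlane (s : Set Plane) :
    closure (toPlane ⁻¹' s) = toPlane ⁻¹' closure s :=
  (toPlane.toHomeomorph.preimage_closure s).symm

theorem frontier_preimage_toPlane (s : Set Plane) :
    frontier (toPlane ⁻¹' s) = toPlane ⁻¹' frontier s :=
  (toPlane.toHomeomorph.preimage_frontier s).symm

theorem SmoothBoundary.hasCharts {Ω : Set Plane} (h : SmoothBoundary Ω) (hU : IsOpen Ω) :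
    HasCharts (toPlane ⁻¹' Ω) := by
  intro p hp
  have hp' := hp
  rw [frontier_preimage_toPlane] at hp'
  obtain ⟨U, f, hUo, hpU, hf, hd, hin, hbd⟩ := h _ hp'
  have hc := toPlane.continuous
  refine exists_bdryChart (V := toPlane ⁻¹' U) (ρ := fun y => -f (toPlane y)) (hU.preimage hc) hp
    ((hUo.preimage hc).mem_nhds hpU) (fun x hx => ?_) (fun hz => ?_) (fun x hx => ?_) (fun x hx => ?_)
  · exact (contDiffAt_comp_toPlane ((hf.contDiffAt (hUo.mem_nhds hx)).of_le
      (WithTop.coe_le_coe.2 (le_top : (2 : ℕ∞) ≤ ⊤)))).neg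
  · refine hd _ hpU ?_
    ext v
    have h1 := congrArg (fun L => L (toPlane.symm v)) hz
    rw [fderiv_fun_neg] at h1
    simpa [fderiv_comp_toPlane] using h1
  · have h1 : toPlane x ∈ Ω ∩ U ↔ toPlane x ∈ {y ∈ U | f y < 0} := by rw [hin]
    have hx' : toPlane x ∈ U := hx
    simpa [hx'] using h1
  · have h1 : toPlane x ∈ frontier Ω ∩ U ↔ toPlane x ∈ {y ∈ U | f y = 0} := by rw [hbd]
    have hx' : toPlane x ∈ U := hx
    rw [frontier_preimage_toPlane]
    simpa [hx'] using h1

theorem setIntegral_toPlane (Ω : Set Plane) (g : Plane → ℝ) :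
    ∫ z in toPlane ⁻¹' Ω, g (toPlane z) = ∫ x in Ω, g x :=
  toPlane.measurePreserving.setIntegral_preimage_emb
    toPlane.toHomeomorph.measurableEmbedding g Ω

end Plane

/-- Uniform mass bound for the singular Liouville equation on a bounded, simply connected
planar domain with smooth boundary. -/
theorem mass_bound_liouville (Ω : Set Plane) (hΩo : IsOpen Ω)
    (hΩb : Bornology.IsBounded Ω) (hΩsc : SimplyConnectedSpace Ω)
    (hΩsm : SmoothBoundary Ω) (h0 : (0 : Plane) ∈ Ω)
    (α : ℝ) (hα : -1 < α)
    (K : Plane → ℝ) (hK : ContDiffOn ℝ 1 K (closure Ω))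
    (hKpos : ∀ x ∈ closure Ω, 0 < K x) :
    ∃ ρ₀ > 0, ∀ (lam : ℝ), 0 < lam → ∀ u : Plane → ℝ,
      ContinuousOn u (closure Ω) → ContDiffOn ℝ 2 u (Ω \ {0}) →
      (∀ x ∈ Ω \ {0}, -lap u x = lam * ‖x‖ ^ (2 * α) * K x * Real.exp (u x)) →
      (∀ x ∈ frontier Ω, u x = 0) →
      lam * ∫ x in Ω, ‖x‖ ^ (2 * α) * K x * Real.exp (u x) ≤ ρ₀ := by
  have hc := toPlane.continuous
  have hsc : IsSimplyConnected (toPlane ⁻¹' Ω) :=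
    (toPlane.toHomeomorph.isSimplyConnected_preimage (s := Ω)).2 hΩsc
  have hb : Bornology.IsBounded (toPlane ⁻¹' Ω) := by
    have := toPlane.symm.lipschitz.isBounded_image hΩb
    rwa [LinearIsometryEquiv.image_eq_preimage_symm] at this
  have hK' : ContDiffOn ℝ 1 (fun z => K (toPlane z)) (closure (toPlane ⁻¹' Ω)) := by
    rw [closure_preimage_toPlane]
    exact hK.comp toPlane.contDiff.contDiffOn fun _ hx => hx
  have hpos : ∀ z ∈ closure (toPlane ⁻¹' Ω), 0 < K (toPlane z) := by
    rw [closure_preimage_toPlane]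
    exact fun z hz => hKpos _ hz
  obtain ⟨B, hB, h⟩ := exists_mass_bound (hΩo.preimage hc) hb hsc (by simpa using h0)
    (hΩsm.hasCharts hΩo) hα hK' hpos
  refine ⟨B, hB, fun lam hlam u hu hu2 heq hz => ?_⟩
  have hne : ∀ z : ℂ, z ≠ 0 → toPlane z ≠ 0 := fun z hz => by simpa using hz
  have hsol : IsSolution (toPlane ⁻¹' Ω) α (fun z => K (toPlane z)) lam (fun z => u (toPlane z)) := by
    refine ⟨hlam, ?_, fun z hz hz0 => ?_, fun z hz hz0 => ?_, ?_⟩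
    · rw [closure_preimage_toPlane]
      exact hu.comp hc.continuousOn fun _ hx => hx
    · exact contDiffAt_comp_toPlane
        (hu2.contDiffAt ((hΩo.sdiff isClosed_singleton).mem_nhds ⟨hz, hne z hz0⟩))
    · have := heq _ ⟨hz, hne z hz0⟩
      rw [lapC_comp_toPlane, source, ← toPlane.norm_map z]
      linarith
    · rw [frontier_preimage_toPlane]
      exact fun z hz' => hz _ hz'
  have key := h lam _ hsol
  rw [← integral_const_mul, ← setIntegral_toPlane]
  refine le_of_eq_of_le ?_ key
  congr 1
  ext z
  rw [source, toPlane.norm_map]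
  ring
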